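/- Let n ≥ 2, d ≥ 1 and let A = (A₀,…,A_d) be a tuple of real n×n matrices whose (d+1)n² entries are i.i.d. standard normal N(0,1) random variables. Then E[μ(A)] = √π · (Γ((d+1)n²/2)/Γ(((d+1)n²−1)/2)) · ℋ^{n²−2}({M ∈ M(n,ℝ) : det M = 0, ‖M‖_F = 1}) / ℋ^{n²−2}(S^{n²−2}), i.e., the expected condition number equals √π times the stated ratio of Gamma values times the ratio of the (n²−2)-dimensional Hausdorff volume of the unit-sphere slice of the singular-matrix hypersurface to the volume of the standard (n²−2)-sphere. -/

import Mathlib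

open MeasureTheory ProbabilityTheory Real
open scoped ENNReal Matrix Classical

namespace PEVP

/-- Tuples of `d+1` real `n × n` matrices, as bare functions (for the product measure). -/
abbrev MatTuple (n d : ℕ) := Fin (d + 1) → Fin n → Fin n → ℝ

/-- The Gaussian measure on tuples: all `(d+1)·n²` entries are i.i.d. `N(0,1)`. -/
noncomputable def gaussTuple (n d : ℕ) : Measure (MatTuple n d) :=
  Measure.pi fun _ => Measure.pi fun _ => Measure.pi fun _ => gaussianReal 0 1

/-- The matrix `P(A,α,β) = ∑ αⁱ β^{d-i} Aᵢ`. -/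
noncomputable def Pmat (n d : ℕ) (A : MatTuple n d) (α β : ℝ) : Matrix (Fin n) (Fin n) ℝ :=
  ∑ i : Fin (d + 1), (α ^ (i : ℕ) * β ^ (d - (i : ℕ))) • Matrix.of (A i)

/-- `(α,β)` is a polynomial eigenvalue of `A`. -/
def IsPEV (n d : ℕ) (A : MatTuple n d) (α β : ℝ) : Prop := (Pmat n d A α β).det = 0

/-- `∂P/∂α (A,α,β)`. -/
noncomputable def Pα (n d : ℕ) (A : MatTuple n d) (α β : ℝ) : Matrix (Fin n) (Fin n) ℝ :=
  ∑ i : Fin (d + 1), (((i : ℕ) : ℝ) * α ^ ((i : ℕ) - 1) * β ^ (d - (i : ℕ))) • Matrix.of (A i)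

/-- `∂P/∂β (A,α,β)`. -/
noncomputable def Pβ (n d : ℕ) (A : MatTuple n d) (α β : ℝ) : Matrix (Fin n) (Fin n) ℝ :=
  ∑ i : Fin (d + 1),
    (((d : ℝ) - ((i : ℕ) : ℝ)) * α ^ (i : ℕ) * β ^ (d - (i : ℕ) - 1)) • Matrix.of (A i)

/-- The vector `v = β·(∂P/∂α)·r − α·(∂P/∂β)·r`. -/
noncomputable def vvec (n d : ℕ) (A : MatTuple n d) (α β : ℝ) (r : Fin n → ℝ) : Fin n → ℝ :=
  β • (Pα n d A α β).mulVec r - α • (Pβ n d A α β).mulVec r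

/-- `r` spans the (one-dimensional) kernel of `P(A,α,β)`, `ℓ` spans the kernel of its
transpose, and `ℓᵗ v ≠ 0`. -/
def GoodPair (n d : ℕ) (A : MatTuple n d) (α β : ℝ) (r ℓ : Fin n → ℝ) : Prop :=
  r ≠ 0 ∧ ℓ ≠ 0 ∧
    LinearMap.ker (Matrix.toLin' (Pmat n d A α β)) = Submodule.span ℝ {r} ∧
    LinearMap.ker (Matrix.toLin' (Pmat n d A α β)ᵀ) = Submodule.span ℝ {ℓ} ∧
    ∑ j, ℓ j * vvec n d A α β r j ≠ 0

/-- Euclidean norm of a vector in `ℝⁿ`. -/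
noncomputable def vnorm (n : ℕ) (r : Fin n → ℝ) : ℝ := Real.sqrt (∑ j, r j ^ 2)

/-- The norm `‖A‖ = (∑ᵢ ‖Aᵢ‖_F²)^{1/2}` of a tuple of matrices. -/
noncomputable def tnorm (n d : ℕ) (A : MatTuple n d) : ℝ :=
  Real.sqrt (∑ i, ∑ j, ∑ k, A i j k ^ 2)

/-- The value `(∑ α^{2k} β^{2(d-k)})^{1/2} · (‖r‖‖ℓ‖ / |ℓᵗv|) · ‖A‖`. -/
noncomputable def muVal (n d : ℕ) (A : MatTuple n d) (α β : ℝ) (r ℓ : Fin n → ℝ) : ℝ :=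
  Real.sqrt (∑ k ∈ Finset.range (d + 1), α ^ (2 * k) * β ^ (2 * (d - k))) *
    (vnorm n r * vnorm n ℓ / |∑ j, ℓ j * vvec n d A α β r j|) * tnorm n d A

/-- The local condition number `μ(A,(α,β)) ∈ [0,∞]`. -/
noncomputable def muLoc (n d : ℕ) (A : MatTuple n d) (α β : ℝ) : ℝ≥0∞ :=
  if h : ∃ p : (Fin n → ℝ) × (Fin n → ℝ), GoodPair n d A α β p.1 p.2 then
    ENNReal.ofReal (muVal n d A α β h.choose.1 h.choose.2)
  else ⊤

/-- A set of canonical representatives for `ℝP¹`: one unit vector in each pair `±(α,β)`. -/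
def circleReps : Set (ℝ × ℝ) :=
  {x | x.1 ^ 2 + x.2 ^ 2 = 1 ∧ (0 < x.2 ∨ (x.2 = 0 ∧ x.1 = 1))}

/-- The polynomial eigenvalues of `A`, as (canonical representatives of) points of `ℝP¹`. -/
def pevReps (n d : ℕ) (A : MatTuple n d) : Set (ℝ × ℝ) :=
  {x ∈ circleReps | IsPEV n d A x.1 x.2}

/-- The condition number `μ(A) ∈ [0,∞]`: the sum of the local condition numbers over all
polynomial eigenvalues `[α:β] ∈ ℝP¹`, set to `∞` when there are infinitely many of them. -/
noncomputable def muTotal (n d : ℕ) (A : MatTuple n d) : ℝ≥0∞ :=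
  if (pevReps n d A).Infinite then ⊤
  else ∑' x : pevReps n d A, muLoc n d A x.1.1 x.1.2


/-- Real `n × n` matrices as a Euclidean space (Frobenius metric). -/
abbrev EMat (n : ℕ) := EuclideanSpace ℝ (Fin n × Fin n)

/-- The matrix corresponding to a point of `EMat n`. -/
noncomputable def matOfE (n : ℕ) (M : EMat n) : Matrix (Fin n) (Fin n) ℝ :=
  Matrix.of fun p q => M (p, q)

section AreaFormula

variable {E : Type*} [NormedAddCommGroup E] [NormedSpace ℝ E] [FiniteDimensional ℝ E]
  [MeasurableSpace E] [BorelSpace E]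

/-- A map with everywhere invertible derivative is injective on the pieces of a countable
measurable partition. -/
theorem exists_partition_injOn_of_det_ne_zero {f : E → E} {f' : E → E →L[ℝ] E} {s : Set E}
    (hf' : ∀ x ∈ s, HasFDerivWithinAt f (f' x) s x) (hdet : ∀ x ∈ s, (f' x).det ≠ 0) :
    ∃ t : ℕ → Set E, Pairwise (Function.onFun Disjoint t) ∧ (∀ n, MeasurableSet (t n)) ∧
      (s ⊆ ⋃ n, t n) ∧ ∀ n, Set.InjOn f (s ∩ t n) := by
  rcases s.eq_empty_or_nonempty with rfl | hne
  · exact ⟨fun _ => ∅, by simp [Pairwise, Function.onFun], by simp, by simp, by simp⟩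
  let r : (E →L[ℝ] E) → NNReal := fun A =>
    if h : A.det ≠ 0 then
      if ‖((A.toContinuousLinearEquivOfDetNeZero h).symm : E →L[ℝ] E)‖₊ = 0 then 1
      else ‖((A.toContinuousLinearEquivOfDetNeZero h).symm : E →L[ℝ] E)‖₊⁻¹ / 2
    else 1
  have rpos : ∀ A, r A ≠ 0 := by
    intro A
    simp only [r]
    split_ifs with h1 h2 <;> simp_all
  obtain ⟨t, A, h1, h2, h3, h4, h5⟩ :=
    exists_partition_approximatesLinearOn_of_hasFDerivWithinAt f s f' hf' r rpos
  refine ⟨t, h1, h2, h3, fun n => ?_⟩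
  obtain ⟨y, hy, hA⟩ := h5 hne n
  have hd : (A n).det ≠ 0 := by rw [hA]; exact hdet y hy
  have := h4 n
  rw [← ContinuousLinearMap.coe_toContinuousLinearEquivOfDetNeZero (A n) hd] at this
  refine this.injOn ?_
  rcases ((A n).toContinuousLinearEquivOfDetNeZero hd).subsingleton_or_nnnorm_symm_pos with h | h
  · exact Or.inl h
  · right
    simp only [ContinuousLinearMap.coe_toContinuousLinearEquivOfDetNeZero, r, dif_pos hd,
      if_neg h.ne']
    exact NNReal.half_lt_self (by simpa using h.ne')

/-- Area formula with multiplicity for maps with invertible derivative. -/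
theorem lintegral_tsum_preimage_eq (μ : Measure E) [μ.IsAddHaarMeasure] {f : E → E}
    {f' : E → E →L[ℝ] E} {s : Set E} (hs : MeasurableSet s)
    (hf' : ∀ x ∈ s, HasFDerivWithinAt f (f' x) s x) (hdet : ∀ x ∈ s, (f' x).det ≠ 0)
    {g : E → ℝ≥0∞} (hg : Measurable g) :
    Measurable (fun y => ∑' x : E, Set.indicator {x | x ∈ s ∧ f x = y} g x) ∧
    ∫⁻ y, ∑' x : E, Set.indicator {x | x ∈ s ∧ f x = y} g x ∂μ =
      ∫⁻ x in s, ENNReal.ofReal |(f' x).det| * g x ∂μ := by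
  obtain ⟨t, h1, h2, h3, h4⟩ := exists_partition_injOn_of_det_ne_zero hf' hdet
  have hst : ∀ n, MeasurableSet (s ∩ t n) := fun n => hs.inter (h2 n)
  have hd : ∀ n, ∀ x ∈ s ∩ t n, HasFDerivWithinAt f (f' x) (s ∩ t n) x :=
    fun n x hx => (hf' x hx.1).mono Set.inter_subset_left
  let h : ℕ → E → ℝ≥0∞ := fun n =>
    Function.extend ((s ∩ t n).domRestrict f) (fun x => g x.1) 0
  have hm : ∀ n, Measurable (h n) := fun n =>
    (measurableEmbedding_of_fderivWithin (hst n) (hd n) (h4 n)).measurable_extend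
      (hg.comp measurable_subtype_coe) measurable_const
  have hinj : ∀ n, Function.Injective ((s ∩ t n).domRestrict f) := fun n =>
    (measurableEmbedding_of_fderivWithin (hst n) (hd n) (h4 n)).injective
  have hin : ∀ n, ∀ x ∈ s ∩ t n, h n (f x) = g x := fun n x hx =>
    (hinj n).extend_apply (fun x => g x.1) 0 ⟨x, hx⟩
  have hout : ∀ n, ∀ y, y ∉ f '' (s ∩ t n) → h n y = 0 := by
    intro n y hy
    refine Function.extend_apply' _ _ _ ?_
    rintro ⟨a, rfl⟩
    exact hy ⟨a, a.2, rfl⟩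
  have hsum : (fun y => ∑' x : E, Set.indicator {x | x ∈ s ∧ f x = y} g x) =
      fun y => ∑' n, h n y := by
    funext y
    have e1 : ∀ x : E, Set.indicator {x | x ∈ s ∧ f x = y} g x =
        ∑' n, Set.indicator {x | x ∈ s ∩ t n ∧ f x = y} g x := by
      intro x
      by_cases hx : x ∈ s ∧ f x = y
      · obtain ⟨m, hm⟩ := Set.mem_iUnion.1 (h3 hx.1)
        rw [tsum_eq_single m]
        · rw [Set.indicator_of_mem, Set.indicator_of_mem] <;> simp [hx, hm]
        · intro k hk
          refine Set.indicator_of_notMem ?_ _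
          rintro ⟨⟨-, hxk⟩, -⟩
          exact Set.disjoint_left.1 (h1 hk) hxk hm
      · rw [Set.indicator_of_notMem (s := {x | x ∈ s ∧ f x = y}) hx]
        symm
        refine ENNReal.tsum_eq_zero.2 fun n => Set.indicator_of_notMem ?_ _
        rintro ⟨⟨hxs, -⟩, hxy⟩
        exact hx ⟨hxs, hxy⟩
    simp_rw [e1]
    rw [ENNReal.tsum_comm]
    refine tsum_congr fun n => ?_
    by_cases hy : y ∈ f '' (s ∩ t n)
    · obtain ⟨x, hx, rfl⟩ := hy
      rw [tsum_eq_single x, hin n x hx, Set.indicator_of_mem]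
      · exact ⟨hx, rfl⟩
      · intro z hz
        refine Set.indicator_of_notMem ?_ _
        rintro ⟨hz1, hz2⟩
        exact hz (h4 n hz1 hx hz2)
    · rw [hout n y hy]
      refine ENNReal.tsum_eq_zero.2 fun x => Set.indicator_of_notMem ?_ _
      rintro ⟨hx, hxy⟩
      exact hy ⟨x, hx, hxy⟩
  refine ⟨by rw [hsum]; exact Measurable.tsum hm, ?_⟩
  rw [hsum, lintegral_tsum fun n => (hm n).aemeasurable]
  have key : ∀ n, ∫⁻ y, h n y ∂μ =
      ∫⁻ x in s ∩ t n, ENNReal.ofReal |(f' x).det| * g x ∂μ := by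
    intro n
    have e : h n = Set.indicator (f '' (s ∩ t n)) (h n) := by
      funext y
      by_cases hy : y ∈ f '' (s ∩ t n)
      · rw [Set.indicator_of_mem hy]
      · rw [Set.indicator_of_notMem hy, hout n y hy]
    have hmi : MeasurableSet (f '' (s ∩ t n)) :=
      measurable_image_of_fderivWithin (hst n) (hd n) (h4 n)
    rw [e, lintegral_indicator hmi,
      lintegral_image_eq_lintegral_abs_det_fderiv_mul μ (hst n) (hd n) (h4 n)]
    refine setLIntegral_congr_fun (hst n) fun x hx => ?_
    simp only [hin n x hx]
  simp_rw [key]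
  rw [← lintegral_iUnion hst fun i j hij => (h1 hij).mono Set.inter_subset_right
    Set.inter_subset_right]
  rw [← Set.inter_iUnion, Set.inter_eq_left.2 h3]

end AreaFormula

section Fubini

variable {E : Type*} [NormedAddCommGroup E] [NormedSpace ℝ E] [FiniteDimensional ℝ E]
  [MeasurableSpace E] [BorelSpace E]

/-- A measurable set whose intersections with all lines of a given direction are null is null. -/
theorem measure_eq_zero_of_forall_line (μ : Measure E) [μ.IsAddHaarMeasure] {s : Set E}
    (hs : MeasurableSet s) (v : E) (h : ∀ w, volume {r : ℝ | w + r • v ∈ s} = 0) : μ s = 0 := by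
  have hm : Measurable fun p : ℝ × E => s.indicator (fun _ => (1 : ℝ≥0∞)) (p.2 + p.1 • v) :=
    (measurable_const.indicator hs).comp (by fun_prop)
  have e1 : ∫⁻ r in Set.Icc (0 : ℝ) 1, ∫⁻ w, s.indicator (fun _ => (1 : ℝ≥0∞)) (w + r • v) ∂μ
      = μ s := by
    simp_rw [lintegral_add_right_eq_self (μ := μ) (fun w => s.indicator (fun _ => (1 : ℝ≥0∞)) w)]
    rw [lintegral_indicator hs]
    simp
  rw [← e1, lintegral_lintegral_swap hm.aemeasurable]
  refine lintegral_eq_zero_of_ae_eq_zero (Filter.Eventually.of_forall fun w => ?_)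
  have hms : MeasurableSet {r : ℝ | w + r • v ∈ s} := by
    have : Measurable fun r : ℝ => w + r • v := by fun_prop
    exact this hs
  refine le_antisymm ?_ zero_le
  calc ∫⁻ r in Set.Icc (0 : ℝ) 1, s.indicator (fun _ => (1 : ℝ≥0∞)) (w + r • v)
      ≤ ∫⁻ r, s.indicator (fun _ => (1 : ℝ≥0∞)) (w + r • v) := setLIntegral_le_lintegral _ _
    _ = ∫⁻ r, {r : ℝ | w + r • v ∈ s}.indicator (fun _ => (1 : ℝ≥0∞)) r := rfl
    _ = 0 := by rw [lintegral_indicator hms]; simp [h w]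

/-- Replacing the coordinate `ℓ` along `e₀` of a vector by an independent copy. -/
theorem lintegral_lintegral_resample (μ : Measure E) [μ.IsAddHaarMeasure] (ℓ : E →L[ℝ] ℝ) (e₀ : E)
    (h0 : ℓ e₀ = 1) {f : ℝ → ℝ≥0∞} (hf : Measurable f) {H : E → ℝ≥0∞} (hH : Measurable H) :
    ∫⁻ A, (∫⁻ r, f (ℓ A) * H (A + (r - ℓ A) • e₀)) ∂μ = (∫⁻ r, f r) * ∫⁻ A, H A ∂μ := by
  have e1 : ∀ A, ∫⁻ r, f (ℓ A) * H (A + (r - ℓ A) • e₀) = ∫⁻ r, f (ℓ A) * H (A + r • e₀) :=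
    fun A => lintegral_sub_right_eq_self (μ := (volume : Measure ℝ))
      (fun r => f (ℓ A) * H (A + r • e₀)) (ℓ A)
  simp_rw [e1]
  rw [lintegral_lintegral_swap (by fun_prop)]
  have e2 : ∀ r : ℝ, ∫⁻ A, f (ℓ A) * H (A + r • e₀) ∂μ = ∫⁻ A, f (ℓ A - r) * H A ∂μ := by
    intro r
    rw [← lintegral_add_right_eq_self (μ := μ) (fun A => f (ℓ A - r) * H A) (r • e₀)]
    refine lintegral_congr fun A => ?_
    simp [h0]
  simp_rw [e2]
  rw [lintegral_lintegral_swap (by fun_prop)]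
  have e3 : ∀ A, ∫⁻ r, f (ℓ A - r) * H A = (∫⁻ r, f r) * H A := by
    intro A
    rw [lintegral_mul_const _ (by fun_prop)]
    congr 1
    exact lintegral_sub_left_eq_self f (ℓ A)
  simp_rw [e3]
  rw [lintegral_const_mul _ hH]

end Fubini

section PiDensity

variable {ι : Type*} [Fintype ι] {X : ι → Type*} [∀ i, MeasurableSpace (X i)]

/-- A finite product of measures with integrable densities has the product density. -/
theorem pi_withDensity_ofReal (μ : ∀ i, Measure (X i)) [∀ i, SigmaFinite (μ i)]
    {p : ∀ i, X i → ℝ} (hp : ∀ i x, 0 ≤ p i x)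
    (hi : ∀ i, Integrable (p i) (μ i)) :
    Measure.pi (fun i => (μ i).withDensity fun x => ENNReal.ofReal (p i x)) =
      (Measure.pi μ).withDensity fun x => ENNReal.ofReal (∏ i, p i (x i)) := by
  have hfin : ∀ i, IsFiniteMeasure ((μ i).withDensity fun x => ENNReal.ofReal (p i x)) :=
    fun i => isFiniteMeasure_withDensity_ofReal (hi i).2
  refine Measure.pi_eq fun s hs => ?_
  have hms : MeasurableSet (Set.univ.pi s) := MeasurableSet.univ_pi hs
  rw [withDensity_apply _ hms, ← lintegral_indicator hms]
  have e1 : ∀ x : ∀ i, X i, (Set.univ.pi s).indicator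
      (fun x => ENNReal.ofReal (∏ i, p i (x i))) x =
      ENNReal.ofReal (∏ i, (s i).indicator (p i) (x i)) := by
    intro x
    by_cases hx : x ∈ Set.univ.pi s
    · rw [Set.indicator_of_mem hx]
      congr 1
      exact Finset.prod_congr rfl fun i _ => (Set.indicator_of_mem (hx i trivial) _).symm
    · rw [Set.indicator_of_notMem hx]
      obtain ⟨i, hi⟩ : ∃ i, x i ∉ s i := by simpa [Set.mem_pi] using hx
      rw [Finset.prod_eq_zero (Finset.mem_univ i) (Set.indicator_of_notMem hi _)]
      simp
  have hi' : ∀ i, Integrable ((s i).indicator (p i)) (μ i) := fun i => (hi i).indicator (hs i)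
  have hp' : ∀ i x, 0 ≤ (s i).indicator (p i) x := fun i x =>
    Set.indicator_nonneg (fun x _ => hp i x) x
  simp_rw [e1]
  rw [← ofReal_integral_eq_lintegral_ofReal (Integrable.fintype_prod_dep hi')
    (Filter.Eventually.of_forall fun x => Finset.prod_nonneg fun i _ => hp' i _),
    integral_fintype_prod_eq_prod, ENNReal.ofReal_prod_of_nonneg fun i _ =>
      integral_nonneg (hp' i)]
  refine Finset.prod_congr rfl fun i _ => ?_
  rw [ofReal_integral_eq_lintegral_ofReal (hi' i) (Filter.Eventually.of_forall (hp' i)),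
    withDensity_apply _ (hs i), ← lintegral_indicator (hs i)]
  refine lintegral_congr fun x => ?_
  by_cases hx : x ∈ s i <;> simp [hx]

end PiDensity

section HausdorffArea

/-- Comparison of Hausdorff measures of two images of a set. -/
theorem hausdorffMeasure_image_le_of_dist_le {X Y Z : Type*} [MetricSpace Y] [MeasurableSpace Y]
    [BorelSpace Y] [MetricSpace Z] [MeasurableSpace Z] [BorelSpace Z] {f : X → Y} {g : X → Z}
    {t : Set X} {K : NNReal}
    (h : ∀ x ∈ t, ∀ y ∈ t, dist (f x) (f y) ≤ K * dist (g x) (g y)) {d : ℝ} (hd : 0 ≤ d) :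
    μH[d] (f '' t) ≤ (K : ℝ≥0∞) ^ d * μH[d] (g '' t) := by
  rcases t.eq_empty_or_nonempty with rfl | ⟨x₀, hx₀⟩
  · simp
  have : Nonempty X := ⟨x₀⟩
  have hL : LipschitzOnWith K (f ∘ Function.invFunOn g t) (g '' t) := by
    refine LipschitzOnWith.of_dist_le_mul ?_
    rintro _ ⟨x, hx, rfl⟩ _ ⟨y, hy, rfl⟩
    have hx' : ∃ a ∈ t, g a = g x := ⟨x, hx, rfl⟩
    have hy' : ∃ a ∈ t, g a = g y := ⟨y, hy, rfl⟩
    have := h _ (Function.invFunOn_mem hx') _ (Function.invFunOn_mem hy')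
    rwa [Function.invFunOn_eq hx', Function.invFunOn_eq hy'] at this
  have e : f '' t = (f ∘ Function.invFunOn g t) '' (g '' t) := by
    rw [Set.image_image]
    refine Set.image_congr fun x hx => ?_
    have hx' : ∃ a ∈ t, g a = g x := ⟨x, hx, rfl⟩
    have := h x hx _ (Function.invFunOn_mem hx')
    rw [Function.invFunOn_eq hx'] at this
    simpa using this
  rw [e]
  exact hL.hausdorffMeasure_image_le hd

variable {U V : Type*} [NormedAddCommGroup U] [InnerProductSpace ℝ U] [FiniteDimensional ℝ U]
  [NormedAddCommGroup V] [InnerProductSpace ℝ V]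

/-- A map close enough to an injective linear map is bi-Lipschitz with respect to it. -/
theorem exists_dist_le_of_approximatesLinearOn (A : U →L[ℝ] V)
    (hA : LinearMap.ker (A : U →ₗ[ℝ] V) = ⊥) {K : NNReal} (hK : 1 < K) :
    ∃ c : NNReal, 0 < c ∧ ∀ (f : U → V) (t : Set U), ApproximatesLinearOn f A t c →
      ∀ x ∈ t, ∀ y ∈ t, dist (f x) (f y) ≤ K * dist (A x) (A y) ∧
        dist (A x) (A y) ≤ K * dist (f x) (f y) := by
  obtain ⟨M, hM, hAM⟩ := (A : U →ₗ[ℝ] V).exists_antilipschitzWith hA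
  have hK' : (1 : ℝ) < K := by exact_mod_cast hK
  have hM' : (0 : ℝ) < M := by exact_mod_cast hM
  have hc0 : (0 : ℝ) < ((K : ℝ) - 1) / K / M := by apply div_pos (div_pos _ _) <;> linarith
  refine ⟨(((K : ℝ) - 1) / K / M).toNNReal, Real.toNNReal_pos.2 hc0, ?_⟩
  · intro f t hf x hx y hy
    have h1 := hf x hx y hy
    rw [Real.coe_toNNReal _ hc0.le] at h1
    have h2 := hAM.le_mul_dist x y
    have h3 : (A : U →ₗ[ℝ] V) x = A x := rfl
    have h4 : (A : U →ₗ[ℝ] V) y = A y := rfl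
    rw [h3, h4] at h2
    set D := dist (A x) (A y) with hD
    have h5 : ‖f x - f y - A (x - y)‖ ≤ (K - 1) / K * D := by
      refine h1.trans ?_
      rw [dist_eq_norm] at h2
      calc ((K : ℝ) - 1) / K / M * ‖x - y‖ ≤ ((K : ℝ) - 1) / K / M * (M * D) := by
            gcongr
        _ = (K - 1) / K * D := by field_simp
    have h6 : ‖A (x - y)‖ = D := by rw [hD, dist_eq_norm, map_sub]
    have h7 : dist (f x) (f y) ≤ D + (K - 1) / K * D := by
      rw [dist_eq_norm]
      calc ‖f x - f y‖ = ‖A (x - y) + (f x - f y - A (x - y))‖ := by congr 1; abel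
        _ ≤ _ := (norm_add_le _ _).trans (by rw [h6]; linarith)
    have h8 : D ≤ dist (f x) (f y) + (K - 1) / K * D := by
      rw [dist_eq_norm]
      calc D = ‖(f x - f y) - (f x - f y - A (x - y))‖ := by rw [← h6]; congr 1; abel
        _ ≤ _ := (norm_sub_le _ _).trans (by linarith)
    have hD0 : 0 ≤ D := dist_nonneg
    constructor
    · have : 1 + ((K : ℝ) - 1) / K ≤ K := by
        rw [← sub_nonneg]
        have : (K : ℝ) - (1 + (K - 1) / K) = (K - 1) ^ 2 / K := by field_simp; ring
        rw [this]; positivity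
      nlinarith
    · have h9 : D * (1 / K) ≤ dist (f x) (f y) := by
        have : D * (1 / (K : ℝ)) = D - (K - 1) / K * D := by field_simp; ring
        linarith
      rw [mul_one_div, div_le_iff₀ (by linarith)] at h9
      linarith

theorem continuous_normDet : Continuous fun A : U →L[ℝ] V => (A : U →ₗ[ℝ] V).normDet := by
  have : (fun A : U →L[ℝ] V => (A : U →ₗ[ℝ] V).normDet) = fun A =>
      √(Matrix.gram ℝ fun i => A (stdOrthonormalBasis ℝ U i)).det := by
    funext A
    rw [eq_comm, Real.sqrt_eq_iff_eq_sq]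
    · exact ((A : U →ₗ[ℝ] V).normDet_sq_eq_det_gram (stdOrthonormalBasis ℝ U)).symm
    · have := (A : U →ₗ[ℝ] V).normDet_sq_eq_det_gram (stdOrthonormalBasis ℝ U)
      simp only [RCLike.ofReal_real_eq_id, id_eq] at this
      refine le_of_le_of_eq (sq_nonneg _) this
    · exact LinearMap.normDet_nonneg _
  rw [this]
  refine Real.continuous_sqrt.comp (Continuous.matrix_det ?_)
  refine continuous_matrix fun i j => ?_
  simp only [Matrix.gram_apply]
  fun_prop

/-- Near every point, a `C¹` immersion is bi-Lipschitz close to its derivative. -/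
theorem exists_partition_dist_le {f : U → V} {f' : U → U →L[ℝ] V} [MeasurableSpace U]
    [BorelSpace U] {s : Set U} (hs : IsOpen s)
    (hf : ∀ x ∈ s, HasStrictFDerivAt f (f' x) x) (hc : ContinuousOn f' s)
    (hker : ∀ x ∈ s, LinearMap.ker (f' x : U →ₗ[ℝ] V) = ⊥) {K : NNReal} (hK : 1 < K) :
    ∃ (t : ℕ → Set U) (A : ℕ → U →L[ℝ] V), Pairwise (Function.onFun Disjoint t) ∧
      (∀ n, MeasurableSet (t n)) ∧ (⋃ n, t n) = s ∧
      (∀ n, ∀ x ∈ t n, ∀ y ∈ t n, dist (f x) (f y) ≤ K * dist (A n x) (A n y) ∧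
        dist (A n x) (A n y) ≤ K * dist (f x) (f y)) ∧
      ∀ n, ∀ x ∈ t n, (f' x : U →ₗ[ℝ] V).normDet ≤ K * (A n : U →ₗ[ℝ] V).normDet ∧
        (A n : U →ₗ[ℝ] V).normDet ≤ K * (f' x : U →ₗ[ℝ] V).normDet := by
  rcases s.eq_empty_or_nonempty with rfl | hne
  · exact ⟨fun _ => ∅, fun _ => 0, by simp [Pairwise, Function.onFun], by simp, by simp, by simp,
      by simp⟩
  have hK' : (1 : ℝ) < K := by exact_mod_cast hK
  have hloc : ∀ x ∈ s, ∃ W : Set U, IsOpen W ∧ x ∈ W ∧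
      (∀ y ∈ W, ∀ z ∈ W, dist (f y) (f z) ≤ K * dist (f' x y) (f' x z) ∧
        dist (f' x y) (f' x z) ≤ K * dist (f y) (f z)) ∧
      ∀ y ∈ W, (f' y : U →ₗ[ℝ] V).normDet ≤ K * (f' x : U →ₗ[ℝ] V).normDet ∧
        (f' x : U →ₗ[ℝ] V).normDet ≤ K * (f' y : U →ₗ[ℝ] V).normDet := by
    intro x hx
    obtain ⟨c, hc0, hcf⟩ := exists_dist_le_of_approximatesLinearOn (f' x) (hker x hx) hK
    obtain ⟨W1, hW1, hW1f⟩ := (hf x hx).approximates_deriv_on_nhds (Or.inr hc0)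
    have hJ : ContinuousAt (fun y => (f' y : U →ₗ[ℝ] V).normDet) x :=
      continuous_normDet.continuousAt.comp (hc.continuousAt (hs.mem_nhds hx))
    have hpos : 0 < (f' x : U →ₗ[ℝ] V).normDet := by
      refine lt_of_le_of_ne (LinearMap.normDet_nonneg _) (Ne.symm ?_)
      rw [Ne, LinearMap.normDet_eq_zero_iff_ker_ne_bot]
      simpa using hker x hx
    have h1 : ∀ᶠ y in nhds x, (f' y : U →ₗ[ℝ] V).normDet <
        K * (f' x : U →ₗ[ℝ] V).normDet :=
      hJ.eventually_lt continuousAt_const (by nlinarith)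
    have h2 : ∀ᶠ y in nhds x, (f' x : U →ₗ[ℝ] V).normDet <
        K * (f' y : U →ₗ[ℝ] V).normDet :=
      continuousAt_const.eventually_lt (continuousAt_const.mul hJ) (by nlinarith)
    obtain ⟨W, hW, hWo, hxW⟩ := mem_nhds_iff.1 (Filter.inter_mem hW1 (h1.and h2))
    exact ⟨W, hWo, hxW, hcf f W (hW1f.mono_set fun y hy => (hW hy).1),
      fun y hy => ⟨(hW hy).2.1.le, (hW hy).2.2.le⟩⟩
  choose! W hWo hxW hW1 hW2 using hloc
  obtain ⟨T, hTs, hTc, hT⟩ := TopologicalSpace.countable_cover_nhdsWithin (f := W) (s := s)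
    fun x hx => mem_nhdsWithin_of_mem_nhds ((hWo x hx).mem_nhds (hxW x hx))
  have hTne : T.Nonempty := by
    rw [Set.nonempty_iff_ne_empty]
    rintro rfl
    simp only [Set.mem_empty_iff_false, Set.iUnion_of_empty, Set.iUnion_empty] at hT
    exact hne.ne_empty (Set.subset_empty_iff.1 hT)
  obtain ⟨u, rfl⟩ := hTc.exists_eq_range hTne
  have hu : ∀ n, u n ∈ s := fun n => hTs ⟨n, rfl⟩
  have hsub : ∀ n, s ∩ disjointed (fun n => W (u n)) n ⊆ W (u n) := fun n =>
    Set.inter_subset_right.trans (disjointed_subset _ _)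
  refine ⟨fun n => s ∩ disjointed (fun n => W (u n)) n, fun n => f' (u n), ?_, ?_, ?_, ?_, ?_⟩
  · intro i j hij
    exact (disjoint_disjointed _ hij).mono Set.inter_subset_right Set.inter_subset_right
  · exact fun n => hs.measurableSet.inter
      (MeasurableSet.disjointed (fun n => (hWo _ (hu n)).measurableSet) n)
  · rw [← Set.inter_iUnion, iUnion_disjointed, Set.inter_eq_left]
    simpa using hT
  · exact fun n x hx y hy => hW1 _ (hu n) x (hsub n hx) y (hsub n hy)
  · exact fun n x hx => hW2 _ (hu n) x (hsub n hx)

/-- Area formula for injective immersions and the Hausdorff measure. -/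
theorem hausdorffMeasure_image_eq_lintegral_normDet [MeasurableSpace U] [BorelSpace U]
    [FiniteDimensional ℝ V] [MeasurableSpace V] [BorelSpace V] {f : U → V}
    {f' : U → U →L[ℝ] V} {s : Set U} (hs : IsOpen s)
    (hf : ∀ x ∈ s, HasStrictFDerivAt f (f' x) x) (hc : ContinuousOn f' s)
    (hker : ∀ x ∈ s, LinearMap.ker (f' x : U →ₗ[ℝ] V) = ⊥) (hinj : Set.InjOn f s) :
    μH[Module.finrank ℝ U] (f '' s) =
      ∫⁻ x in s, ENNReal.ofReal (f' x : U →ₗ[ℝ] V).normDet ∂μH[Module.finrank ℝ U] := by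
  set k : ℝ := (Module.finrank ℝ U : ℝ)
  have hk : 0 ≤ k := Nat.cast_nonneg _
  have hcf : ContinuousOn f s := fun x hx => (hf x hx).continuousAt.continuousWithinAt
  have hbound : ∀ K : NNReal, 1 < K →
      μH[k] (f '' s) ≤ (K : ℝ≥0∞) ^ (k + 1) *
        ∫⁻ x in s, ENNReal.ofReal (f' x : U →ₗ[ℝ] V).normDet ∂μH[k] ∧
      ∫⁻ x in s, ENNReal.ofReal (f' x : U →ₗ[ℝ] V).normDet ∂μH[k] ≤
        (K : ℝ≥0∞) ^ (k + 1) * μH[k] (f '' s) := by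
    intro K hK
    obtain ⟨t, A, ht1, ht2, rfl, ht4, ht5⟩ := exists_partition_dist_le hs hf hc hker hK
    have hK0 : (K : ℝ≥0∞) ≠ 0 := by
      have : K ≠ 0 := (zero_lt_one.trans hK).ne'
      exact_mod_cast this
    have hpow : (K : ℝ≥0∞) ^ (k + 1) = (K : ℝ≥0∞) ^ k * K := by
      rw [ENNReal.rpow_add _ _ hK0 ENNReal.coe_ne_top, ENNReal.rpow_one]
    have hlin : ∀ n, μH[k] (A n '' t n) =
        ENNReal.ofReal (A n : U →ₗ[ℝ] V).normDet * μH[k] (t n) := fun n =>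
      (A n : U →ₗ[ℝ] V).hausdorffMeasure_image (t n)
    have hsub : ∀ n, t n ⊆ ⋃ n, t n := Set.subset_iUnion t
    have hmimg : ∀ n, MeasurableSet (f '' t n) := fun n =>
      (ht2 n).image_of_continuousOn_injOn (hcf.mono (hsub n)) (hinj.mono (hsub n))
    have hdimg : Pairwise (Function.onFun Disjoint fun n => f '' t n) := by
      intro i j hij
      exact Set.disjoint_image_image fun x hx y hy hxy => by
        have := hinj (hsub i hx) (hsub j hy) hxy
        subst this
        exact Set.disjoint_left.1 (ht1 hij) hx hy
    rw [Set.image_iUnion, measure_iUnion hdimg hmimg, lintegral_iUnion ht2 ht1,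
      ← ENNReal.tsum_mul_left, ← ENNReal.tsum_mul_left]
    have hKc : ENNReal.ofReal (K : ℝ) = K := ENNReal.ofReal_coe_nnreal
    constructor
    · refine ENNReal.tsum_le_tsum fun n => ?_
      calc μH[k] (f '' t n) ≤ (K : ℝ≥0∞) ^ k * μH[k] (A n '' t n) :=
            hausdorffMeasure_image_le_of_dist_le
              (fun x hx y hy => (ht4 n x hx y hy).1) hk
        _ = (K : ℝ≥0∞) ^ k * ∫⁻ x in t n, ENNReal.ofReal (A n : U →ₗ[ℝ] V).normDet ∂μH[k] := by
            rw [hlin, setLIntegral_const]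
        _ ≤ (K : ℝ≥0∞) ^ k * ∫⁻ x in t n, K *
              ENNReal.ofReal (f' x : U →ₗ[ℝ] V).normDet ∂μH[k] := by
            gcongr (K : ℝ≥0∞) ^ k * ?_
            refine setLIntegral_mono' (ht2 n) fun x hx => ?_
            rw [← hKc, ← ENNReal.ofReal_mul K.coe_nonneg]
            exact ENNReal.ofReal_le_ofReal (ht5 n x hx).2
        _ = _ := by rw [lintegral_const_mul' _ _ ENNReal.coe_ne_top, hpow, mul_assoc]
    · refine ENNReal.tsum_le_tsum fun n => ?_
      calc ∫⁻ x in t n, ENNReal.ofReal (f' x : U →ₗ[ℝ] V).normDet ∂μH[k]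
          ≤ ∫⁻ x in t n, K * ENNReal.ofReal (A n : U →ₗ[ℝ] V).normDet ∂μH[k] := by
            refine setLIntegral_mono' (ht2 n) fun x hx => ?_
            rw [← hKc, ← ENNReal.ofReal_mul K.coe_nonneg]
            exact ENNReal.ofReal_le_ofReal (ht5 n x hx).1
        _ = K * μH[k] (A n '' t n) := by
            rw [lintegral_const_mul' _ _ ENNReal.coe_ne_top, hlin, setLIntegral_const]
        _ ≤ K * ((K : ℝ≥0∞) ^ k * μH[k] (f '' t n)) := by
            gcongr
            exact hausdorffMeasure_image_le_of_dist_le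
              (fun x hx y hy => (ht4 n x hx y hy).2) hk
        _ = _ := by rw [hpow]; ring
  have hlim : ∀ b : ℝ≥0∞, Filter.Tendsto (fun K : NNReal => (K : ℝ≥0∞) ^ (k + 1) * b)
      (nhdsWithin 1 (Set.Ioi 1)) (nhds b) := by
    intro b
    have h1 : Filter.Tendsto (fun K : NNReal => (K : ℝ≥0∞) ^ (k + 1)) (nhds 1) (nhds 1) := by
      have : Continuous fun K : NNReal => (K : ℝ≥0∞) ^ (k + 1) :=
        ENNReal.continuous_rpow_const.comp ENNReal.continuous_coe
      simpa using this.tendsto 1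
    have h2 := ENNReal.Tendsto.mul_const (b := b) h1 (Or.inl one_ne_zero)
    rw [one_mul] at h2
    exact h2.mono_left nhdsWithin_le_nhds
  have hev : ∀ᶠ K : NNReal in nhdsWithin 1 (Set.Ioi 1), 1 < K := self_mem_nhdsWithin
  exact le_antisymm (ge_of_tendsto (hlim _) (hev.mono fun K hK => (hbound K hK).1))
    (ge_of_tendsto (hlim _) (hev.mono fun K hK => (hbound K hK).2))

end HausdorffArea

/-- Strictly differentiable images of subsets of coordinate affine subspaces of small dimension
are null for the Hausdorff measure. -/
theorem hausdorffMeasure_image_eq_zero_of_coord {ι F : Type*} [Fintype ι] [NormedAddCommGroup F]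
    [NormedSpace ℝ F] [MeasurableSpace F] [BorelSpace F] (S : Finset ι) (c : ι → ℝ)
    {s : Set (EuclideanSpace ℝ ι)} (hs : ∀ x ∈ s, ∀ a ∈ S, x a = c a)
    {f : EuclideanSpace ℝ ι → F}
    (hf : ∀ x ∈ s, ∃ f' : EuclideanSpace ℝ ι →L[ℝ] F, HasStrictFDerivAt f f' x) {d : NNReal}
    (hd : (Fintype.card ι : ℝ) - S.card < d) : μH[d] (f '' s) = 0 := by
  let emb : ({a // a ∉ S} → ℝ) → EuclideanSpace ℝ ι := fun y =>
    WithLp.toLp 2 fun a => if h : a ∉ S then y ⟨a, h⟩ else c a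
  have hemb : ContDiff ℝ 1 emb := by
    rw [contDiff_euclidean]
    intro a
    by_cases h : a ∈ S
    · simp only [emb, h, not_true_eq_false, dite_false]
      exact contDiff_const
    · simp only [emb, h, not_false_eq_true, dite_true]
      fun_prop
  have hsub : s ⊆ Set.range emb := by
    intro x hx
    refine ⟨fun a => x a, ?_⟩
    ext a
    by_cases h : a ∈ S
    · simp [emb, h, hs x hx a h]
    · simp [emb, h]
  have hdim : dimH s ≤ Fintype.card {a // a ∉ S} := by
    refine (dimH_mono hsub).trans (hemb.dimH_range_le.trans ?_)
    simp
  have hdim' : dimH (f '' s) ≤ Fintype.card {a // a ∉ S} := by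
    refine (dimH_image_le_of_locally_lipschitzOn fun x hx => ?_).trans hdim
    obtain ⟨f', hf'⟩ := hf x hx
    obtain ⟨K, t, ht, hK⟩ := hf'.exists_lipschitzOnWith
    exact ⟨K, t, mem_nhdsWithin_of_mem_nhds ht, hK⟩
  refine hausdorffMeasure_of_dimH_lt (hdim'.trans_lt ?_)
  have hcard : (Fintype.card {a // a ∉ S} : ℝ) = Fintype.card ι - S.card := by
    rw [Fintype.card_subtype_compl, Nat.cast_sub]
    · simp
    · simpa using Finset.card_le_univ S
  have : (Fintype.card {a // a ∉ S} : NNReal) < d := by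
    rw [← NNReal.coe_lt_coe, NNReal.coe_natCast, hcard]
    exact hd
  exact_mod_cast this

section Cone

variable {F : Type*} [NormedAddCommGroup F] [InnerProductSpace ℝ F]

/-- The function `t` on the open set `U` is homogeneous of degree one and independent of the
coordinate along `o`. -/
structure IsConeGraph (o : F) (U : Set F) (t : F → ℝ) (t' : F → F →L[ℝ] ℝ) : Prop where
  isOpen : IsOpen U
  hasStrictFDerivAt : ∀ V ∈ U, HasStrictFDerivAt t (t' V) V
  continuousOn : ContinuousOn t' U
  add_mem : ∀ V ∈ U, ∀ r : ℝ, V + r • o ∈ U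
  add_eq : ∀ V ∈ U, ∀ r : ℝ, t (V + r • o) = t V
  smul_mem : ∀ V ∈ U, ∀ r : ℝ, r ≠ 0 → r • V ∈ U
  smul_eq : ∀ V ∈ U, ∀ r : ℝ, r ≠ 0 → t (r • V) = r * t V

namespace IsConeGraph

variable {o : F} {U : Set F} {t : F → ℝ} {t' : F → F →L[ℝ] ℝ}

theorem add_mem_iff (h : IsConeGraph o U t t') {V : F} {r : ℝ} : V + r • o ∈ U ↔ V ∈ U := by
  refine ⟨fun hV => ?_, fun hV => h.add_mem V hV r⟩
  simpa [add_assoc, ← add_smul] using h.add_mem _ hV (-r)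

theorem smul_mem_iff (h : IsConeGraph o U t t') {V : F} {r : ℝ} (hr : r ≠ 0) :
    r • V ∈ U ↔ V ∈ U := by
  refine ⟨fun hV => ?_, fun hV => h.smul_mem V hV r hr⟩
  simpa [smul_smul, inv_mul_cancel₀ hr] using h.smul_mem _ hV r⁻¹ (inv_ne_zero hr)

theorem apply_axis (h : IsConeGraph o U t t') {V : F} (hV : V ∈ U) : t' V o = 0 := by
  have h1 : HasDerivAt (fun r : ℝ => V + r • o) o 0 := by
    simpa using ((hasDerivAt_id (0 : ℝ)).smul_const o).const_add V
  have h2 : HasFDerivAt t (t' V) (V + (0 : ℝ) • o) := by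
    simpa using (h.hasStrictFDerivAt V hV).hasFDerivAt
  have h3 := h2.comp_hasDerivAt (0 : ℝ) h1
  have h4 : t ∘ (fun r : ℝ => V + r • o) = fun _ => t V := funext fun r => h.add_eq V hV r
  rw [h4] at h3
  exact h3.unique (hasDerivAt_const _ _)

theorem apply_self (h : IsConeGraph o U t t') {V : F} (hV : V ∈ U) : t' V V = t V := by
  have h1 : HasDerivAt (fun r : ℝ => r • V) V 1 := by
    simpa using (hasDerivAt_id (1 : ℝ)).smul_const V
  have h2 : HasFDerivAt t (t' V) ((1 : ℝ) • V) := by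
    simpa using (h.hasStrictFDerivAt V hV).hasFDerivAt
  have h3 := h2.comp_hasDerivAt (1 : ℝ) h1
  have h4 : t ∘ (fun r : ℝ => r • V) =ᶠ[nhds 1] fun r => r * t V := by
    filter_upwards [eventually_ne_nhds (one_ne_zero (α := ℝ))] with r hr
    exact h.smul_eq V hV r hr
  have h5 : HasDerivAt (fun r : ℝ => r * t V) (t V) 1 := by
    simpa using (hasDerivAt_id (1 : ℝ)).mul_const (t V)
  exact h3.unique (h5.congr_of_eventuallyEq h4)

theorem deriv_smul (h : IsConeGraph o U t t') {V : F} (hV : V ∈ U) {r : ℝ} (hr : r ≠ 0) :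
    t' (r • V) = t' V := by
  have h1 : HasFDerivAt (fun W : F => r • W) (r • ContinuousLinearMap.id ℝ F) V :=
    (hasFDerivAt_id V).const_smul r
  have h2 := (h.hasStrictFDerivAt _ (h.smul_mem V hV r hr)).hasFDerivAt.comp V h1
  have h4 : t ∘ (fun W : F => r • W) =ᶠ[nhds V] fun W => r * t W := by
    filter_upwards [h.isOpen.mem_nhds hV] with W hW
    exact h.smul_eq W hW r hr
  have h5 := (h.hasStrictFDerivAt V hV).hasFDerivAt.const_mul r
  have h6 := h2.unique (h5.congr_of_eventuallyEq h4)
  ext W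
  have := DFunLike.congr_fun h6 W
  simpa [hr] using this

theorem deriv_add (h : IsConeGraph o U t t') {V : F} (hV : V ∈ U) (r : ℝ) :
    t' (V + r • o) = t' V := by
  have h1 : HasFDerivAt (fun W : F => W + r • o) (ContinuousLinearMap.id ℝ F) V :=
    (hasFDerivAt_id V).add_const _
  have h2 := (h.hasStrictFDerivAt _ (h.add_mem V hV r)).hasFDerivAt.comp V h1
  have h4 : t ∘ (fun W : F => W + r • o) =ᶠ[nhds V] t := by
    filter_upwards [h.isOpen.mem_nhds hV] with W hW
    exact h.add_eq W hW r
  have h6 := h2.unique ((h.hasStrictFDerivAt V hV).hasFDerivAt.congr_of_eventuallyEq h4)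
  simpa using h6

theorem continuousOn_fun (h : IsConeGraph o U t t') : ContinuousOn t U := fun V hV =>
  (h.hasStrictFDerivAt V hV).hasFDerivAt.continuousAt.continuousWithinAt

end IsConeGraph

/-- The Riemannian density of a graph whose slope is `t'`. -/
noncomputable def graphDensity (t' : F → F →L[ℝ] ℝ) (V : F) : ℝ := √(1 + ‖t' V‖ ^ 2)

theorem graphDensity_pos (t' : F → F →L[ℝ] ℝ) (V : F) : 0 < graphDensity t' V := by
  unfold graphDensity; positivity

theorem IsConeGraph.continuousOn_graphDensity {o : F} {U : Set F} {t : F → ℝ} {t' : F → F →L[ℝ] ℝ}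
    (hc : IsConeGraph o U t t') :
    ContinuousOn (graphDensity t') U :=
  (((hc.continuousOn.norm).pow 2).const_add 1).sqrt

/-- `o`, `i` are orthonormal and `E` is the orthogonal complement of their span. -/
structure IsFrame (o i : F) (E : Submodule ℝ F) : Prop where
  norm_o : ‖o‖ = 1
  norm_i : ‖i‖ = 1
  inner_oi : inner ℝ o i = 0
  inner_o : ∀ z ∈ E, inner ℝ o z = 0
  inner_i : ∀ z ∈ E, inner ℝ i z = 0
  mem : ∀ V : F, V - (inner ℝ o V : ℝ) • o - (inner ℝ i V : ℝ) • i ∈ E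

theorem hasStrictFDerivAt_normalize {G : Type*} [NormedAddCommGroup G] [NormedSpace ℝ G]
    {q : G → F} {q' : G →L[ℝ] F} {x : G} (h : HasStrictFDerivAt q q' x) (h0 : q x ≠ 0) :
    HasStrictFDerivAt (fun y => ‖q y‖⁻¹ • q y)
      (‖q x‖⁻¹ • q' - ((‖q x‖⁻¹ ^ 3) • (innerSL ℝ (q x)).comp q').smulRight (q x)) x := by
  have hn : ‖q x‖ ≠ 0 := norm_ne_zero_iff.2 h0
  have h1 : HasStrictFDerivAt (fun y => ‖q y‖ ^ 2) (2 • (innerSL ℝ (q x)).comp q') x :=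
    (hasStrictFDerivAt_norm_sq (q x)).comp x h
  have h2 := (h1.sqrt (by positivity))
  simp only [Real.sqrt_sq (norm_nonneg _)] at h2
  have h3 := ((hasStrictDerivAt_inv hn).comp_hasStrictFDerivAt x h2).smul h
  refine h3.congr_fderiv ?_
  ext v
  simp only [add_apply, smul_apply,
    ContinuousLinearMap.smulRight_apply, sub_apply,
    ContinuousLinearMap.comp_apply, smul_eq_mul, Function.comp, nsmul_eq_mul]
  rw [sub_eq_add_neg, ← neg_smul]
  congr 2
  field_simp
  simp

end Cone

section Frame

variable {F : Type*} [NormedAddCommGroup F] [InnerProductSpace ℝ F] {o i : F} {E : Submodule ℝ F}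

namespace IsFrame

theorem inner_oo (h : IsFrame o i E) : (inner ℝ o o : ℝ) = 1 := by
  simp [h.norm_o]

theorem inner_ii (h : IsFrame o i E) : (inner ℝ i i : ℝ) = 1 := by
  simp [h.norm_i]

theorem inner_io (h : IsFrame o i E) : (inner ℝ i o : ℝ) = 0 := by
  rw [real_inner_comm, h.inner_oi]

theorem inner_zo (h : IsFrame o i E) {z : F} (hz : z ∈ E) : (inner ℝ z o : ℝ) = 0 := by
  rw [real_inner_comm, h.inner_o z hz]

theorem inner_zi (h : IsFrame o i E) {z : F} (hz : z ∈ E) : (inner ℝ z i : ℝ) = 0 := by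
  rw [real_inner_comm, h.inner_i z hz]

theorem inner_combo (h : IsFrame o i E) (a a' c c' : ℝ) {z z' : F} (hz : z ∈ E) (hz' : z' ∈ E) :
    (inner ℝ (a • o + c • i + z) (a' • o + c' • i + z') : ℝ) = a * a' + c * c' + inner ℝ z z' := by
  simp only [inner_add_left, inner_add_right, inner_smul_left, inner_smul_right, h.inner_oo,
    h.inner_ii, h.inner_oi, h.inner_io, h.inner_o z' hz', h.inner_i z' hz', h.inner_zo hz,
    h.inner_zi hz]
  simp
  ring

theorem norm_combo (h : IsFrame o i E) (a c : ℝ) {z : F} (hz : z ∈ E) :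
    ‖a • o + c • i + z‖ ^ 2 = a ^ 2 + c ^ 2 + ‖z‖ ^ 2 := by
  rw [← real_inner_self_eq_norm_sq, h.inner_combo a a c c hz hz, real_inner_self_eq_norm_sq]
  ring

theorem inner_o_combo (h : IsFrame o i E) (a c : ℝ) {z : F} (hz : z ∈ E) :
    (inner ℝ o (a • o + c • i + z) : ℝ) = a := by
  simpa using h.inner_combo 1 a 0 c (E.zero_mem) hz

theorem inner_i_combo (h : IsFrame o i E) (a c : ℝ) {z : F} (hz : z ∈ E) :
    (inner ℝ i (a • o + c • i + z) : ℝ) = c := by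
  simpa using h.inner_combo 0 a 1 c (E.zero_mem) hz

theorem norm_dual_sq [FiniteDimensional ℝ F] (h : IsFrame o i E) {κ : Type*} [Fintype κ]
    (b : OrthonormalBasis κ ℝ E) (ℓ : F →L[ℝ] ℝ) :
    ‖ℓ‖ ^ 2 = ℓ o ^ 2 + ℓ i ^ 2 + ∑ a, ℓ (b a) ^ 2 := by
  obtain ⟨g, rfl⟩ := (InnerProductSpace.toDual ℝ F).surjective ℓ
  rw [LinearIsometryEquiv.norm_map]
  simp only [InnerProductSpace.toDual_apply_apply]
  set z := g - (inner ℝ o g : ℝ) • o - (inner ℝ i g : ℝ) • i with hz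
  have hzE : z ∈ E := h.mem g
  have hg : g = (inner ℝ o g : ℝ) • o + (inner ℝ i g : ℝ) • i + z := by rw [hz]; abel
  have h1 := h.norm_combo (inner ℝ o g) (inner ℝ i g) hzE
  rw [← hg] at h1
  rw [h1, real_inner_comm o g, real_inner_comm i g]
  congr 1
  have h2 := b.sum_sq_norm_inner_right ⟨z, hzE⟩
  change _ = ‖z‖ ^ 2 at h2
  rw [← h2]
  refine Finset.sum_congr rfl fun a _ => ?_
  have h3 : (inner ℝ (b a) (⟨z, hzE⟩ : E) : ℝ) = inner ℝ g (b a) := by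
    rw [Submodule.coe_inner, real_inner_comm]
    change inner ℝ z (b a : F) = inner ℝ g (b a : F)
    rw [hz, inner_sub_left, inner_sub_left, inner_smul_left, inner_smul_left,
      h.inner_o _ (b a).2, h.inner_i _ (b a).2]
    simp
  rw [h3, Real.norm_eq_abs, sq_abs]

end IsFrame

theorem det_one_add_rank_two {κ : Type*} [Fintype κ] [DecidableEq κ] (u w : κ → ℝ) (e : ℝ) :
    (Matrix.of fun a b => (if a = b then 1 else 0) + u a * u b - e * (w a * w b) :
      Matrix κ κ ℝ).det = (1 + ∑ a, u a ^ 2) * (1 - e * ∑ a, w a ^ 2) +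
        e * (∑ a, u a * w a) ^ 2 := by
  let X : Matrix κ (Fin 2) ℝ := Matrix.of fun a => ![u a, w a]
  let Y : Matrix (Fin 2) κ ℝ := Matrix.of ![u, fun a => -e * w a]
  have h : (Matrix.of fun a b => (if a = b then 1 else 0) + u a * u b - e * (w a * w b) :
      Matrix κ κ ℝ) = 1 + X * Y := by
    ext a b
    simp [X, Y, Matrix.mul_apply, Fin.sum_univ_two, Matrix.one_apply]
    ring
  rw [h, Matrix.det_one_add_mul_comm, Matrix.det_fin_two]
  simp only [Matrix.add_apply, Matrix.mul_apply, X, Y, Matrix.of_apply, Matrix.one_apply,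
    Matrix.cons_val_zero, Matrix.cons_val_one, if_true, Fin.isValue, zero_ne_one, one_ne_zero,
    if_false, zero_add]
  have e1 : ∑ a, u a * w a = ∑ a, w a * u a := Finset.sum_congr rfl fun a _ => mul_comm _ _
  have e2 : ∀ f g : κ → ℝ, ∑ a, -e * f a * g a = -e * ∑ a, f a * g a := fun f g => by
    rw [Finset.mul_sum]; exact Finset.sum_congr rfl fun a _ => by ring
  simp only [e2, sq, e1]
  ring

theorem normDet_radial_projection_graph [FiniteDimensional ℝ F] (h : IsFrame o i E) {y : E} {T : ℝ}
    {ℓ : F →L[ℝ] ℝ} (hℓo : ℓ o = 0) (hℓ : ℓ (i + y) = T) {ρ : ℝ} (hρ : 0 < ρ)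
    (hρ2 : ρ ^ 2 = T ^ 2 + 1 + ‖y‖ ^ 2) (L : E →ₗ[ℝ] F)
    (hL : ∀ z : E, L z = ρ⁻¹ • ((z : F) + ℓ z • o) -
      (ρ⁻¹ ^ 3 * inner ℝ (i + y + T • o : F) ((z : F) + ℓ z • o)) • (i + y + T • o : F)) :
    L.normDet = ρ⁻¹ ^ (Module.finrank ℝ E + 1) * √(1 + ‖ℓ‖ ^ 2) := by
  let b := stdOrthonormalBasis ℝ E
  have hq : ∀ z : E, (inner ℝ (i + y + T • o : F) ((z : F) + ℓ z • o) : ℝ) =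
      inner ℝ y z + T * ℓ z := by
    intro z
    have := h.inner_combo T (ℓ z) 1 0 y.2 z.2
    rw [Submodule.coe_inner]
    calc _ = (inner ℝ (T • o + (1 : ℝ) • i + (y : F)) (ℓ z • o + (0 : ℝ) • i + (z : F)) : ℝ) := by
          congr 1
          · rw [one_smul]; abel
          · rw [zero_smul]; abel
      _ = _ := by rw [this]; ring
  have hzz : ∀ z z' : E, (inner ℝ ((z : F) + ℓ z • o) ((z' : F) + ℓ z' • o) : ℝ) =
      inner ℝ z z' + ℓ z * ℓ z' := by
    intro z z'
    have := h.inner_combo (ℓ z) (ℓ z') 0 0 z.2 z'.2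
    rw [Submodule.coe_inner]
    calc _ = (inner ℝ (ℓ z • o + (0 : ℝ) • i + (z : F)) (ℓ z' • o + (0 : ℝ) • i + (z' : F)) : ℝ) := by
          congr 1 <;> rw [zero_smul] <;> abel
      _ = _ := by rw [this]; ring
  have hqq : (inner ℝ (i + y + T • o : F) (i + y + T • o : F) : ℝ) = ρ ^ 2 := by
    have := h.inner_combo T T 1 1 y.2 y.2
    rw [hρ2, ← Submodule.norm_coe, ← real_inner_self_eq_norm_sq]
    calc _ = (inner ℝ (T • o + (1 : ℝ) • i + (y : F)) (T • o + (1 : ℝ) • i + (y : F)) : ℝ) := by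
          congr 1 <;> rw [one_smul] <;> abel
      _ = _ := by rw [this]; ring
  have hgram : ∀ z z' : E, (inner ℝ (L z) (L z') : ℝ) = ρ⁻¹ ^ 2 *
      (inner ℝ z z' + ℓ z * ℓ z' - ρ⁻¹ ^ 2 * ((inner ℝ y z + T * ℓ z) * (inner ℝ y z' + T * ℓ z'))) := by
    intro z z'
    rw [hL, hL]
    simp only [inner_sub_left, inner_sub_right, inner_smul_left, inner_smul_right]
    rw [real_inner_comm (i + y + T • o : F) ((z : F) + ℓ z • o), hq, hq, hzz, hqq]
    simp only [conj_trivial]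
    field_simp
    ring
  let u : Fin (Module.finrank ℝ E) → ℝ := fun a => ℓ (b a)
  let w : Fin (Module.finrank ℝ E) → ℝ := fun a => inner ℝ y (b a) + T * ℓ (b a)
  have hdet : L.normDet ^ 2 = (ρ⁻¹ ^ 2) ^ (Module.finrank ℝ E) *
      ((1 + ∑ a, u a ^ 2) * (1 - ρ⁻¹ ^ 2 * ∑ a, w a ^ 2) + ρ⁻¹ ^ 2 * (∑ a, u a * w a) ^ 2) := by
    have h1 := LinearMap.normDet_sq_eq_det_gram L b
    rw [RCLike.ofReal_real_eq_id, id] at h1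
    rw [h1, ← det_one_add_rank_two u w (ρ⁻¹ ^ 2)]
    have h2 : Matrix.gram ℝ (fun a => L (b a)) = (ρ⁻¹ ^ 2) • (Matrix.of fun a c =>
        (if a = c then 1 else 0) + u a * u c - ρ⁻¹ ^ 2 * (w a * w c) : Matrix _ _ ℝ) := by
      ext a c
      rw [Matrix.gram_apply, hgram]
      simp [u, w, orthonormal_iff_ite.1 b.orthonormal]
    rw [h2, Matrix.det_smul, Fintype.card_fin]
  have hsum1 : ∑ a, (inner ℝ y (b a) : ℝ) ^ 2 = ‖y‖ ^ 2 := by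
    rw [← b.sum_sq_norm_inner_left y]
    simp
  have hsum2 : ∑ a, ℓ (b a) * (inner ℝ y (b a) : ℝ) = ℓ y := by
    conv_rhs => rw [← b.sum_repr' y]
    rw [Submodule.coe_sum, map_sum]
    refine Finset.sum_congr rfl fun a _ => ?_
    rw [Submodule.coe_smul, map_smul, smul_eq_mul, mul_comm, real_inner_comm]
  have hww : ∑ a, w a ^ 2 = ‖y‖ ^ 2 + 2 * T * ℓ y + T ^ 2 * ∑ a, u a ^ 2 := by
    rw [← hsum1, ← hsum2, Finset.mul_sum, Finset.mul_sum, ← Finset.sum_add_distrib,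
      ← Finset.sum_add_distrib]
    exact Finset.sum_congr rfl fun a _ => by simp only [w, u]; ring
  have huw : ∑ a, u a * w a = ℓ y + T * ∑ a, u a ^ 2 := by
    rw [← hsum2, Finset.mul_sum, ← Finset.sum_add_distrib]
    exact Finset.sum_congr rfl fun a _ => by simp only [w, u]; ring
  have hi : ℓ i = T - ℓ y := by rw [← hℓ, map_add]; ring
  have hnorm := h.norm_dual_sq b ℓ
  rw [hℓo, hi] at hnorm
  have key : L.normDet ^ 2 = (ρ⁻¹ ^ (Module.finrank ℝ E + 1) * √(1 + ‖ℓ‖ ^ 2)) ^ 2 := by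
    rw [hdet, mul_pow, Real.sq_sqrt (by positivity), hnorm, hww, huw]
    have hy : ‖y‖ ^ 2 = ρ ^ 2 - T ^ 2 - 1 := by rw [hρ2]; ring
    have hp : (ρ⁻¹ ^ (Module.finrank ℝ E + 1)) ^ 2 = (ρ⁻¹ ^ 2) ^ Module.finrank ℝ E * ρ⁻¹ ^ 2 := by
      ring
    rw [hy, hp, mul_assoc _ (ρ⁻¹ ^ 2)]
    congr 1
    change _ = ρ⁻¹ ^ 2 * (1 + (0 ^ 2 + (T - ℓ y) ^ 2 + ∑ a, u a ^ 2))
    field_simp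
    ring
  exact (pow_left_inj₀ L.normDet_nonneg (by positivity) two_ne_zero).1 key

end Frame

section Slice

variable {F : Type*} [NormedAddCommGroup F] [InnerProductSpace ℝ F] [FiniteDimensional ℝ F]
  [MeasurableSpace F] [BorelSpace F] {o i : F} {E : Submodule ℝ F}
  {U : Set F} {t : F → ℝ} {t' : F → F →L[ℝ] ℝ}

theorem hausdorffMeasure_slice_pos (h : IsFrame o i E) (hc : IsConeGraph o U t t') :
    μH[Module.finrank ℝ E] {M | M ∈ U ∧ inner ℝ o M = t M ∧ ‖M‖ = 1 ∧ (0 : ℝ) < inner ℝ i M} =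
      ∫⁻ y in {y : E | i + (y : F) ∈ U}, ENNReal.ofReal
        (‖i + (y : F) + t (i + y) • o‖⁻¹ ^ (Module.finrank ℝ E + 1) * graphDensity t' (i + y))
        ∂μH[Module.finrank ℝ E] := by
  let s : Set E := {y : E | i + (y : F) ∈ U}
  let q : E → F := fun y => i + (y : F) + t (i + y) • o
  let q' : E → E →L[ℝ] F := fun y => E.subtypeL + ((t' (i + y)).comp E.subtypeL).smulRight o
  let f : E → F := fun y => ‖q y‖⁻¹ • q y
  let f' : E → E →L[ℝ] F := fun y =>
    ‖q y‖⁻¹ • q' y - ((‖q y‖⁻¹ ^ 3) • (innerSL ℝ (q y)).comp (q' y)).smulRight (q y)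
  have hqc : ∀ y : E, q y = t (i + y) • o + (1 : ℝ) • i + (y : F) := fun y => by
    simp only [q, one_smul]; abel
  have hqi : ∀ y : E, (inner ℝ i (q y) : ℝ) = 1 := fun y => by
    rw [hqc, h.inner_i_combo _ _ y.2]
  have hqo : ∀ y : E, (inner ℝ o (q y) : ℝ) = t (i + y) := fun y => by
    rw [hqc, h.inner_o_combo _ _ y.2]
  have hq0 : ∀ y : E, q y ≠ 0 := fun y h0 => by simpa [h0] using hqi y
  have hs : IsOpen s := hc.isOpen.preimage (by fun_prop)
  have hqd : ∀ y ∈ s, HasStrictFDerivAt q (q' y) y := by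
    intro y hy
    have h1 : HasStrictFDerivAt (fun y : E => i + (y : F)) E.subtypeL y :=
      E.subtypeL.hasStrictFDerivAt.const_add i
    exact h1.add (((hc.hasStrictFDerivAt _ hy).comp y h1).smul_const o)
  have hf : ∀ y ∈ s, HasStrictFDerivAt f (f' y) y := fun y hy =>
    hasStrictFDerivAt_normalize (hqd y hy) (hq0 y)
  have hcont : ContinuousOn f' s := by
    have h1 : Continuous fun y : E => i + (y : F) := by fun_prop
    have h2 : ContinuousOn (fun y : E => t' (i + y)) s :=
      hc.continuousOn.comp h1.continuousOn fun y hy => hy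
    have h3 : ContinuousOn q' s := by
      have : Continuous fun L : F →L[ℝ] ℝ => E.subtypeL + (L.comp E.subtypeL).smulRight o := by
        change Continuous fun L : F →L[ℝ] ℝ =>
          E.subtypeL + ContinuousLinearMap.smulRightL ℝ E F (L.comp E.subtypeL) o
        fun_prop
      exact this.comp_continuousOn h2
    have h4 : ContinuousOn q s := fun y hy =>
      (hqd y hy).hasFDerivAt.continuousAt.continuousWithinAt
    have h5 : ContinuousOn (fun y => ‖q y‖⁻¹) s :=
      h4.norm.inv₀ fun y _ => norm_ne_zero_iff.2 (hq0 y)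
    have h6 : ContinuousOn (fun y => innerSL ℝ (q y)) s := (innerSL ℝ).continuous.comp_continuousOn h4
    have h7 : ContinuousOn (fun y => (‖q y‖⁻¹ ^ 3) • (innerSL ℝ (q y)).comp (q' y)) s :=
      (h5.pow 3).smul (h6.clm_comp h3)
    have h8 : Continuous fun p : (E →L[ℝ] ℝ) × F => p.1.smulRight p.2 := by
      change Continuous fun p : (E →L[ℝ] ℝ) × F => ContinuousLinearMap.smulRightL ℝ E F p.1 p.2
      fun_prop
    exact (h5.smul h3).sub (h8.comp_continuousOn (h7.prodMk h4))
  have hnd : ∀ y ∈ s, (f' y : E →ₗ[ℝ] F).normDet =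
      ‖q y‖⁻¹ ^ (Module.finrank ℝ E + 1) * graphDensity t' (i + y) := by
    intro y hy
    have hρ2 : ‖q y‖ ^ 2 = t (i + y) ^ 2 + 1 + ‖y‖ ^ 2 := by
      rw [hqc, h.norm_combo _ _ y.2]; simp
    exact normDet_radial_projection_graph h (hc.apply_axis hy) (hc.apply_self hy)
      (norm_pos_iff.2 (hq0 y)) hρ2 _ fun z => rfl
  have hker : ∀ y ∈ s, LinearMap.ker (f' y : E →ₗ[ℝ] F) = ⊥ := by
    intro y hy
    by_contra hk
    have h0 := LinearMap.normDet_eq_zero_iff_ker_ne_bot.2 hk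
    rw [hnd y hy] at h0
    have h1 := graphDensity_pos t' (i + (y : F))
    have h2 := norm_pos_iff.2 (hq0 y)
    exact absurd h0 (by positivity)
  have hinj : Set.InjOn f s := by
    intro y hy z hz hyz
    have hn : ‖q y‖⁻¹ = ‖q z‖⁻¹ := by
      have := congrArg (inner ℝ i) hyz
      simpa only [f, inner_smul_right, hqi, mul_one] using this
    have hqq : q y = q z := by
      have h1 : ‖q y‖⁻¹ • q y = ‖q y‖⁻¹ • q z := by
        conv_rhs => rw [hn]
        exact hyz
      exact smul_right_injective F (inv_ne_zero (norm_ne_zero_iff.2 (hq0 y))) h1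
    have ht : t (i + y) = t (i + z) := by rw [← hqo, ← hqo, hqq]
    apply Subtype.ext
    simp only [q, ht] at hqq
    simpa using hqq
  have himg : f '' s = {M | M ∈ U ∧ inner ℝ o M = t M ∧ ‖M‖ = 1 ∧ (0 : ℝ) < inner ℝ i M} := by
    ext M
    constructor
    · rintro ⟨y, hy, rfl⟩
      have hn : ‖q y‖⁻¹ ≠ 0 := inv_ne_zero (norm_ne_zero_iff.2 (hq0 y))
      have hqU : q y ∈ U := hc.add_mem _ hy _
      have htq : t (q y) = t (i + y) := hc.add_eq _ hy _
      refine ⟨hc.smul_mem _ hqU _ hn, ?_, ?_, ?_⟩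
      · simp only [f]
        rw [inner_smul_right, hqo, hc.smul_eq _ hqU _ hn, htq]
      · simp only [f]
        rw [norm_smul, norm_inv, norm_norm, inv_mul_cancel₀ (norm_ne_zero_iff.2 (hq0 y))]
      · simp only [f]
        rw [inner_smul_right, hqi, mul_one]
        exact inv_pos.2 (norm_pos_iff.2 (hq0 y))
    · rintro ⟨hMU, hMo, hM1, hMi⟩
      set m : ℝ := inner ℝ i M with hm
      let y : E := ⟨m⁻¹ • (M - (inner ℝ o M : ℝ) • o - m • i), E.smul_mem _ (h.mem M)⟩
      have h1 : i + (y : F) = m⁻¹ • (M + (-(inner ℝ o M : ℝ)) • o) := by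
        simp only [y]
        rw [smul_sub, smul_smul, inv_mul_cancel₀ hMi.ne', one_smul, neg_smul]
        rw [← sub_eq_add_neg]
        abel
      have hU1 : M + (-(inner ℝ o M : ℝ)) • o ∈ U := hc.add_mem _ hMU _
      have hys : y ∈ s := by
        change i + (y : F) ∈ U
        rw [h1]
        exact hc.smul_mem _ hU1 _ (inv_ne_zero hMi.ne')
      have hty : t (i + y) = m⁻¹ * inner ℝ o M := by
        rw [h1, hc.smul_eq _ hU1 _ (inv_ne_zero hMi.ne'), hc.add_eq _ hMU, hMo]
      have hqy : q y = m⁻¹ • M := by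
        simp only [q]
        rw [hty, h1, smul_add, smul_smul, mul_neg, neg_smul]
        abel
      refine ⟨y, hys, ?_⟩
      simp only [f]
      rw [hqy, norm_smul, hM1, mul_one, norm_inv, Real.norm_of_nonneg hMi.le, inv_inv, smul_smul,
        mul_inv_cancel₀ hMi.ne', one_smul]
  rw [← himg, hausdorffMeasure_image_eq_lintegral_normDet hs hf hcont hker hinj]
  exact setLIntegral_congr_fun hs.measurableSet fun y hy => by rw [hnd y hy]

theorem hausdorffMeasure_slice (h : IsFrame o i E) (hc : IsConeGraph o U t t')
    (h0 : μH[Module.finrank ℝ E]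
      {M | M ∈ U ∧ inner ℝ o M = t M ∧ ‖M‖ = 1 ∧ (inner ℝ i M : ℝ) = 0} = 0) :
    μH[Module.finrank ℝ E] {M | M ∈ U ∧ inner ℝ o M = t M ∧ ‖M‖ = 1} =
      2 * ∫⁻ y in {y : E | i + (y : F) ∈ U}, ENNReal.ofReal
        (‖i + (y : F) + t (i + y) • o‖⁻¹ ^ (Module.finrank ℝ E + 1) * graphDensity t' (i + y))
        ∂μH[Module.finrank ℝ E] := by
  rw [← hausdorffMeasure_slice_pos h hc]
  set P := {M | M ∈ U ∧ inner ℝ o M = t M ∧ ‖M‖ = 1 ∧ (0 : ℝ) < inner ℝ i M}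
  set Z := {M | M ∈ U ∧ inner ℝ o M = t M ∧ ‖M‖ = 1 ∧ (inner ℝ i M : ℝ) = 0}
  set A := {M | M ∈ U ∧ inner ℝ o M = t M ∧ ‖M‖ = 1}
  have hneg : ∀ M : F, -M ∈ A ↔ M ∈ A := by
    have : ∀ M ∈ A, -M ∈ A := by
      rintro M ⟨h1, h2, h3⟩
      refine ⟨by simpa using hc.smul_mem M h1 (-1) (by norm_num), ?_, by simpa using h3⟩
      have := hc.smul_eq M h1 (-1) (by norm_num)
      rw [inner_neg_right, h2]
      simpa using this.symm
    exact fun M => ⟨fun hM => by simpa using this _ hM, this M⟩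
  let e := LinearIsometryEquiv.neg ℝ (E := F)
  have hN : μH[Module.finrank ℝ E] (e '' P) = μH[Module.finrank ℝ E] P :=
    e.isometry.hausdorffMeasure_image (Or.inl (by positivity)) P
  have hPm : MeasurableSet {M : F | (0 : ℝ) < inner ℝ i M} :=
    (isOpen_lt continuous_const (by fun_prop)).measurableSet
  have hPA : P = A ∩ {M : F | (0 : ℝ) < inner ℝ i M} := by
    ext M; simp only [P, A, Set.mem_ofPred_eq, Set.mem_inter_iff]; tauto
  have hdiff : A \ {M : F | (0 : ℝ) < inner ℝ i M} ⊆ e '' P ∪ Z := by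
    rintro M ⟨hA, hM⟩
    simp only [Set.mem_ofPred_eq, not_lt] at hM
    rcases hM.lt_or_eq with hM | hM
    · left
      refine ⟨-M, ?_, by simp [e]⟩
      rw [hPA]
      exact ⟨(hneg M).2 hA, by simpa using hM⟩
    · exact Or.inr ⟨hA.1, hA.2.1, hA.2.2, hM⟩
  have hsub : e '' P ⊆ A \ {M : F | (0 : ℝ) < inner ℝ i M} := by
    rintro _ ⟨M, hM, rfl⟩
    rw [hPA] at hM
    refine ⟨(hneg M).2 hM.1, ?_⟩
    have := hM.2
    simp only [Set.mem_ofPred_eq] at this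
    simp [e, this.le]
  rw [← measure_inter_add_sdiff A hPm, ← hPA, two_mul]
  congr 1
  refine le_antisymm ?_ (hN ▸ measure_mono hsub)
  calc _ ≤ μH[Module.finrank ℝ E] (e '' P ∪ Z) := measure_mono hdiff
    _ ≤ μH[Module.finrank ℝ E] (e '' P) + μH[Module.finrank ℝ E] Z := measure_union_le _ _
    _ = _ := by rw [h0, add_zero, hN]

end Slice

section Measure

variable {F : Type*} [NormedAddCommGroup F] [InnerProductSpace ℝ F] [FiniteDimensional ℝ F]
  {o i : F} {E : Submodule ℝ F}

/-- The coordinates attached to a frame. -/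
noncomputable def IsFrame.equiv (h : IsFrame o i E) : (ℝ × ℝ × E) ≃L[ℝ] F :=
  (LinearEquiv.toContinuousLinearEquiv
    { toFun := fun p => p.1 • o + p.2.1 • i + (p.2.2 : F)
      map_add' := fun p q => by
        simp only [Prod.fst_add, Prod.snd_add, add_smul, Submodule.coe_add]; abel
      map_smul' := fun r p => by
        simp [smul_add, smul_smul]
      invFun := fun V => ⟨inner ℝ o V, inner ℝ i V, ⟨_, h.mem V⟩⟩
      left_inv := fun p => by
        have h1 := h.inner_o_combo p.1 p.2.1 p.2.2.2
        have h2 := h.inner_i_combo p.1 p.2.1 p.2.2.2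
        ext
        · exact h1
        · exact h2
        · simp only [h1, h2]; abel
      right_inv := fun V => by simp only; abel })

theorem IsFrame.finrank_add_two (h : IsFrame o i E) :
    Module.finrank ℝ E + 2 = Module.finrank ℝ F := by
  rw [← h.equiv.toLinearEquiv.finrank_eq]
  simp
  ring

variable [MeasurableSpace F] [BorelSpace F]

theorem IsFrame.lintegral_eq (h : IsFrame o i E) (μ : Measure F) [μ.IsAddHaarMeasure] :
    ∃ c : ℝ≥0∞, c ≠ 0 ∧ c ≠ ⊤ ∧ ∀ H : F → ℝ≥0∞, Measurable H →
      ∫⁻ V, H V ∂μ = c * ∫⁻ a : ℝ, ∫⁻ r : ℝ, (∫⁻ z : E, H (a • o + r • i + (z : F))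
        ∂μH[Module.finrank ℝ E]) := by
  let ν : Measure (ℝ × ℝ × E) := volume.prod (volume.prod μH[Module.finrank ℝ E])
  have hν₁ : (volume.prod μH[Module.finrank ℝ E] : Measure (ℝ × E)).IsAddHaarMeasure :=
    Measure.prod.instIsAddHaarMeasure _ _
  have hν₀ : ν.IsAddHaarMeasure := Measure.prod.instIsAddHaarMeasure _ _
  have hν : (ν.map h.equiv).IsAddHaarMeasure := h.equiv.isAddHaarMeasure_map ν
  refine ⟨Measure.addHaarScalarFactor μ (ν.map h.equiv), ?_, ENNReal.coe_ne_top, ?_⟩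
  · exact_mod_cast (Measure.addHaarScalarFactor_pos_of_isAddHaarMeasure μ (ν.map h.equiv)).ne'
  · intro H hH
    have he : Measurable h.equiv := h.equiv.continuous.measurable
    conv_lhs => rw [Measure.isAddLeftInvariant_eq_smul μ (ν.map h.equiv)]
    rw [lintegral_smul_measure, lintegral_map hH he]
    have hm : Measurable fun p => H (h.equiv p) := hH.comp he
    rw [lintegral_prod _ hm.aemeasurable]
    have : ∀ a : ℝ, ∫⁻ p : ℝ × E, H (h.equiv (a, p)) ∂(volume.prod μH[Module.finrank ℝ E]) =
        ∫⁻ r : ℝ, (∫⁻ z : E, H (a • o + r • i + (z : F)) ∂μH[Module.finrank ℝ E]) := by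
      intro a
      have hma : Measurable fun p : ℝ × E => H (h.equiv (a, p)) :=
        hm.comp (measurable_const.prodMk measurable_id)
      rw [lintegral_prod _ hma.aemeasurable]
      rfl
    simp_rw [this]
    rfl

theorem lintegral_eq_comp_smul {G : Type*} [NormedAddCommGroup G] [NormedSpace ℝ G]
    [FiniteDimensional ℝ G] [MeasurableSpace G] [BorelSpace G] (μ : Measure G)
    [μ.IsAddHaarMeasure] {r : ℝ} (hr : r ≠ 0) {H : G → ℝ≥0∞} (hH : Measurable H) :
    ∫⁻ z, H z ∂μ = ENNReal.ofReal (|r| ^ Module.finrank ℝ G) * ∫⁻ y, H (r • y) ∂μ := by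
  rw [← lintegral_map hH (by fun_prop : Measurable fun y : G => r • y), Measure.map_addHaar_smul μ hr,
    lintegral_smul_measure, smul_eq_mul, ← mul_assoc, ← ENNReal.ofReal_mul (by positivity), abs_inv,
    abs_pow, mul_inv_cancel₀ (by positivity), ENNReal.ofReal_one, one_mul]

/-- The absolute moment of order `k` of the unnormalised Gaussian. -/
noncomputable def gaussMoment (k : ℕ) : ℝ≥0∞ := ∫⁻ r : ℝ, ENNReal.ofReal (|r| ^ k * exp (-r ^ 2 / 2))

theorem gaussMoment_ne_zero (k : ℕ) : gaussMoment k ≠ 0 := by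
  unfold gaussMoment
  refine (lintegral_pos_iff_support (by fun_prop)).2 ?_ |>.ne'
  refine lt_of_lt_of_le ?_ (measure_mono (s := Set.Ioo (0 : ℝ) 1) fun r hr => ?_)
  · simp
  · have := hr.1
    simp only [Function.mem_support, ne_eq, ENNReal.ofReal_eq_zero, not_le]
    positivity

theorem gaussMoment_ne_top (k : ℕ) : gaussMoment k ≠ ⊤ := by
  have h := (integrable_rpow_mul_exp_neg_mul_sq (b := 1 / 2) (by norm_num) (s := k)
    (by have : (0 : ℝ) ≤ k := by positivity
        linarith)).norm
  have h2 : Integrable fun r : ℝ => |r| ^ k * exp (-r ^ 2 / 2) := by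
    refine h.congr (Filter.Eventually.of_forall fun r => ?_)
    simp only [norm_mul, Real.norm_eq_abs, Real.abs_exp, Real.rpow_natCast, abs_pow]
    congr 2
    ring
  exact h2.lintegral_lt_top.ne

theorem lintegral_abs_pow_mul_exp (k : ℕ) {ρ : ℝ} (hρ : 0 < ρ) :
    ∫⁻ r : ℝ, ENNReal.ofReal (|r| ^ k * exp (-(r * ρ) ^ 2 / 2)) =
      ENNReal.ofReal (ρ⁻¹ ^ (k + 1)) * gaussMoment k := by
  rw [lintegral_eq_comp_smul volume (inv_ne_zero hρ.ne') (by fun_prop)]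
  simp only [Module.finrank_self, pow_one, smul_eq_mul]
  rw [gaussMoment, ← lintegral_const_mul _ (by fun_prop), ← lintegral_const_mul _ (by fun_prop)]
  refine lintegral_congr fun r => ?_
  rw [← ENNReal.ofReal_mul (by positivity), ← ENNReal.ofReal_mul (by positivity)]
  congr 1
  rw [abs_mul, abs_of_pos (inv_pos.2 hρ), mul_pow, mul_comm ρ⁻¹ r, inv_mul_cancel_right₀ hρ.ne']
  ring

variable {U : Set F} {t : F → ℝ} {t' : F → F →L[ℝ] ℝ}

theorem measurable_indicator_of_continuousOn {X : Type*} [TopologicalSpace X] [MeasurableSpace X]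
    [OpensMeasurableSpace X] {s : Set X} (hs : IsOpen s) {f : X → ℝ} (hf : ContinuousOn f s) :
    Measurable (s.indicator fun x => ENNReal.ofReal (f x)) := by
  have := (ENNReal.continuous_ofReal.comp_continuousOn hf).measurable_piecewise
    (continuousOn_const (c := (0 : ℝ≥0∞)) (s := sᶜ)) hs.measurableSet
  convert this using 1
  exact (Set.piecewise_eq_indicator).symm

/-- The Gaussian integral of the graph density of a cone is a multiple of the volume of the
intersection of the cone with the unit sphere. -/
theorem exists_lintegral_graphDensity_eq (h : IsFrame o i E) (μ : Measure F) [μ.IsAddHaarMeasure] :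
    ∃ a : ℝ≥0∞, a ≠ 0 ∧ a ≠ ⊤ ∧ ∀ (U : Set F) (t : F → ℝ) (t' : F → F →L[ℝ] ℝ),
      IsConeGraph o U t t' →
      μH[Module.finrank ℝ E]
        {M | M ∈ U ∧ inner ℝ o M = t M ∧ ‖M‖ = 1 ∧ (inner ℝ i M : ℝ) = 0} = 0 →
      ∫⁻ V in U, ENNReal.ofReal (exp (-(‖V‖ ^ 2 + t V ^ 2) / 2) * graphDensity t' V) ∂μ =
        a * μH[Module.finrank ℝ E] {M | M ∈ U ∧ inner ℝ o M = t M ∧ ‖M‖ = 1} := by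
  obtain ⟨c, hc0, hct, hc⟩ := h.lintegral_eq μ
  set k := Module.finrank ℝ E with hk
  refine ⟨c * gaussMoment 0 * gaussMoment k / 2, ?_, ?_, ?_⟩
  · simp [hc0, gaussMoment_ne_zero]
  · exact ENNReal.div_ne_top (ENNReal.mul_ne_top (ENNReal.mul_ne_top hct (gaussMoment_ne_top 0))
      (gaussMoment_ne_top k)) two_ne_zero
  intro U t t' hU hZ
  rw [hausdorffMeasure_slice h hU hZ]
  have hcont : ContinuousOn (fun V => exp (-(‖V‖ ^ 2 + t V ^ 2) / 2) * graphDensity t' V) U := by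
    have := hU.continuousOn_graphDensity
    have := hU.continuousOn_fun
    fun_prop
  have hmeas := measurable_indicator_of_continuousOn hU.isOpen hcont
  rw [← lintegral_indicator hU.isOpen.measurableSet]
  set Hf : F → ℝ≥0∞ := U.indicator fun V =>
    ENNReal.ofReal (exp (-(‖V‖ ^ 2 + t V ^ 2) / 2) * graphDensity t' V) with hHf
  rw [hc _ hmeas]
  let s : Set E := {y : E | i + (y : F) ∈ U}
  have hs : IsOpen s := hU.isOpen.preimage (by fun_prop)
  let ρ : E → ℝ := fun y => ‖i + (y : F) + t (i + y) • o‖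
  let R : E → ℝ := fun y => graphDensity t' (i + y)
  have hi : Continuous fun y : E => i + (y : F) := by fun_prop
  have htc : ContinuousOn (fun y : E => t (i + y)) s :=
    hU.continuousOn_fun.comp hi.continuousOn fun y hy => hy
  have hRc : ContinuousOn R s := hU.continuousOn_graphDensity.comp hi.continuousOn fun y hy => hy
  have hρc : ContinuousOn ρ s := by
    have : ContinuousOn (fun y : E => i + (y : F) + t (i + y) • o) s :=
      hi.continuousOn.add (htc.smul continuousOn_const)
    exact this.norm
  have hρ2 : ∀ y, ρ y ^ 2 = t (i + y) ^ 2 + 1 + ‖y‖ ^ 2 := by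
    intro y
    have := h.norm_combo (t (i + y)) 1 y.2
    simp only [ρ]
    rw [← Submodule.norm_coe y, ← one_pow 2, ← this]
    congr 2
    rw [one_smul]; abel
  have hρ0 : ∀ y, 0 < ρ y := by
    intro y
    have h1 := hρ2 y
    have h2 : 0 ≤ ρ y := norm_nonneg _
    refine h2.lt_of_ne fun h3 => ?_
    rw [← h3] at h1
    nlinarith [sq_nonneg (t (i + y)), sq_nonneg ‖y‖]
  have hinner : ∀ a r : ℝ, r ≠ 0 → ∫⁻ z : E, Hf (a • o + r • i + (z : F)) ∂μH[k] =
      ENNReal.ofReal (exp (-a ^ 2 / 2)) * ∫⁻ y, s.indicator (fun y => ENNReal.ofReal (R y *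
        (|r| ^ k * exp (-(r * ρ y) ^ 2 / 2)))) y ∂μH[k] := by
    intro a r hr
    have hm1 : Measurable fun z : E => Hf (a • o + r • i + (z : F)) :=
      hmeas.comp (by fun_prop : Measurable fun z : E => a • o + r • i + (z : F))
    have hm2 : Measurable fun z : E => Hf (a • o + r • i + ((r • z : E) : F)) :=
      hm1.comp (measurable_const_smul r)
    rw [lintegral_eq_comp_smul _ hr hm1, ← lintegral_const_mul _ hm2,
      ← lintegral_const_mul]
    swap
    · exact measurable_indicator_of_continuousOn hs (by fun_prop)
    refine lintegral_congr fun y => ?_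
    have e1 : a • o + r • i + ((r • y : E) : F) = r • (i + (y : F)) + a • o := by
      rw [Submodule.coe_smul, smul_add]; abel
    have e2 : a • o + r • i + ((r • y : E) : F) ∈ U ↔ y ∈ s := by
      rw [e1, hU.add_mem_iff, hU.smul_mem_iff hr]; rfl
    have e4 := h.norm_combo a r (r • y).2
    by_cases hy : y ∈ s
    · have hyU : i + (y : F) ∈ U := hy
      rw [hHf, Set.indicator_of_mem (e2.2 hy), Set.indicator_of_mem hy,
        ← ENNReal.ofReal_mul (by positivity), ← ENNReal.ofReal_mul (by positivity), e4, e1,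
        hU.add_eq _ (hU.smul_mem _ hyU r hr), hU.smul_eq _ hyU r hr]
      congr 1
      have e3 : graphDensity t' (r • (i + (y : F)) + a • o) = R y := by
        simp only [graphDensity, R]
        rw [hU.deriv_add (hU.smul_mem _ hyU r hr), hU.deriv_smul hyU hr]
      rw [e3, Submodule.norm_coe, norm_smul]
      have e5 : -(a ^ 2 + r ^ 2 + (‖r‖ * ‖y‖) ^ 2 + (r * t (i + y)) ^ 2) / 2 =
          -a ^ 2 / 2 + -(r * ρ y) ^ 2 / 2 := by
        rw [mul_pow, mul_pow, mul_pow, hρ2, Real.norm_eq_abs, sq_abs]; ring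
      rw [e5, exp_add]
      ring
    · rw [hHf, Set.indicator_of_notMem (fun h => hy (e2.1 h)), Set.indicator_of_notMem hy, mul_zero,
        mul_zero]
  have hr0 : ∀ᵐ r : ℝ, r ≠ 0 := by
    simp [ae_iff]
  have hjoint : Measurable fun p : ℝ × E => s.indicator (fun y => ENNReal.ofReal (R y *
        (|p.1| ^ k * exp (-(p.1 * ρ y) ^ 2 / 2)))) p.2 := by
    have := measurable_indicator_of_continuousOn (s := Set.univ ×ˢ s) (isOpen_univ.prod hs)
      (f := fun p : ℝ × E => R p.2 * (|p.1| ^ k * exp (-(p.1 * ρ p.2) ^ 2 / 2))) (by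
        have h1 : ContinuousOn (fun p : ℝ × E => R p.2) (Set.univ ×ˢ s) :=
          hRc.comp continuousOn_snd fun p hp => hp.2
        have h2 : ContinuousOn (fun p : ℝ × E => ρ p.2) (Set.univ ×ˢ s) :=
          hρc.comp continuousOn_snd fun p hp => hp.2
        have h3 : ContinuousOn (fun p : ℝ × E => |p.1| ^ k) (Set.univ ×ˢ s) := by fun_prop
        have h4 : ContinuousOn (fun p : ℝ × E => -(p.1 * ρ p.2) ^ 2 / 2) (Set.univ ×ˢ s) :=
          ((continuousOn_fst.mul h2).pow 2).neg.div_const 2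
        exact h1.mul (h3.mul h4.rexp))
    convert this using 2 with p
    by_cases hp : p.2 ∈ s
    · rw [Set.indicator_of_mem hp, Set.indicator_of_mem (s := Set.univ ×ˢ s) ⟨trivial, hp⟩]
    · rw [Set.indicator_of_notMem hp, Set.indicator_of_notMem (s := Set.univ ×ˢ s) fun h' => hp h'.2]
  have hr_int : ∀ a : ℝ, ∫⁻ r : ℝ, (∫⁻ z : E, Hf (a • o + r • i + (z : F)) ∂μH[k]) =
      ENNReal.ofReal (exp (-a ^ 2 / 2)) * ∫⁻ r : ℝ, (∫⁻ y, s.indicator (fun y => ENNReal.ofReal (R y *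
        (|r| ^ k * exp (-(r * ρ y) ^ 2 / 2)))) y ∂μH[k]) := by
    intro a
    rw [← lintegral_const_mul _ hjoint.lintegral_prod_right]
    refine lintegral_congr_ae ?_
    filter_upwards [hr0] with r hr using hinner a r hr
  simp_rw [hr_int]
  rw [lintegral_mul_const _ (by fun_prop), lintegral_lintegral_swap hjoint.aemeasurable]
  have hy_int : ∀ y : E, ∫⁻ r : ℝ, s.indicator (fun y => ENNReal.ofReal (R y *
        (|r| ^ k * exp (-(r * ρ y) ^ 2 / 2)))) y =
      gaussMoment k * s.indicator (fun y => ENNReal.ofReal ((ρ y)⁻¹ ^ (k + 1) * R y)) y := by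
    intro y
    by_cases hy : y ∈ s
    · simp only [Set.indicator_of_mem hy]
      have hR : 0 ≤ R y := (graphDensity_pos _ _).le
      simp_rw [ENNReal.ofReal_mul hR]
      rw [lintegral_const_mul _ (by fun_prop), lintegral_abs_pow_mul_exp k (hρ0 y),
        ENNReal.ofReal_mul' hR]
      ring
    · simp [Set.indicator_of_notMem hy]
  simp_rw [hy_int]
  have hlast : ContinuousOn (fun y => (ρ y)⁻¹ ^ (k + 1) * R y) s :=
    ((hρc.inv₀ fun y _ => (hρ0 y).ne').pow (k + 1)).mul hRc
  rw [lintegral_const_mul _ (measurable_indicator_of_continuousOn hs hlast),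
    lintegral_indicator hs.measurableSet]
  have hg0 : ∫⁻ a : ℝ, ENNReal.ofReal (exp (-a ^ 2 / 2)) = gaussMoment 0 := by
    simp [gaussMoment]
  rw [hg0, ← mul_assoc (_ / 2), ENNReal.div_mul_cancel two_ne_zero ENNReal.ofNat_ne_top]
  ring

end Measure

section Coordinates

variable {ι : Type*} [Fintype ι]

theorem isFrame_single {a b : ι} (hab : a ≠ b) :
    IsFrame (EuclideanSpace.single a (1 : ℝ)) (EuclideanSpace.single b 1)
      (Submodule.span ℝ {EuclideanSpace.single a (1 : ℝ), EuclideanSpace.single b 1})ᗮ where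
  norm_o := by simp
  norm_i := by simp
  inner_oi := by simp [EuclideanSpace.inner_single_left, hab]
  inner_o := fun z hz => by
    rw [Submodule.mem_orthogonal] at hz
    exact hz _ (Submodule.subset_span (by simp))
  inner_i := fun z hz => by
    rw [Submodule.mem_orthogonal] at hz
    exact hz _ (Submodule.subset_span (by simp))
  mem := fun V => by
    rw [Submodule.mem_orthogonal]
    intro u hu
    induction hu using Submodule.span_induction with
    | mem x hx =>
      rcases hx with rfl | rfl <;>
      simp [inner_sub_right, inner_smul_right, EuclideanSpace.inner_single_left, hab, hab.symm]
    | zero => simp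
    | add x y _ _ hx hy => rw [inner_add_left, hx, hy, add_zero]
    | smul c x _ hx => rw [inner_smul_left, hx, mul_zero]

theorem norm_smul_normalize_of_unit {F : Type*} [NormedAddCommGroup F] [NormedSpace ℝ F] {M : F}
    (hM : ‖M‖ = 1) {m : ℝ} (hm : m ≠ 0) :
    ‖m⁻¹ • M‖⁻¹ • (m⁻¹ • M) = M ∨ -(‖m⁻¹ • M‖⁻¹ • (m⁻¹ • M)) = M := by
  rw [norm_smul, hM, mul_one, norm_inv, inv_inv, smul_smul]
  rcases hm.lt_or_gt with h | h
  · right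
    rw [Real.norm_of_nonpos h.le, ← neg_smul, neg_mul, neg_neg, mul_inv_cancel₀ hm, one_smul]
  · left
    rw [Real.norm_of_nonneg h.le, mul_inv_cancel₀ hm, one_smul]

/-- Normalisations, up to sign, of strictly differentiable images of subsets of coordinate affine
subspaces of small dimension are null for the Hausdorff measure. -/
theorem hausdorffMeasure_unit_eq_zero_of_coord {F : Type*} [NormedAddCommGroup F]
    [InnerProductSpace ℝ F] [MeasurableSpace F] [BorelSpace F] (S : Finset ι) (c : ι → ℝ)
    {s : Set (EuclideanSpace ℝ ι)} (hs : ∀ x ∈ s, ∀ a ∈ S, x a = c a)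
    {g : EuclideanSpace ℝ ι → F}
    (hg : ∀ x ∈ s, g x ≠ 0 ∧ ∃ g' : EuclideanSpace ℝ ι →L[ℝ] F, HasStrictFDerivAt g g' x)
    {Z : Set F} (hZ : ∀ M ∈ Z, ‖M‖ = 1 ∧ ∃ x ∈ s, ∃ m : ℝ, m ≠ 0 ∧ g x = m⁻¹ • M)
    {k : ℕ} (hk : Fintype.card ι < k + S.card) : μH[(k : ℝ)] Z = 0 := by
  let f : EuclideanSpace ℝ ι → F := fun x => ‖g x‖⁻¹ • g x
  have hk' : (Fintype.card ι : ℝ) - S.card < (k : NNReal) := by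
    rw [NNReal.coe_natCast, sub_lt_iff_lt_add]
    exact_mod_cast hk
  have hf : ∀ x ∈ s, ∃ f' : EuclideanSpace ℝ ι →L[ℝ] F, HasStrictFDerivAt f f' x := by
    intro x hx
    obtain ⟨h0, g', hg'⟩ := hg x hx
    exact ⟨_, hasStrictFDerivAt_normalize hg' h0⟩
  have h1 := hausdorffMeasure_image_eq_zero_of_coord S c hs hf hk'
  have h2 := hausdorffMeasure_image_eq_zero_of_coord S c hs (f := fun x => -f x) (fun x hx => by
    obtain ⟨f', hf'⟩ := hf x hx
    exact ⟨_, hf'.neg⟩) hk'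
  rw [NNReal.coe_natCast] at h1 h2
  refine measure_mono_null (fun M hM => ?_) (measure_union_null h1 h2)
  obtain ⟨hM1, x, hx, m, hm, hgx⟩ := hZ M hM
  rcases norm_smul_normalize_of_unit hM1 hm with h | h
  · exact Or.inl ⟨x, hx, by simp only [f, hgx]; exact h⟩
  · exact Or.inr ⟨x, hx, by simp only [f, hgx]; exact h⟩

theorem hausdorffMeasure_slice_hyperplane_eq_zero {a b : ι} (hab : a ≠ b)
    {U : Set (EuclideanSpace ℝ ι)} {t : EuclideanSpace ℝ ι → ℝ}
    {t' : EuclideanSpace ℝ ι → EuclideanSpace ℝ ι →L[ℝ] ℝ}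
    (hU : IsConeGraph (EuclideanSpace.single a (1 : ℝ)) U t t') {k : ℕ}
    (hk : k + 2 = Fintype.card ι) :
    μH[(k : ℝ)] {M : EuclideanSpace ℝ ι | M ∈ U ∧ M a = t M ∧ ‖M‖ = 1 ∧ M b = 0} = 0 := by
  set o : EuclideanSpace ℝ ι := EuclideanSpace.single a (1 : ℝ) with ho
  have hoj : ∀ j, o j = if j = a then 1 else 0 := fun j => by simp [ho]
  have hsub : {M : EuclideanSpace ℝ ι | M ∈ U ∧ M a = t M ∧ ‖M‖ = 1 ∧ M b = 0} ⊆
      ⋃ j : {j // j ≠ a ∧ j ≠ b}, {M | M ∈ U ∧ M a = t M ∧ ‖M‖ = 1 ∧ M b = 0 ∧ M j ≠ 0} := by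
    rintro M ⟨h1, h2, h3, h4⟩
    by_contra hcon
    have hj : ∀ j, j ≠ a → M j = 0 := by
      intro j hja
      by_cases hjb : j = b
      · rw [hjb, h4]
      · by_contra hj0
        exact hcon (Set.mem_iUnion.2 ⟨⟨j, hja, hjb⟩, h1, h2, h3, h4, hj0⟩)
    have hM : M = M a • o := by
      ext j
      by_cases hja : j = a
      · simp [hja, hoj]
      · simp [hoj, hj j hja, hja]
    have hz : M + (-(M a)) • o = 0 := by
      rw [neg_smul, ← hM]; simp
    have h0U : (0 : EuclideanSpace ℝ ι) ∈ U := hz ▸ hU.add_mem M h1 (-(M a))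
    have ht0 : t 0 = 0 := by
      have := hU.smul_eq 0 h0U 2 two_ne_zero
      rw [smul_zero] at this
      linarith
    have : M a = 0 := by rw [h2, ← hU.add_eq M h1 (-(M a)), hz, ht0]
    rw [hM, this] at h3
    simp at h3
  refine measure_mono_null hsub (measure_iUnion_null fun j => ?_)
  refine hausdorffMeasure_unit_eq_zero_of_coord (ι := ι) ({a, b, (j : ι)} : Finset ι)
    (fun l => if l = j then 1 else 0)
    (s := {x | x ∈ U ∧ x j = 1 ∧ x a = 0 ∧ x b = 0}) ?_ (g := fun x => x + t x • o) ?_ ?_ ?_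
  · rintro x ⟨-, h1, h2, h3⟩ l hl
    simp only [Finset.mem_insert, Finset.mem_singleton] at hl
    rcases hl with rfl | rfl | rfl
    · simp [h2, j.2.1.symm]
    · simp [h3, j.2.2.symm]
    · simp [h1]
  · rintro x ⟨h0, h1, h2, h3⟩
    refine ⟨fun h => ?_, _, (hasStrictFDerivAt_id x).add ((hU.hasStrictFDerivAt x h0).smul_const o)⟩
    have := congrArg (fun v : EuclideanSpace ℝ ι => v j) h
    simp [hoj, j.2.1, h1] at this
  · rintro M ⟨h1, h2, h3, h4, h5⟩
    refine ⟨h3, (M j)⁻¹ • (M + (-(M a)) • o), ⟨?_, ?_, ?_, ?_⟩, M j, h5, ?_⟩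
    · exact hU.smul_mem _ (hU.add_mem _ h1 _) _ (inv_ne_zero h5)
    · simp [hoj, j.2.1, h5]
    · simp [hoj]
    · simp [hoj, hab.symm, h4]
    · rw [hU.smul_eq _ (hU.add_mem _ h1 _) _ (inv_ne_zero h5), hU.add_eq _ h1, ← h2, mul_smul,
        ← smul_add, neg_smul, neg_add_cancel_right]
  · have : ({a, b, (j : ι)} : Finset ι).card = 3 := Finset.card_eq_three.2
      ⟨a, b, j, hab, j.2.1.symm, j.2.2.symm, rfl⟩
    omega

/-- The Gaussian integral of the graph density of a cone is a multiple of the volume of the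
intersection of the cone with the unit sphere. -/
theorem exists_lintegral_graphDensity_eq_coord {a b : ι} (hab : a ≠ b) {k : ℕ}
    (hk : k + 2 = Fintype.card ι) :
    ∃ K : ℝ≥0∞, K ≠ 0 ∧ K ≠ ⊤ ∧ ∀ (U : Set (EuclideanSpace ℝ ι)) (t : EuclideanSpace ℝ ι → ℝ)
      (t' : EuclideanSpace ℝ ι → EuclideanSpace ℝ ι →L[ℝ] ℝ),
      IsConeGraph (EuclideanSpace.single a (1 : ℝ)) U t t' →
      ∫⁻ V in U, ENNReal.ofReal (exp (-(‖V‖ ^ 2 + t V ^ 2) / 2) * graphDensity t' V) =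
        K * μH[(k : ℝ)] {M | M ∈ U ∧ M a = t M ∧ ‖M‖ = 1} := by
  have h := isFrame_single hab
  obtain ⟨K, hK0, hKt, hK⟩ := exists_lintegral_graphDensity_eq h volume
  have hf := h.finrank_add_two
  rw [finrank_euclideanSpace] at hf
  have hf' : Module.finrank ℝ (Submodule.span ℝ {EuclideanSpace.single a (1 : ℝ),
      EuclideanSpace.single b 1})ᗮ = k := by omega
  rw [hf'] at hK
  refine ⟨K, hK0, hKt, fun U t t' hU => ?_⟩
  have h1 := hK U t t' hU
  simp only [EuclideanSpace.inner_single_left, map_one, one_mul] at h1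
  exact h1 (hausdorffMeasure_slice_hyperplane_eq_zero hab hU hk)

end Coordinates

section Det

variable {κ : Type*} [Fintype κ] [DecidableEq κ]

theorem det_add_smul_single (M : Matrix κ κ ℝ) (p q : κ) (r : ℝ) :
    (M + r • Matrix.single p q 1).det = M.det + r * M.adjugate q p := by
  have h : M + r • Matrix.single p q 1 = M.updateRow p (M p + r • Pi.single q 1) := by
    ext i j
    by_cases hi : i = p
    · subst hi
      simp [Matrix.single_apply, Pi.single_apply, eq_comm]
    · simp [hi, Ne.symm hi]
  rw [h, Matrix.det_updateRow_add, Matrix.det_updateRow_smul, Matrix.updateRow_eq_self,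
    Matrix.adjugate_apply]

theorem contDiff_det {G : Type*} [NormedAddCommGroup G] [NormedSpace ℝ G] {M : G → Matrix κ κ ℝ}
    {m : WithTop ℕ∞} (hM : ∀ p q, ContDiff ℝ m fun x => M x p q) :
    ContDiff ℝ m fun x => (M x).det := by
  simp only [Matrix.det_apply']
  exact ContDiff.sum fun σ _ => contDiff_const.mul (contDiff_prod fun i _ => hM _ _)

theorem contDiff_adjugate {G : Type*} [NormedAddCommGroup G] [NormedSpace ℝ G]
    {M : G → Matrix κ κ ℝ} {m : WithTop ℕ∞} (hM : ∀ p q, ContDiff ℝ m fun x => M x p q) (i j : κ) :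
    ContDiff ℝ m fun x => (M x).adjugate i j := by
  simp only [Matrix.adjugate_apply]
  refine contDiff_det fun p q => ?_
  by_cases hp : p = j
  · subst hp
    simpa using contDiff_const
  · simpa [hp] using hM p q

theorem hasStrictFDerivAt_det_pi (x : κ × κ → ℝ) :
    HasStrictFDerivAt (fun x : κ × κ → ℝ => (Matrix.of fun p q => x (p, q)).det)
      (∑ e : κ × κ, (Matrix.of fun p q => x (p, q)).adjugate e.2 e.1 •
        ContinuousLinearMap.proj (R := ℝ) (φ := fun _ : κ × κ => ℝ) e) x := by
  have hC : ContDiff ℝ 1 (fun x : κ × κ → ℝ => (Matrix.of fun p q => x (p, q)).det) :=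
    contDiff_det fun p q => contDiff_apply ℝ ℝ (p, q)
  have hS := hC.contDiffAt.hasStrictFDerivAt (x := x) (by norm_num)
  refine hS.congr_fderiv (Eq.symm ?_)
  rw [← ContinuousLinearMap.coe_inj]
  refine Module.Basis.ext (Pi.basisFun ℝ (κ × κ)) fun e => ?_
  obtain ⟨p, q⟩ := e
  have h1 : HasDerivAt (fun r : ℝ => x + r • Pi.single (p, q) (1 : ℝ)) (Pi.single (p, q) 1) 0 := by
    simpa using ((hasDerivAt_id (0 : ℝ)).smul_const (Pi.single (p, q) (1 : ℝ))).const_add x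
  have hS0 : HasFDerivAt (fun x : κ × κ → ℝ => (Matrix.of fun p q => x (p, q)).det)
    (fderiv ℝ (fun x : κ × κ → ℝ => (Matrix.of fun p q => x (p, q)).det) x)
    (x + (0 : ℝ) • Pi.single (p, q) (1 : ℝ)) := by simpa using hS.hasFDerivAt
  have h2 := hS0.comp_hasDerivAt (0 : ℝ) h1
  have h3 : (fun x : κ × κ → ℝ => (Matrix.of fun p q => x (p, q)).det) ∘
      (fun r : ℝ => x + r • Pi.single (p, q) (1 : ℝ)) = fun r =>
        (Matrix.of fun p q => x (p, q)).det + r * (Matrix.of fun p q => x (p, q)).adjugate q p := by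
    funext r
    rw [← det_add_smul_single]
    simp only [Function.comp]
    congr 1
    ext i j
    simp [Matrix.single_apply, Pi.single_apply, Prod.ext_iff, eq_comm]
  rw [h3] at h2
  have h4 : HasDerivAt (fun r : ℝ => (Matrix.of fun p q => x (p, q)).det +
      r * (Matrix.of fun p q => x (p, q)).adjugate q p)
      ((Matrix.of fun p q => x (p, q)).adjugate q p) 0 := by
    simpa using ((hasDerivAt_id (0 : ℝ)).mul_const
      ((Matrix.of fun p q => x (p, q)).adjugate q p)).const_add
        (Matrix.of fun p q => x (p, q)).det
  have h5 := h4.unique h2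
  simp only [Pi.basisFun_apply, ContinuousLinearMap.coe_coe]
  rw [← h5]
  simp [sum_apply, Pi.single_apply]

theorem hasDerivAt_det {M : ℝ → Matrix κ κ ℝ} {M' : Matrix κ κ ℝ} {r : ℝ}
    (hM : ∀ p q, HasDerivAt (fun r => M r p q) (M' p q) r) :
    HasDerivAt (fun r => (M r).det) (((M r).adjugate * M').trace) r := by
  have h1 : HasDerivAt (fun r => fun e : κ × κ => M r e.1 e.2) (fun e => M' e.1 e.2) r :=
    hasDerivAt_pi.2 fun e => hM e.1 e.2
  have h2 := (hasStrictFDerivAt_det_pi (fun e : κ × κ => M r e.1 e.2)).hasFDerivAt.comp_hasDerivAt r h1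
  refine h2.congr_deriv ?_
  simp only [sum_apply, smul_apply,
    ContinuousLinearMap.proj_apply, smul_eq_mul, Matrix.trace, Matrix.diag, Matrix.mul_apply,
    Fintype.sum_prod_type]
  rw [Finset.sum_comm]
  rfl

theorem adjugate_add_smul_single (M : Matrix κ κ ℝ) (p q q' : κ) (r : ℝ) :
    (M + r • Matrix.single p q' 1).adjugate q p = M.adjugate q p := by
  rw [Matrix.adjugate_apply, Matrix.adjugate_apply]
  congr 1
  ext i j
  by_cases hi : i = p
  · subst hi; simp
  · simp [hi, Ne.symm hi]

end Det

theorem norm_dual_sq_eq_sum {ι : Type*} [Fintype ι] [DecidableEq ι] (ℓ : EuclideanSpace ℝ ι →L[ℝ] ℝ) :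
    ‖ℓ‖ ^ 2 = ∑ e, ℓ (EuclideanSpace.single e 1) ^ 2 := by
  have h := (InnerProductSpace.toDual ℝ (EuclideanSpace ℝ ι)).symm.norm_map ℓ
  rw [← h, EuclideanSpace.norm_sq_eq]
  refine Finset.sum_congr rfl fun e _ => ?_
  have := InnerProductSpace.toDual_symm_apply (𝕜 := ℝ) (x := EuclideanSpace.single e (1 : ℝ))
    (y := ℓ)
  rw [← this, EuclideanSpace.inner_single_right]
  simp

section DetSol

variable {n : ℕ} [NeZero n]

/-- The value of the upper left entry of `M` that makes the determinant vanish, the other entries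
being kept. -/
noncomputable def detSol (M : Matrix (Fin n) (Fin n) ℝ) : ℝ := M 0 0 - M.det / M.adjugate 0 0

theorem detSol_add_smul_single {M : Matrix (Fin n) (Fin n) ℝ} (hM : M.adjugate 0 0 ≠ 0) (r : ℝ) :
    detSol (M + r • Matrix.single 0 0 1) = detSol M := by
  rw [detSol, adjugate_add_smul_single, det_add_smul_single, detSol]
  simp only [Matrix.add_apply, Matrix.smul_apply, Matrix.single_apply_same, smul_eq_mul]
  field_simp
  ring

theorem det_add_detSol {M : Matrix (Fin n) (Fin n) ℝ} (hM : M.adjugate 0 0 ≠ 0) :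
    (M + (detSol M - M 0 0) • Matrix.single 0 0 1).det = 0 := by
  rw [det_add_smul_single, detSol]
  field_simp
  ring

theorem det_eq_zero_iff_detSol {M : Matrix (Fin n) (Fin n) ℝ} (hM : M.adjugate 0 0 ≠ 0) :
    M.det = 0 ↔ M 0 0 = detSol M := by
  rw [detSol]
  constructor
  · intro h; simp [h]
  · intro h
    have : M.det / M.adjugate 0 0 = 0 := by linarith
    simpa [hM] using this

theorem detSol_smul (M : Matrix (Fin n) (Fin n) ℝ) {r : ℝ} (hr : r ≠ 0) :
    detSol (r • M) = r * detSol M := by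
  have hn : n = n - 1 + 1 := (Nat.succ_pred_eq_of_ne_zero (NeZero.ne n)).symm
  rw [detSol, Matrix.adjugate_smul, Matrix.det_smul, detSol]
  simp only [Matrix.smul_apply, smul_eq_mul, Fintype.card_fin]
  by_cases h : M.adjugate 0 0 = 0
  · simp [h]
  · conv_lhs => enter [2, 1, 1, 2]; rw [hn]
    have := pow_ne_zero (n - 1) hr
    rw [pow_succ]
    field_simp

theorem adjugate_smul_ne_zero_iff (M : Matrix (Fin n) (Fin n) ℝ) {r : ℝ} (hr : r ≠ 0) :
    (r • M).adjugate 0 0 ≠ 0 ↔ M.adjugate 0 0 ≠ 0 := by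
  rw [Matrix.adjugate_smul]
  simp [hr]

variable (n) in
/-- Matrices whose upper left cofactor does not vanish. -/
def cofSet : Set (EMat n) := {V | (matOfE n V).adjugate 0 0 ≠ 0}

variable (n) in
/-- `detSol` as a function on the Euclidean space of matrices. -/
noncomputable def detSolE (V : EMat n) : ℝ := detSol (matOfE n V)

omit [NeZero n] in
@[simp] theorem matOfE_apply (V : EMat n) (p q : Fin n) : matOfE n V p q = V (p, q) := rfl

omit [NeZero n] in
theorem matOfE_add_single (V : EMat n) (r : ℝ) (p q : Fin n) :
    matOfE n (V + r • EuclideanSpace.single (p, q) 1) = matOfE n V + r • Matrix.single p q 1 := by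
  ext i j
  simp [Matrix.single_apply, Prod.ext_iff, eq_comm]

omit [NeZero n] in
theorem matOfE_smul (V : EMat n) (r : ℝ) : matOfE n (r • V) = r • matOfE n V := by
  ext i j
  simp

omit [NeZero n] in
theorem contDiff_matOfE_apply {m : WithTop ℕ∞} (p q : Fin n) :
    ContDiff ℝ m fun V : EMat n => matOfE n V p q := by
  simp only [matOfE_apply]
  fun_prop

theorem isOpen_cofSet : IsOpen (cofSet n) :=
  (contDiff_adjugate (m := 0) contDiff_matOfE_apply 0 0).continuous.isOpen_preimage _
    isOpen_compl_singleton

theorem contDiffAt_detSolE {V : EMat n} (hV : V ∈ cofSet n) : ContDiffAt ℝ 2 (detSolE n) V := by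
  unfold detSolE detSol
  exact (contDiff_matOfE_apply 0 0).contDiffAt.sub
    ((contDiff_det contDiff_matOfE_apply).contDiffAt.div
      (contDiff_adjugate contDiff_matOfE_apply 0 0).contDiffAt hV)

theorem isConeGraph_detSolE :
    IsConeGraph (EuclideanSpace.single (0, 0) 1) (cofSet n) (detSolE n) (fderiv ℝ (detSolE n)) where
  isOpen := isOpen_cofSet
  hasStrictFDerivAt V hV := (contDiffAt_detSolE hV).hasStrictFDerivAt (by norm_num)
  continuousOn V hV :=
    ((contDiffAt_detSolE hV).fderiv_right (m := 1) (by norm_num)).continuousAt.continuousWithinAt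
  add_mem V hV r := by
    simp only [cofSet, Set.mem_ofPred_eq, matOfE_add_single, adjugate_add_smul_single]
    exact hV
  add_eq V hV r := by
    rw [detSolE, matOfE_add_single, detSol_add_smul_single hV, detSolE]
  smul_mem V hV r hr := by
    simp only [cofSet, Set.mem_ofPred_eq, matOfE_smul]
    exact (adjugate_smul_ne_zero_iff _ hr).2 hV
  smul_eq V hV r hr := by
    rw [detSolE, matOfE_smul, detSol_smul _ hr, detSolE]

/-- The Frobenius norm of the adjugate matrix. -/
noncomputable def adjNorm {κ : Type*} [Fintype κ] [DecidableEq κ] (M : Matrix κ κ ℝ) : ℝ :=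
  √(∑ e : κ × κ, M.adjugate e.2 e.1 ^ 2)

theorem graphDensity_detSolE {V : EMat n} (hV : V ∈ cofSet n) :
    graphDensity (fderiv ℝ (detSolE n)) V =
      adjNorm (matOfE n V + (detSol (matOfE n V) - V (0, 0)) • Matrix.single 0 0 1) /
        |(matOfE n V).adjugate 0 0| := by
  set o : EMat n := EuclideanSpace.single (0, 0) 1 with ho
  set W := V + (detSolE n V - V (0, 0)) • o with hW
  have hWm : matOfE n W = matOfE n V + (detSol (matOfE n V) - V (0, 0)) • Matrix.single 0 0 1 := by
    rw [hW, matOfE_add_single, detSolE]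
  have hc : (matOfE n W).adjugate 0 0 = (matOfE n V).adjugate 0 0 := by
    rw [hWm, adjugate_add_smul_single]
  have hV' : (matOfE n V).adjugate 0 0 ≠ 0 := hV
  set t' := fderiv ℝ (detSolE n) V with ht'
  have ht : HasFDerivAt (detSolE n) t' V := (isConeGraph_detSolE.hasStrictFDerivAt V hV).hasFDerivAt
  have hdir : ∀ e : Fin n × Fin n, (matOfE n W).adjugate e.2 e.1 +
      (matOfE n W).adjugate 0 0 * (t' (EuclideanSpace.single e 1) -
        (EuclideanSpace.single e (1 : ℝ) : EMat n) (0, 0)) = 0 := by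
    intro e
    set x := (EuclideanSpace.single e (1 : ℝ) : EMat n) with hx
    have h1 : HasFDerivAt (fun Z : EMat n => Z + (detSolE n Z - Z (0, 0)) • o)
        (ContinuousLinearMap.id ℝ (EMat n) +
          (t' - EuclideanSpace.proj (𝕜 := ℝ) ((0, 0) : Fin n × Fin n)).smulRight o) V :=
      (hasFDerivAt_id V).add
        ((ht.sub (EuclideanSpace.proj (𝕜 := ℝ) ((0, 0) : Fin n × Fin n)).hasFDerivAt).smul_const o)
    have h2 := (EuclideanSpace.equiv (Fin n × Fin n) ℝ).toContinuousLinearMap.hasFDerivAt.comp V h1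
    have h3 := (hasStrictFDerivAt_det_pi (W : Fin n × Fin n → ℝ)).hasFDerivAt.comp V h2
    have h4 : ((fun x : Fin n × Fin n → ℝ => (Matrix.of fun p q => x (p, q)).det) ∘
        (EuclideanSpace.equiv (Fin n × Fin n) ℝ).toContinuousLinearMap ∘
          fun Z : EMat n => Z + (detSolE n Z - Z (0, 0)) • o) =ᶠ[nhds V] fun _ => 0 := by
      filter_upwards [isOpen_cofSet.mem_nhds hV] with Z hZ
      have := det_add_detSol (M := matOfE n Z) hZ
      rw [matOfE_apply, ← matOfE_add_single] at this
      exact this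
    have h5 := h3.unique ((hasFDerivAt_const (0 : ℝ) V).congr_of_eventuallyEq h4)
    have h6 := DFunLike.congr_fun h5 x
    have h7 : ∑ e' : Fin n × Fin n, (matOfE n W).adjugate e'.2 e'.1 *
        (x e' + (t' x - x (0, 0)) * o e') = 0 := by
      rw [ContinuousLinearMap.comp_apply] at h6
      simp only [matOfE]
      simpa [sum_apply, smul_apply] using h6
    simp only [mul_add, Finset.sum_add_distrib] at h7
    have h8 : ∑ e' : Fin n × Fin n, (matOfE n W).adjugate e'.2 e'.1 * x e' =
        (matOfE n W).adjugate e.2 e.1 := by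
      rw [Finset.sum_eq_single e]
      · simp [hx]
      · intro b _ hb; simp [hx, hb]
      · simp
    have h9 : ∑ e' : Fin n × Fin n, (matOfE n W).adjugate e'.2 e'.1 * ((t' x - x (0, 0)) * o e') =
        (matOfE n W).adjugate 0 0 * (t' x - x (0, 0)) := by
      rw [Finset.sum_eq_single (0, 0)]
      · simp [ho]
      · intro b _ hb; simp [ho, hb]
      · simp
    linarith
  have hsum : 1 + ‖t'‖ ^ 2 = (∑ e : Fin n × Fin n, (matOfE n W).adjugate e.2 e.1 ^ 2) /
      (matOfE n V).adjugate 0 0 ^ 2 := by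
    rw [norm_dual_sq_eq_sum, Finset.sum_div,
      ← Finset.add_sum_erase (a := ((0, 0) : Fin n × Fin n)) _ _ (Finset.mem_univ _),
      ← Finset.add_sum_erase (a := ((0, 0) : Fin n × Fin n)) _ _ (Finset.mem_univ _), ← add_assoc]
    congr 1
    · rw [hc, div_self (pow_ne_zero _ hV')]
      have := isConeGraph_detSolE.apply_axis hV
      rw [ht', this]; simp
    · refine Finset.sum_congr rfl fun e he => ?_
      have h0 : (EuclideanSpace.single e (1 : ℝ) : EMat n) (0, 0) = 0 := by
        simp [Ne.symm (Finset.ne_of_mem_erase he)]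
      have h1 := hdir e
      rw [h0, sub_zero, hc] at h1
      have h2 : (matOfE n W).adjugate e.2 e.1 =
          -((matOfE n V).adjugate 0 0 * t' (EuclideanSpace.single e 1)) := by linarith
      rw [h2]
      field_simp
  rw [graphDensity, ← ht', hsum, Real.sqrt_div' _ (sq_nonneg _), Real.sqrt_sq_eq_abs, adjNorm, hWm]

end DetSol

section Degenerate

variable {n : ℕ} [NeZero n]

/-- The column `j ≠ 0` is a linear combination of the other columns with non-zero index. -/
def ColumnRelation (M : Matrix (Fin n) (Fin n) ℝ) (j : Fin n) : Prop :=
  j ≠ 0 ∧ ∃ c : Fin n → ℝ, c 0 = 0 ∧ c j = 0 ∧ ∀ p, M p j = ∑ i, c i * M p i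

theorem columnRelation_of_mulVec {M : Matrix (Fin n) (Fin n) ℝ} {x : Fin n → ℝ} (hx : x ≠ 0)
    (h0 : x 0 = 0) (hM : M *ᵥ x = 0) : ∃ j, ColumnRelation M j := by
  obtain ⟨j, hj⟩ := Function.ne_iff.1 hx
  have hj0 : j ≠ 0 := by rintro rfl; exact hj h0
  refine ⟨j, hj0, fun i => if i = j then 0 else -(x i / x j), by simp [h0, hj0.symm], by simp,
    fun p => ?_⟩
  have h1 : ∑ i, M p i * x i = 0 := congrFun hM p
  have hj' : x j ≠ 0 := hj
  rw [← Finset.add_sum_erase _ _ (Finset.mem_univ j)] at h1 ⊢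
  have h2 : ∑ i ∈ Finset.univ.erase j, (if i = j then 0 else -(x i / x j)) * M p i =
      -(∑ i ∈ Finset.univ.erase j, M p i * x i) / x j := by
    rw [← Finset.sum_neg_distrib, Finset.sum_div]
    refine Finset.sum_congr rfl fun i hi => ?_
    rw [if_neg (Finset.ne_of_mem_erase hi)]
    ring
  rw [h2]
  simp only [if_true, zero_mul, zero_add]
  rw [eq_div_iff hj']
  linarith

theorem exists_columnRelation {M : Matrix (Fin n) (Fin n) ℝ} (h : M.det = 0)
    (hc : M.adjugate 0 0 = 0) : (∃ j, ColumnRelation M j) ∨ ∃ j, ColumnRelation Mᵀ j := by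
  rw [Matrix.adjugate_apply] at hc
  obtain ⟨x, hx, hx0⟩ := Matrix.exists_mulVec_eq_zero_iff.2 hc
  have e0 : x 0 = 0 := by
    have := congrFun hx0 0
    simpa [Matrix.mulVec, dotProduct, Pi.single_apply] using this
  have e1 : ∀ i, i ≠ 0 → (M *ᵥ x) i = 0 := by
    intro i hi
    have := congrFun hx0 i
    simpa [Matrix.mulVec, dotProduct, hi] using this
  by_cases hb : (M *ᵥ x) 0 = 0
  · left
    refine columnRelation_of_mulVec hx e0 (funext fun i => ?_)
    by_cases hi : i = 0
    · rw [hi, hb]; rfl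
    · exact e1 i hi
  · right
    obtain ⟨y, hy, hy0⟩ := Matrix.exists_vecMul_eq_zero_iff.2 h
    refine columnRelation_of_mulVec hy ?_ (by rw [Matrix.mulVec_transpose, hy0])
    have h2 : y ⬝ᵥ (M *ᵥ x) = 0 := by rw [Matrix.dotProduct_mulVec, hy0, zero_dotProduct]
    rw [dotProduct, Finset.sum_eq_single 0 (fun i _ hi => by rw [e1 i hi, mul_zero]) (by simp)] at h2
    exact (mul_eq_zero.1 h2).resolve_right hb

theorem hausdorffMeasure_columnRelation {k : ℕ} (hk : k + 2 = n ^ 2) (j : Fin n) :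
    μH[(k : ℝ)] {M : EMat n | ColumnRelation (matOfE n M) j ∧ ‖M‖ = 1} = 0 := by
  by_cases hj : j = 0
  · have : {M : EMat n | ColumnRelation (matOfE n M) j ∧ ‖M‖ = 1} = ∅ := by
      ext M; simp [ColumnRelation, hj]
    rw [this, measure_empty]
  have hsub : {M : EMat n | ColumnRelation (matOfE n M) j ∧ ‖M‖ = 1} ⊆
      ⋃ e : {e : Fin n × Fin n // e.2 ≠ j},
        {M : EMat n | ColumnRelation (matOfE n M) j ∧ ‖M‖ = 1 ∧ M e ≠ 0} := by
    rintro M ⟨hM, h1⟩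
    by_contra hcon
    simp only [Set.mem_iUnion, not_exists, Set.mem_ofPred_eq, not_and, not_not] at hcon
    have h2 : ∀ p q, q ≠ j → M (p, q) = 0 := fun p q hq => hcon ⟨(p, q), hq⟩ hM h1
    obtain ⟨_, c, hc0, hcj, hc⟩ := hM
    have : M = 0 := by
      ext ⟨p, q⟩
      by_cases hq : q = j
      · subst hq
        have := hc p
        simp only [matOfE_apply] at this
        rw [this]
        simp only [PiLp.zero_apply]
        refine Finset.sum_eq_zero fun i _ => ?_
        by_cases hi : i = q
        · rw [hi, hcj, zero_mul]
        · rw [h2 p i hi, mul_zero]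
      · exact h2 p q hq
    rw [this, norm_zero] at h1
    exact zero_ne_one h1
  refine measure_mono_null hsub (measure_iUnion_null fun e => ?_)
  obtain ⟨⟨a, b⟩, hb⟩ := e
  have hb : b ≠ j := hb
  refine hausdorffMeasure_unit_eq_zero_of_coord (k := k)
    {((0 : Fin n), j), (j, j), (a, b)} (fun e => if e = (a, b) then 1 else 0)
    (s := {x | x (0, j) = 0 ∧ x (j, j) = 0 ∧ x (a, b) = 1}) ?_
    (g := fun x => WithLp.toLp 2 fun e => if e.2 = j then ∑ i ∈ Finset.univ.erase j,
      x (i, j) * x (e.1, i) else x e) ?_ ?_ ?_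
  · rintro x ⟨h1, h2, h3⟩ e he
    simp only [Finset.mem_insert, Finset.mem_singleton] at he
    rcases he with rfl | rfl | rfl
    · simpa [hb.symm] using h1
    · simpa [hb.symm] using h2
    · simpa using h3
  · rintro x ⟨h1, h2, h3⟩
    refine ⟨fun h => ?_, ?_⟩
    · have := congrArg (fun z : EMat n => z (a, b)) h
      simp [hb, h3] at this
    · have hC : ContDiff ℝ 1 (fun x : EMat n => (WithLp.toLp 2 fun e : Fin n × Fin n =>
          if e.2 = j then ∑ i ∈ Finset.univ.erase j, x (i, j) * x (e.1, i) else x e : EMat n)) := by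
        refine contDiff_piLp' 2 fun e => ?_
        by_cases he : e.2 = j
        · simp only [he, if_true]
          fun_prop
        · simp only [he, if_false]
          fun_prop
      exact ⟨_, hC.contDiffAt.hasStrictFDerivAt (by norm_num)⟩
  · rintro M ⟨⟨_, c, hc0, hcj, hc⟩, h1, hm⟩
    have hm : M (a, b) ≠ 0 := hm
    refine ⟨h1, WithLp.toLp 2 fun e => if e.2 = j then c e.1 else (M (a, b))⁻¹ * M e, ?_, M (a, b),
      hm, ?_⟩
    · simp [hc0, hcj, hb, hm]
    · ext ⟨p, q⟩
      by_cases hq : q = j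
      · subst hq
        simp only [if_true, PiLp.smul_apply, smul_eq_mul]
        have h3 := hc p
        simp only [matOfE_apply] at h3
        rw [h3, ← Finset.add_sum_erase _ _ (Finset.mem_univ q), hcj, zero_mul, zero_add,
          Finset.mul_sum]
        refine Finset.sum_congr rfl fun i hi => ?_
        rw [if_neg (Finset.ne_of_mem_erase hi)]
        ring
      · simp [hq]
  · have : ({((0 : Fin n), j), (j, j), (a, b)} : Finset (Fin n × Fin n)).card = 3 :=
      Finset.card_eq_three.2 ⟨(0, j), (j, j), (a, b), by simp [Ne.symm hj], by simp [hb.symm],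
        by simp [hb.symm], rfl⟩
    rw [this, Fintype.card_prod, Fintype.card_fin]
    nlinarith

theorem hausdorffMeasure_adjugate_eq_zero {k : ℕ} (hk : k + 2 = n ^ 2) :
    μH[(k : ℝ)] {M : EMat n | ((matOfE n M).det = 0 ∧ (matOfE n M).adjugate 0 0 = 0) ∧ ‖M‖ = 1} =
      0 := by
  set τ : EMat n ≃ₗᵢ[ℝ] EMat n := LinearIsometryEquiv.piLpCongrLeft 2 ℝ ℝ (Equiv.prodComm _ _)
    with hτ
  have hτm : ∀ M, matOfE n (τ M) = (matOfE n M)ᵀ := fun M => by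
    ext p q
    simp [hτ, LinearIsometryEquiv.piLpCongrLeft_apply, Equiv.piCongrLeft']
  refine measure_mono_null (t := (⋃ j, {M : EMat n | ColumnRelation (matOfE n M) j ∧ ‖M‖ = 1}) ∪
    ⋃ j, τ ⁻¹' {M : EMat n | ColumnRelation (matOfE n M) j ∧ ‖M‖ = 1}) ?_
    (measure_union_null (measure_iUnion_null fun j => hausdorffMeasure_columnRelation hk j)
      (measure_iUnion_null fun j => ?_))
  · rintro M ⟨⟨h1, h2⟩, h3⟩
    rcases exists_columnRelation h1 h2 with ⟨j, hj⟩ | ⟨j, hj⟩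
    · exact Or.inl (Set.mem_iUnion.2 ⟨j, hj, h3⟩)
    · refine Or.inr (Set.mem_iUnion.2 ⟨j, ?_, ?_⟩)
      · rw [hτm]; exact hj
      · rw [τ.norm_map, h3]
  · have := τ.toIsometryEquiv.hausdorffMeasure_preimage (k : ℝ)
      {M : EMat n | ColumnRelation (matOfE n M) j ∧ ‖M‖ = 1}
    rw [hausdorffMeasure_columnRelation hk j] at this
    exact this

end Degenerate

theorem hausdorffMeasure_sphere_eq_slice {ι : Type*} [Fintype ι] (a : ι) {m : ℕ}
    (hm : m + 1 = Fintype.card ι) {k : ℝ} (hk : 0 ≤ k) :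
    μH[k] (Metric.sphere (0 : EuclideanSpace ℝ (Fin m)) 1) =
      μH[k] {M : EuclideanSpace ℝ ι | M a = 0 ∧ ‖M‖ = 1} := by
  have hc : Fintype.card {e // e ≠ a} = Fintype.card (Fin m) := by
    have := Fintype.card_subtype_compl (fun e => e = a)
    rw [Fintype.card_subtype_eq] at this
    rw [Fintype.card_fin, this]
    omega
  obtain ⟨φ⟩ : Nonempty ({e // e ≠ a} ≃ Fin m) := Fintype.card_eq.1 hc
  let f : EuclideanSpace ℝ (Fin m) →ₗ[ℝ] EuclideanSpace ℝ ι :=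
    { toFun := fun y => WithLp.toLp 2 fun e => if h : e ≠ a then y (φ ⟨e, h⟩) else 0
      map_add' := fun y z => by
        ext e; by_cases h : e = a <;> simp [h]
      map_smul' := fun r y => by
        ext e; by_cases h : e = a <;> simp [h] }
  have hfe : ∀ y e, f y e = if h : e ≠ a then y (φ ⟨e, h⟩) else 0 := fun y e => rfl
  have hn : ∀ y, ‖f y‖ = ‖y‖ := fun y => by
    rw [EuclideanSpace.norm_eq, EuclideanSpace.norm_eq]
    congr 1
    rw [Fintype.sum_eq_add_sum_subtype_ne _ a, ← φ.sum_comp, hfe]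
    simp only [ne_eq, not_true, dite_false, norm_zero]
    rw [zero_pow two_ne_zero, zero_add]
    refine Finset.sum_congr rfl fun e _ => ?_
    rw [hfe, dif_pos e.2]
  have hiso : Isometry f := AddMonoidHomClass.isometry_of_norm f hn
  rw [← hiso.hausdorffMeasure_image (Or.inl hk)]
  congr 1
  ext M
  simp only [Set.mem_image, mem_sphere_zero_iff_norm, Set.mem_ofPred_eq]
  constructor
  · rintro ⟨y, hy, rfl⟩
    exact ⟨by simp [hfe], by rw [hn, hy]⟩
  · rintro ⟨h0, h1⟩
    have hM : f (WithLp.toLp 2 fun i => M (φ.symm i)) = M := by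
      ext e
      rw [hfe]
      by_cases h : e = a
      · simp [h, h0]
      · simp [h]
    exact ⟨_, by rw [← hn, hM, h1], hM⟩

theorem pi_gaussianReal {ι : Type*} [Fintype ι] {v : ι → NNReal} (hv : ∀ i, v i ≠ 0) :
    Measure.pi (fun i => gaussianReal 0 (v i)) =
      (volume : Measure (ι → ℝ)).withDensity fun x =>
        ENNReal.ofReal (∏ i, gaussianPDFReal 0 (v i) (x i)) := by
  have h : ∀ i, gaussianReal 0 (v i) =
      (volume : Measure ℝ).withDensity fun x => ENNReal.ofReal (gaussianPDFReal 0 (v i) x) :=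
    fun i => gaussianReal_of_var_ne_zero 0 (hv i)
  simp_rw [h]
  exact pi_withDensity_ofReal (fun _ => volume) (fun i x => gaussianPDFReal_nonneg 0 (v i) x)
    fun i => integrable_gaussianPDFReal 0 (v i)

theorem lintegral_prod_gaussianPDFReal {ι : Type*} [Fintype ι] {v : ι → NNReal}
    (hv : ∀ i, v i ≠ 0) :
    ∫⁻ V : EuclideanSpace ℝ ι, ENNReal.ofReal (∏ e, gaussianPDFReal 0 (v e) (V e)) = 1 := by
  have h := (PiLp.volume_preserving_toLp ι).lintegral_comp_emb
    (MeasurableEquiv.toLp 2 (ι → ℝ)).measurableEmbedding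
    (fun V : EuclideanSpace ℝ ι => ENNReal.ofReal (∏ e, gaussianPDFReal 0 (v e) (V e)))
  rw [← h]
  have h1 := measure_univ (μ := Measure.pi (fun i => gaussianReal 0 (v i)))
  rw [pi_gaussianReal hv, withDensity_apply _ MeasurableSet.univ, Measure.restrict_univ] at h1
  exact h1

theorem gaussianPDFReal_zero_one (x : ℝ) :
    gaussianPDFReal 0 1 x = (√(2 * π))⁻¹ * exp (-x ^ 2 / 2) := by
  simp [gaussianPDFReal]

theorem exp_norm_sq_eq_prod {ι : Type*} [Fintype ι] (V : EuclideanSpace ℝ ι) :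
    exp (-‖V‖ ^ 2 / 2) = √(2 * π) ^ Fintype.card ι * ∏ e, gaussianPDFReal 0 1 (V e) := by
  simp_rw [gaussianPDFReal_zero_one, Finset.prod_mul_distrib, ← Real.exp_sum]
  rw [Finset.prod_const, Finset.card_univ, inv_pow, ← mul_assoc,
    mul_inv_cancel₀ (pow_ne_zero _ (by positivity)), one_mul, EuclideanSpace.norm_sq_eq]
  congr 1
  rw [neg_div, Finset.sum_div, ← Finset.sum_neg_distrib]
  simp [neg_div]

theorem exists_ne_zero_of_two_le {n : ℕ} [NeZero n] (hn : 2 ≤ n) : ∃ b : Fin n, b ≠ 0 :=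
  ⟨⟨1, hn⟩, fun h => by simpa using congrArg Fin.val h⟩

/-- The Gaussian integral defining the volume ratio of the singular matrices. -/
noncomputable def singularIntegral (n : ℕ) [NeZero n] : ℝ≥0∞ :=
  ∫⁻ V in cofSet n, ENNReal.ofReal (graphDensity (fderiv ℝ (detSolE n)) V *
    gaussianPDFReal 0 1 (detSolE n V) * ∏ e, gaussianPDFReal 0 1 (V e))

theorem hausdorffMeasure_singular_div_sphere {n : ℕ} [NeZero n] (hn : 2 ≤ n) :
    μH[(n : ℝ) ^ 2 - 2] {M : EMat n | (matOfE n M).det = 0 ∧ ‖M‖ = 1} /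
        μH[(n : ℝ) ^ 2 - 2] (Metric.sphere (0 : EuclideanSpace ℝ (Fin (n ^ 2 - 1))) 1) =
      ENNReal.ofReal √(2 * π) * singularIntegral n := by
  obtain ⟨b, hb⟩ := exists_ne_zero_of_two_le hn
  have h4n : 2 ^ 2 ≤ n ^ 2 := by gcongr
  obtain ⟨k, hk⟩ : ∃ k, k + 2 = n ^ 2 := ⟨n ^ 2 - 2, by omega⟩
  have hk' : (n : ℝ) ^ 2 - 2 = (k : ℝ) := by
    have : ((k + 2 : ℕ) : ℝ) = ((n ^ 2 : ℕ) : ℝ) := by rw [hk]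
    push_cast at this
    linarith
  have hcard : Fintype.card (Fin n × Fin n) = n ^ 2 := by simp [sq]
  rw [hk']
  obtain ⟨K, hK0, hKt, hK⟩ := exists_lintegral_graphDensity_eq_coord
    (a := ((0, 0) : Fin n × Fin n)) (b := (0, b)) (by simp [hb.symm]) (k := k) (by rw [hcard, hk])
  have h1 := hK (cofSet n) (detSolE n) (fderiv ℝ (detSolE n))
    (by convert isConeGraph_detSolE (n := n))
  have h2 := hK Set.univ (fun _ => 0) (fun _ => 0)
    { isOpen := isOpen_univ
      hasStrictFDerivAt := fun V _ => hasStrictFDerivAt_const _ _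
      continuousOn := continuousOn_const
      add_mem := fun _ _ _ => trivial
      add_eq := fun _ _ _ => rfl
      smul_mem := fun _ _ _ _ => trivial
      smul_eq := fun _ _ _ _ => by simp }
  set C : ℝ := √(2 * π) ^ (n ^ 2) with hC
  have hCpos : 0 < C := by positivity
  have h3 : K * μH[(k : ℝ)] (Metric.sphere (0 : EuclideanSpace ℝ (Fin (n ^ 2 - 1))) 1) =
      ENNReal.ofReal C := by
    rw [hausdorffMeasure_sphere_eq_slice ((0, 0) : Fin n × Fin n) (by omega) (Nat.cast_nonneg k)]
    simp only [Set.mem_univ, true_and, Measure.restrict_univ] at h2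
    rw [← h2]
    have : ∀ V : EMat n, ENNReal.ofReal (exp (-(‖V‖ ^ 2 + 0 ^ 2) / 2) *
        graphDensity (fun _ : EMat n => (0 : EMat n →L[ℝ] ℝ)) V) =
        ENNReal.ofReal C * ENNReal.ofReal (∏ e, gaussianPDFReal 0 1 (V e)) := fun V => by
      rw [← ENNReal.ofReal_mul hCpos.le]
      congr 1
      have := exp_norm_sq_eq_prod V
      rw [hcard] at this
      rw [hC, ← this]
      simp [graphDensity]
    simp_rw [this]
    rw [lintegral_const_mul' _ _ ENNReal.ofReal_ne_top, lintegral_prod_gaussianPDFReal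
      (v := fun _ => 1) (fun _ => one_ne_zero), mul_one]
  have h4 : K * μH[(k : ℝ)] {M : EMat n | (matOfE n M).det = 0 ∧ ‖M‖ = 1} =
      ENNReal.ofReal C * (ENNReal.ofReal √(2 * π) * singularIntegral n) := by
    have e1 : μH[(k : ℝ)] {M : EMat n | (matOfE n M).det = 0 ∧ ‖M‖ = 1} =
        μH[(k : ℝ)] {M : EMat n | M ∈ cofSet n ∧ M (0, 0) = detSolE n M ∧ ‖M‖ = 1} := by
      refine measure_congr ?_
      have h0 := hausdorffMeasure_adjugate_eq_zero (n := n) hk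
      filter_upwards [compl_mem_ae_iff.2 h0] with M hM
      simp only [Set.mem_compl_iff, Set.mem_ofPred_eq, not_and] at hM
      refine propext ⟨fun h => ?_, fun h => ?_⟩
      · have hcof : M ∈ cofSet n := fun hc => hM ⟨h.1, hc⟩ h.2
        exact ⟨hcof, (det_eq_zero_iff_detSol hcof).1 h.1, h.2⟩
      · exact ⟨(det_eq_zero_iff_detSol h.1).2 h.2.1, h.2.2⟩
    rw [e1, ← h1, singularIntegral, ← mul_assoc, ← ENNReal.ofReal_mul hCpos.le,
      ← lintegral_const_mul' _ _ ENNReal.ofReal_ne_top]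
    refine lintegral_congr fun V => ?_
    rw [← ENNReal.ofReal_mul (by positivity)]
    congr 1
    have := exp_norm_sq_eq_prod V
    rw [hcard, ← hC] at this
    rw [gaussianPDFReal_zero_one, neg_add, add_div, Real.exp_add, this]
    have h2pi : √(2 * π) ≠ 0 := by positivity
    field_simp
  have hS0 : μH[(k : ℝ)] (Metric.sphere (0 : EuclideanSpace ℝ (Fin (n ^ 2 - 1))) 1) ≠ 0 := by
    intro h
    rw [h, mul_zero] at h3
    exact (ENNReal.ofReal_pos.2 hCpos).ne h3
  have hSt : μH[(k : ℝ)] (Metric.sphere (0 : EuclideanSpace ℝ (Fin (n ^ 2 - 1))) 1) ≠ ⊤ := by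
    intro h
    rw [h, ENNReal.mul_top hK0] at h3
    exact ENNReal.ofReal_ne_top h3.symm
  refine Eq.symm ((ENNReal.eq_div_iff hS0 hSt).2 ?_)
  refine (ENNReal.mul_right_inj hK0 hKt).1 ?_
  rw [h4, ← h3]
  ring

section LocalCondition

variable {n : ℕ} [NeZero n]

theorem ker_eq_span_of_adjugate {M : Matrix (Fin n) (Fin n) ℝ} (h : M.det = 0)
    (hc : M.adjugate 0 0 ≠ 0) :
    LinearMap.ker (Matrix.toLin' M) = Submodule.span ℝ {fun i => M.adjugate i 0} := by
  have hr : M *ᵥ (fun i => M.adjugate i 0) = 0 := by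
    ext i
    have := congrFun (congrFun (Matrix.mul_adjugate M) i) 0
    simpa [h, Matrix.mul_apply, Matrix.mulVec, dotProduct] using this
  have h0 : ∀ x : Fin n → ℝ, M *ᵥ x = 0 → x 0 = 0 → x = 0 := by
    intro x hx hx0
    by_contra hne
    refine hc ?_
    rw [Matrix.adjugate_apply]
    refine Matrix.exists_mulVec_eq_zero_iff.1 ⟨x, hne, funext fun i => ?_⟩
    by_cases hi : i = 0
    · subst hi
      simp [Matrix.mulVec, hx0]
    · have := congrFun hx i
      simpa [Matrix.mulVec, hi] using this
  refine le_antisymm (fun x hx => ?_) ?_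
  · rw [LinearMap.mem_ker, Matrix.toLin'_apply] at hx
    rw [Submodule.mem_span_singleton]
    refine ⟨x 0 / M.adjugate 0 0, ?_⟩
    have := h0 (x - (x 0 / M.adjugate 0 0) • fun i => M.adjugate i 0)
      (by rw [Matrix.mulVec_sub, Matrix.mulVec_smul, hx, hr]; simp) (by simp [hc])
    exact (sub_eq_zero.1 this).symm
  · rw [Submodule.span_singleton_le_iff_mem, LinearMap.mem_ker, Matrix.toLin'_apply, hr]

omit [NeZero n] in
theorem exists_adjugate_eq_mul {M : Matrix (Fin n) (Fin n) ℝ} (h : M.det = 0) {r ℓ : Fin n → ℝ}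
    (hr : LinearMap.ker (Matrix.toLin' M) = Submodule.span ℝ {r})
    (hℓ : LinearMap.ker (Matrix.toLin' Mᵀ) = Submodule.span ℝ {ℓ}) (hr0 : r ≠ 0) :
    ∃ c : ℝ, ∀ i j, M.adjugate i j = c * r i * ℓ j := by
  have h1 : ∀ j, ∃ a : ℝ, a • r = fun i => M.adjugate i j := fun j => by
    rw [← Submodule.mem_span_singleton, ← hr, LinearMap.mem_ker, Matrix.toLin'_apply]
    ext i
    have := congrFun (congrFun (Matrix.mul_adjugate M) i) j
    simpa [h, Matrix.mul_apply, Matrix.mulVec, dotProduct] using this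
  have h2 : ∀ i, ∃ a : ℝ, a • ℓ = fun j => M.adjugate i j := fun i => by
    rw [← Submodule.mem_span_singleton, ← hℓ, LinearMap.mem_ker, Matrix.toLin'_apply]
    ext j
    have := congrFun (congrFun (Matrix.adjugate_mul M) i) j
    simpa [h, Matrix.mul_apply, Matrix.mulVec, dotProduct, mul_comm] using this
  choose a ha using h1
  choose b hb using h2
  obtain ⟨k, hk⟩ := Function.ne_iff.1 hr0
  have hk : r k ≠ 0 := hk
  refine ⟨b k / r k, fun i j => ?_⟩
  have e1 : a j * r i = M.adjugate i j := congrFun (ha j) i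
  have e2 : a j * r k = M.adjugate k j := congrFun (ha j) k
  have e3 : b k * ℓ j = M.adjugate k j := congrFun (hb k) j
  rw [← e1]
  field_simp
  rw [mul_right_comm, e2, ← e3]
  ring

/-- The matrix `β·∂P/∂α − α·∂P/∂β`. -/
noncomputable def Qmat (n d : ℕ) (A : MatTuple n d) (α β : ℝ) : Matrix (Fin n) (Fin n) ℝ :=
  β • Pα n d A α β - α • Pβ n d A α β

omit [NeZero n] in
theorem vvec_eq_mulVec {d : ℕ} (A : MatTuple n d) (α β : ℝ) (r : Fin n → ℝ) :
    vvec n d A α β r = Qmat n d A α β *ᵥ r := by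
  rw [vvec, Qmat, Matrix.sub_mulVec, Matrix.smul_mulVec, Matrix.smul_mulVec]

/-- The sum of the squares of the homogeneous monomials of degree `d`. -/
noncomputable def monoSum (d : ℕ) (α β : ℝ) : ℝ :=
  ∑ k ∈ Finset.range (d + 1), α ^ (2 * k) * β ^ (2 * (d - k))

/-- The local condition number relative to the norm of the tuple, in terms of the adjugate. -/
noncomputable def relCond (n d : ℕ) (A : MatTuple n d) (α β : ℝ) : ℝ :=
  √(monoSum d α β) * (adjNorm (Pmat n d A α β) /
    |((Pmat n d A α β).adjugate * Qmat n d A α β).trace|)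

theorem muLoc_eq_relCond {d : ℕ} {A : MatTuple n d} {α β : ℝ} (h : (Pmat n d A α β).det = 0)
    (hc : (Pmat n d A α β).adjugate 0 0 ≠ 0)
    (ht : ((Pmat n d A α β).adjugate * Qmat n d A α β).trace ≠ 0) :
    muLoc n d A α β = ENNReal.ofReal (relCond n d A α β * tnorm n d A) := by
  set M := Pmat n d A α β with hM
  have key : ∀ r ℓ : Fin n → ℝ, r ≠ 0 → LinearMap.ker (Matrix.toLin' M) = Submodule.span ℝ {r} →
      LinearMap.ker (Matrix.toLin' Mᵀ) = Submodule.span ℝ {ℓ} → ∃ c : ℝ, c ≠ 0 ∧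
      adjNorm M = |c| * (vnorm n r * vnorm n ℓ) ∧
      (M.adjugate * Qmat n d A α β).trace = c * ∑ j, ℓ j * vvec n d A α β r j := by
    intro r ℓ hr0 hr hℓ
    obtain ⟨c, hcM⟩ := exists_adjugate_eq_mul h hr hℓ hr0
    refine ⟨c, ?_, ?_, ?_⟩
    · rintro rfl
      exact hc (by rw [hcM]; ring)
    · rw [adjNorm, vnorm, vnorm, ← Real.sqrt_sq_eq_abs, ← Real.sqrt_mul (by positivity),
        ← Real.sqrt_mul (sq_nonneg c), Finset.sum_mul_sum, Finset.mul_sum,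
        Fintype.sum_prod_type_right]
      congr 1
      refine Finset.sum_congr rfl fun i _ => ?_
      rw [Finset.mul_sum]
      refine Finset.sum_congr rfl fun j _ => ?_
      rw [hcM]; ring
    · rw [vvec_eq_mulVec, Matrix.trace]
      simp only [Matrix.diag, Matrix.mul_apply, Matrix.mulVec, dotProduct, Finset.mul_sum]
      rw [Finset.sum_comm]
      refine Finset.sum_congr rfl fun i _ => Finset.sum_congr rfl fun j _ => ?_
      rw [hcM]; ring
  have hex : ∃ p : (Fin n → ℝ) × (Fin n → ℝ), GoodPair n d A α β p.1 p.2 := by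
    have hcT : Mᵀ.adjugate 0 0 ≠ 0 := by rw [← Matrix.adjugate_transpose]; exact hc
    have h1 := ker_eq_span_of_adjugate h hc
    have h2 := ker_eq_span_of_adjugate (by rw [Matrix.det_transpose, h]) hcT
    have hr0 : (fun i => M.adjugate i 0) ≠ 0 := fun h => hc (congrFun h 0)
    obtain ⟨c, hc0, -, h4⟩ := key _ _ hr0 h1 h2
    refine ⟨(fun i => M.adjugate i 0, fun i => Mᵀ.adjugate i 0), hr0,
      fun h => hcT (congrFun h 0), h1, h2, fun h0 => ht ?_⟩
    rw [h4, h0, mul_zero]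
  rw [muLoc, dif_pos hex]
  obtain ⟨hr0, -, hr, hℓ, hv⟩ := hex.choose_spec
  obtain ⟨c, hc0, h3, h4⟩ := key _ _ hr0 hr hℓ
  congr 1
  rw [muVal, relCond, h3, h4, abs_mul, monoSum,
    mul_div_mul_left _ _ (abs_ne_zero.2 hc0)]

end LocalCondition

section Curve

variable {n d : ℕ}

theorem Pmat_apply (A : MatTuple n d) (α β : ℝ) (p q : Fin n) :
    Pmat n d A α β p q = ∑ i : Fin (d + 1), α ^ (i : ℕ) * β ^ (d - (i : ℕ)) * A i p q := by
  simp [Pmat, Matrix.sum_apply]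

/-- The matrix polynomial along the unit circle. -/
noncomputable def circMat (A : MatTuple n d) (θ : ℝ) : Matrix (Fin n) (Fin n) ℝ :=
  Pmat n d A (cos θ) (sin θ)

theorem circMat_apply (A : MatTuple n d) (θ : ℝ) (p q : Fin n) :
    circMat A θ p q = ∑ i : Fin (d + 1), cos θ ^ (i : ℕ) * sin θ ^ (d - (i : ℕ)) * A i p q :=
  Pmat_apply A _ _ p q

theorem hasDerivAt_circMat (A : MatTuple n d) (θ : ℝ) (p q : Fin n) :
    HasDerivAt (fun θ => circMat A θ p q) (-Qmat n d A (cos θ) (sin θ) p q) θ := by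
  simp only [circMat_apply]
  have h : -Qmat n d A (cos θ) (sin θ) p q = ∑ i : Fin (d + 1),
      (((i : ℕ) * cos θ ^ ((i : ℕ) - 1) * -sin θ) * sin θ ^ (d - (i : ℕ)) +
        cos θ ^ (i : ℕ) * (((d - (i : ℕ) : ℕ) : ℝ) * sin θ ^ (d - (i : ℕ) - 1) * cos θ)) *
          A i p q := by
    simp only [Qmat, Pα, Pβ, Matrix.sub_apply, Matrix.smul_apply, Matrix.sum_apply, smul_eq_mul,
      Matrix.of_apply]
    rw [Finset.mul_sum, Finset.mul_sum, ← Finset.sum_sub_distrib, ← Finset.sum_neg_distrib]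
    refine Finset.sum_congr rfl fun i _ => ?_
    rw [Nat.cast_sub (Nat.lt_succ_iff.1 i.2)]
    ring
  rw [h]
  exact HasDerivAt.fun_sum fun i _ =>
    (((hasDerivAt_cos θ).fun_pow _).mul ((hasDerivAt_sin θ).fun_pow _)).mul_const _

theorem hasDerivAt_det_circMat (A : MatTuple n d) (θ : ℝ) :
    HasDerivAt (fun θ => (circMat A θ).det)
      (-((circMat A θ).adjugate * Qmat n d A (cos θ) (sin θ)).trace) θ := by
  have := hasDerivAt_det (M := circMat A) (M' := -Qmat n d A (cos θ) (sin θ)) (r := θ)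
    fun p q => hasDerivAt_circMat A θ p q
  simpa using this

theorem contDiff_circMat {G : Type*} [NormedAddCommGroup G] [NormedSpace ℝ G] {m : WithTop ℕ∞}
    {A : G → MatTuple n d} {τ : G → ℝ} (hA : ContDiff ℝ m A) (hτ : ContDiff ℝ m τ) (p q : Fin n) :
    ContDiff ℝ m fun x => circMat (A x) (τ x) p q := by
  simp only [circMat_apply]
  have hA' : ∀ i p q, ContDiff ℝ m fun x => A x i p q := fun i p q =>
    contDiff_pi.1 (contDiff_pi.1 (contDiff_pi.1 hA i) p) q
  exact ContDiff.sum fun i _ =>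
    (((contDiff_cos.comp hτ).pow _).mul ((contDiff_sin.comp hτ).pow _)).mul (hA' i p q)

/-- The standard basis of the space of tuples. -/
noncomputable def unitTuple (i : Fin (d + 1)) (p q : Fin n) : MatTuple n d :=
  Pi.single i (Pi.single p (Pi.single q 1))

theorem unitTuple_apply (i j : Fin (d + 1)) (p q p' q' : Fin n) :
    unitTuple i p q j p' q' = if j = i ∧ p' = p ∧ q' = q then 1 else 0 := by
  unfold unitTuple
  by_cases h1 : j = i
  · subst h1
    by_cases h2 : p' = p
    · subst h2
      by_cases h3 : q' = q
      · subst h3; simp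
      · simp [h3]
    · simp [h2]
  · simp [h1]

theorem circMat_add_unit (A : MatTuple n d) (r : ℝ) (i : Fin (d + 1)) (p q : Fin n) (θ : ℝ) :
    circMat (A + r • unitTuple i p q) θ =
      circMat A θ + (r * (cos θ ^ (i : ℕ) * sin θ ^ (d - (i : ℕ)))) • Matrix.single p q 1 := by
  ext p' q'
  simp only [circMat_apply, Matrix.add_apply, Matrix.smul_apply, Pi.add_apply, Pi.smul_apply,
    smul_eq_mul, unitTuple_apply, mul_add, Finset.sum_add_distrib, Matrix.single_apply]
  congr 1
  by_cases h : p' = p ∧ q' = q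
  · obtain ⟨rfl, rfl⟩ := h
    simp; ring
  · have h' : ¬(p = p' ∧ q = q') := fun h' => h ⟨h'.1.symm, h'.2.symm⟩
    simp [h, h']

variable [NeZero n]

/-- The value of the entry `A 0 0 0` for which `θ` becomes an eigenvalue. -/
noncomputable def rootCoord (A : MatTuple n d) (θ : ℝ) : ℝ :=
  A 0 0 0 - (circMat A θ).det / (sin θ ^ d * (circMat A θ).adjugate 0 0)

theorem rootCoord_add_unit {A : MatTuple n d} {θ : ℝ} (hs : sin θ ≠ 0)
    (hc : (circMat A θ).adjugate 0 0 ≠ 0) (r : ℝ) :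
    rootCoord (A + r • unitTuple 0 0 0) θ = rootCoord A θ := by
  rw [rootCoord, circMat_add_unit, det_add_smul_single, adjugate_add_smul_single, rootCoord]
  have := pow_ne_zero d hs
  simp only [Pi.add_apply, Pi.smul_apply, unitTuple_apply, smul_eq_mul]
  simp
  field_simp
  ring

theorem rootCoord_add_unit_last (hd : 1 ≤ d) {A : MatTuple n d} {θ : ℝ} (hs : sin θ ≠ 0)
    (hc : (circMat A θ).adjugate 0 0 ≠ 0) (r : ℝ) :
    rootCoord (A + r • unitTuple (Fin.last d) 0 0) θ =
      rootCoord A θ - r * (cos θ / sin θ) ^ d := by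
  rw [rootCoord, circMat_add_unit, det_add_smul_single, adjugate_add_smul_single, rootCoord]
  have := pow_ne_zero d hs
  have h0 : (0 : Fin (d + 1)) ≠ Fin.last d := by
    intro h
    have := congrArg Fin.val h
    simp at this
    omega
  simp only [Pi.add_apply, Pi.smul_apply, unitTuple_apply, smul_eq_mul, h0, Fin.val_last, div_pow]
  simp
  field_simp
  ring

theorem hasDerivAt_rootCoord {A : MatTuple n d} {θ : ℝ} (hs : sin θ ≠ 0)
    (hc : (circMat A θ).adjugate 0 0 ≠ 0) (h : (circMat A θ).det = 0) :
    HasDerivAt (rootCoord A) (((circMat A θ).adjugate * Qmat n d A (cos θ) (sin θ)).trace /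
      (sin θ ^ d * (circMat A θ).adjugate 0 0)) θ := by
  have h1 := hasDerivAt_det_circMat A θ
  have hC : ContDiff ℝ 1 fun θ => sin θ ^ d * (circMat A θ).adjugate 0 0 :=
    (contDiff_sin.pow d).mul
      (contDiff_adjugate (fun p q => contDiff_circMat contDiff_const contDiff_id p q) 0 0)
  have h2 := (hC.differentiable (by norm_num) θ).hasDerivAt
  have hne : sin θ ^ d * (circMat A θ).adjugate 0 0 ≠ 0 := mul_ne_zero (pow_ne_zero d hs) hc
  have h3 := (h1.div h2 hne).const_sub (A 0 0 0)
  refine h3.congr_deriv ?_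
  rw [h]
  field_simp
  ring

theorem det_circMat_rootCoord {A : MatTuple n d} {θ : ℝ} (hs : sin θ ≠ 0)
    (hc : (circMat A θ).adjugate 0 0 ≠ 0) :
    (circMat (A + (rootCoord A θ - A 0 0 0) • unitTuple 0 0 0) θ).det = 0 := by
  rw [circMat_add_unit, det_add_smul_single, rootCoord]
  have := pow_ne_zero d hs
  simp
  field_simp
  ring

end Curve

section Solve

variable {n d : ℕ} [NeZero n]

variable (n d) in
/-- Pairs of an angle in `(0, π)` and a tuple for which the eigenvalue equation can be solved for
the coordinate `A 0 0 0`. -/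
def pairSet : Set (ℝ × MatTuple n d) :=
  {x | x.1 ∈ Set.Ioo 0 π ∧ (circMat x.2 x.1).adjugate 0 0 ≠ 0}

theorem isOpen_pairSet : IsOpen (pairSet n d) := by
  refine (isOpen_Ioo.preimage continuous_fst).inter ?_
  exact (contDiff_adjugate (m := 0) (fun p q => contDiff_circMat contDiff_snd contDiff_fst p q)
    0 0).continuous.isOpen_preimage _ isOpen_compl_singleton

theorem sin_ne_zero_of_mem_pairSet {x : ℝ × MatTuple n d} (hx : x ∈ pairSet n d) : sin x.1 ≠ 0 :=
  (sin_pos_of_mem_Ioo hx.1).ne'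

theorem contDiffAt_rootCoord {x : ℝ × MatTuple n d} (hx : x ∈ pairSet n d) :
    ContDiffAt ℝ 2 (fun x : ℝ × MatTuple n d => rootCoord x.2 x.1) x := by
  have h0 : ContDiff ℝ 2 fun x : ℝ × MatTuple n d => x.2 0 0 0 := by fun_prop
  have hM : ∀ p q, ContDiff ℝ 2 fun x : ℝ × MatTuple n d => circMat x.2 x.1 p q :=
    fun p q => contDiff_circMat contDiff_snd contDiff_fst p q
  exact h0.contDiffAt.sub ((contDiff_det hM).contDiffAt.div
    (((contDiff_sin.comp contDiff_fst).pow d).mul (contDiff_adjugate hM 0 0)).contDiffAt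
    (mul_ne_zero (pow_ne_zero d (sin_ne_zero_of_mem_pairSet hx)) hx.2))

/-- The tuple obtained from `A` by changing `A 0 0 0` so that `θ` becomes an eigenvalue. -/
noncomputable def solveAt (A : MatTuple n d) (θ : ℝ) : MatTuple n d :=
  A + (rootCoord A θ - A 0 0 0) • unitTuple 0 0 0

theorem solveAt_apply_zero (A : MatTuple n d) (θ : ℝ) : solveAt A θ 0 0 0 = rootCoord A θ := by
  simp [solveAt, unitTuple_apply]

theorem adjugate_circMat_add (A : MatTuple n d) (r θ : ℝ) :
    (circMat (A + r • unitTuple 0 0 0) θ).adjugate 0 0 = (circMat A θ).adjugate 0 0 := by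
  rw [circMat_add_unit, adjugate_add_smul_single]

theorem solveAt_add_unit {A : MatTuple n d} {θ : ℝ} (hx : (θ, A) ∈ pairSet n d) (r : ℝ) :
    solveAt (A + r • unitTuple 0 0 0) θ = solveAt A θ := by
  rw [solveAt, rootCoord_add_unit (sin_ne_zero_of_mem_pairSet hx) hx.2, solveAt, add_assoc,
    ← add_smul]
  congr 2
  simp [unitTuple_apply]
  ring

/-- The derivative, up to sign, of the determinant along the circle. -/
noncomputable def eigDeriv (A : MatTuple n d) (θ : ℝ) : ℝ :=
  ((circMat A θ).adjugate * Qmat n d A (cos θ) (sin θ)).trace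

omit [NeZero n] in
theorem continuous_eigDeriv : Continuous fun x : ℝ × MatTuple n d => eigDeriv x.2 x.1 := by
  have hM : ∀ p q, ContDiff ℝ 0 fun x : ℝ × MatTuple n d => circMat x.2 x.1 p q :=
    fun p q => contDiff_circMat contDiff_snd contDiff_fst p q
  have hQ : ∀ p q, Continuous fun x : ℝ × MatTuple n d =>
      Qmat n d x.2 (cos x.1) (sin x.1) p q := fun p q => by
    simp only [Qmat, Pα, Pβ, Matrix.sub_apply, Matrix.smul_apply, Matrix.sum_apply, smul_eq_mul,
      Matrix.of_apply]
    fun_prop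
  simp only [eigDeriv, Matrix.trace, Matrix.diag, Matrix.mul_apply]
  exact continuous_finsetSum _ fun i _ => continuous_finsetSum _ fun j _ =>
    (contDiff_adjugate hM i j).continuous.mul (hQ j i)

omit [NeZero n] in
theorem continuous_adjNorm : Continuous fun x : ℝ × MatTuple n d => adjNorm (circMat x.2 x.1) := by
  have hM : ∀ p q, ContDiff ℝ 0 fun x : ℝ × MatTuple n d => circMat x.2 x.1 p q :=
    fun p q => contDiff_circMat contDiff_snd contDiff_fst p q
  exact (continuous_finsetSum _ fun e _ => (contDiff_adjugate hM e.2 e.1).continuous.pow 2).sqrt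

theorem continuousOn_solveAt :
    ContinuousOn (fun x : ℝ × MatTuple n d => solveAt x.2 x.1) (pairSet n d) := by
  have h1 : ContinuousOn (fun x : ℝ × MatTuple n d => rootCoord x.2 x.1) (pairSet n d) :=
    fun x hx => (contDiffAt_rootCoord hx).continuousAt.continuousWithinAt
  have h2 : Continuous fun x : ℝ × MatTuple n d => x.2 0 0 0 := by fun_prop
  exact continuous_snd.continuousOn.add ((h1.sub h2.continuousOn).smul continuousOn_const)

variable (n d) in
/-- Tuples whose coordinate `A 0 0 0` is an angle for which the eigenvalue equation can be
solved. -/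
def angleSet : Set (MatTuple n d) := {w | (w 0 0 0, w) ∈ pairSet n d}

/-- Replace the angle stored in the coordinate `w 0 0 0` by the entry making it an eigenvalue. -/
noncomputable def solveMap (w : MatTuple n d) : MatTuple n d := solveAt w (w 0 0 0)

variable (n d) in
/-- The coordinate `A 0 0 0` as a linear form. -/
noncomputable def coordForm : MatTuple n d →L[ℝ] ℝ :=
  (ContinuousLinearMap.proj (R := ℝ) (φ := fun _ : Fin n => ℝ) 0).comp
    ((ContinuousLinearMap.proj (R := ℝ) (φ := fun _ : Fin n => Fin n → ℝ) 0).comp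
      (ContinuousLinearMap.proj (R := ℝ) (φ := fun _ : Fin (d + 1) => Fin n → Fin n → ℝ) 0))

theorem coordForm_apply (w : MatTuple n d) : coordForm n d w = w 0 0 0 := rfl

theorem coordForm_unit : coordForm n d (unitTuple 0 0 0) = 1 := by
  simp [coordForm_apply, unitTuple_apply]

theorem continuous_pairing : Continuous fun w : MatTuple n d => (w 0 0 0, w) := by fun_prop

theorem isOpen_angleSet : IsOpen (angleSet n d) := isOpen_pairSet.preimage continuous_pairing

theorem contDiffAt_rootCoord_self {w : MatTuple n d} (hw : w ∈ angleSet n d) :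
    ContDiffAt ℝ 2 (fun w : MatTuple n d => rootCoord w (w 0 0 0)) w := by
  have h0 : ContDiff ℝ 2 fun w : MatTuple n d => (w 0 0 0, w) := by fun_prop
  exact ContDiffAt.comp w (g := fun x : ℝ × MatTuple n d => rootCoord x.2 x.1)
    (f := fun w : MatTuple n d => (w 0 0 0, w)) (contDiffAt_rootCoord hw) h0.contDiffAt

/-- The derivative of `solveMap`. -/
noncomputable def solveMapDeriv (w : MatTuple n d) : MatTuple n d →L[ℝ] MatTuple n d :=
  ContinuousLinearMap.id ℝ _ +
    (fderiv ℝ (fun w : MatTuple n d => rootCoord w (w 0 0 0)) w - coordForm n d).smulRight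
      (unitTuple 0 0 0)

theorem hasFDerivAt_solveMap {w : MatTuple n d} (hw : w ∈ angleSet n d) :
    HasFDerivAt solveMap (solveMapDeriv w) w :=
  (hasFDerivAt_id w).add
    ((((contDiffAt_rootCoord_self hw).differentiableAt (by norm_num)).hasFDerivAt.sub
      (coordForm n d).hasFDerivAt).smul_const (unitTuple 0 0 0))

theorem det_solveMapDeriv_eq_apply (w : MatTuple n d) :
    (solveMapDeriv w).det =
      fderiv ℝ (fun w : MatTuple n d => rootCoord w (w 0 0 0)) w (unitTuple 0 0 0) := by
  have h : (solveMapDeriv w : MatTuple n d →ₗ[ℝ] MatTuple n d) = LinearMap.transvection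
      ((fderiv ℝ (fun w : MatTuple n d => rootCoord w (w 0 0 0)) w - coordForm n d :
        MatTuple n d →L[ℝ] ℝ) : MatTuple n d →ₗ[ℝ] ℝ) (unitTuple 0 0 0) := by
    ext1 v
    rfl
  rw [ContinuousLinearMap.det, h, LinearMap.transvection.det]
  have := coordForm_unit (n := n) (d := d)
  simp only [ContinuousLinearMap.coe_coe, sub_apply, this]
  ring

theorem hasDerivAt_rootCoord_solveMapDeriv {w : MatTuple n d} (hw : w ∈ angleSet n d) :
    HasDerivAt (rootCoord w) (solveMapDeriv w).det (w 0 0 0) := by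
  rw [det_solveMapDeriv_eq_apply]
  have h1 : HasDerivAt (fun r : ℝ => w + (r - w 0 0 0) • unitTuple 0 0 0) (unitTuple 0 0 0)
      (w 0 0 0) := by
    simpa using (((hasDerivAt_id (w 0 0 0)).sub_const (w 0 0 0)).smul_const
      (unitTuple (d := d) (n := n) 0 0 0)).const_add w
  have h2 : HasFDerivAt (fun w : MatTuple n d => rootCoord w (w 0 0 0))
      (fderiv ℝ (fun w : MatTuple n d => rootCoord w (w 0 0 0)) w)
      (w + (w 0 0 0 - w 0 0 0) • unitTuple 0 0 0) := by
    simpa using ((contDiffAt_rootCoord_self hw).differentiableAt (by norm_num)).hasFDerivAt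
  refine (h2.comp_hasDerivAt (w 0 0 0) h1).congr_of_eventuallyEq ?_
  have hc : Continuous fun r : ℝ => (r, w) := by fun_prop
  filter_upwards [hc.continuousAt.preimage_mem_nhds (isOpen_pairSet.mem_nhds hw)] with r hr
  have e : (w + (r - w 0 0 0) • unitTuple 0 0 0 : MatTuple n d) 0 0 0 = r := by
    simp [unitTuple_apply]
  simp only [Function.comp, e]
  exact (rootCoord_add_unit (sin_ne_zero_of_mem_pairSet hr) hr.2 _).symm

theorem det_solveMap {w : MatTuple n d} (hw : w ∈ angleSet n d) :
    (circMat (solveMap w) (w 0 0 0)).det = 0 := by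
  have hs : sin (w 0 0 0) ≠ 0 := sin_ne_zero_of_mem_pairSet (x := (w 0 0 0, w)) hw
  exact det_circMat_rootCoord hs hw.2

theorem adjugate_solveMap (w : MatTuple n d) :
    (circMat (solveMap w) (w 0 0 0)).adjugate 0 0 = (circMat w (w 0 0 0)).adjugate 0 0 :=
  adjugate_circMat_add _ _ _

theorem det_solveMapDeriv {w : MatTuple n d} (hw : w ∈ angleSet n d) :
    (solveMapDeriv w).det = eigDeriv (solveMap w) (w 0 0 0) /
      (sin (w 0 0 0) ^ d * (circMat w (w 0 0 0)).adjugate 0 0) := by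
  have hs := sin_ne_zero_of_mem_pairSet hw
  have h1 := hasDerivAt_rootCoord (A := solveMap w) hs
    (by rw [adjugate_solveMap]; exact hw.2) (det_solveMap hw)
  rw [adjugate_solveMap] at h1
  refine (hasDerivAt_rootCoord_solveMapDeriv hw).unique (h1.congr_of_eventuallyEq ?_)
  have hc : Continuous fun r : ℝ => (r, w) := by fun_prop
  filter_upwards [hc.continuousAt.preimage_mem_nhds (isOpen_pairSet.mem_nhds hw)] with r hr
  exact (rootCoord_add_unit (sin_ne_zero_of_mem_pairSet hr) hr.2 _).symm

/-- Elements of the fibres of `solveMap` are determined by their angle, which is an eigenvalue. -/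
theorem mem_fiber_iff {w A : MatTuple n d} :
    w ∈ angleSet n d ∧ solveMap w = A ↔
      (w = A + (w 0 0 0 - A 0 0 0) • unitTuple 0 0 0 ∧ (w 0 0 0, A) ∈ pairSet n d ∧
        (circMat A (w 0 0 0)).det = 0) := by
  constructor
  · rintro ⟨hw, rfl⟩
    refine ⟨?_, ⟨hw.1, ?_⟩, det_solveMap hw⟩
    · rw [solveMap, solveAt_apply_zero, solveAt, add_assoc, ← add_smul]
      simp
    · simp only [adjugate_solveMap]; exact hw.2
  · rintro ⟨h1, h2, h3⟩
    set θ := w 0 0 0 with hθ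
    have hw : (θ, w) ∈ pairSet n d := ⟨h2.1, by rw [h1, adjugate_circMat_add]; exact h2.2⟩
    refine ⟨hw, ?_⟩
    rw [solveMap, ← hθ, h1, solveAt_add_unit h2, solveAt, rootCoord, h3]
    simp

instance isAddHaarMeasure_volume_matTuple :
    (volume : Measure (MatTuple n d)).IsAddHaarMeasure := by
  have h1 : (volume : Measure (Fin n → Fin n → ℝ)).IsAddHaarMeasure := 
    Measure.pi.isAddHaarMeasure _
  exact Measure.pi.isAddHaarMeasure _

theorem ae_eigDeriv_ne_zero :
    ∀ᵐ A : MatTuple n d, ∀ θ, (θ, A) ∈ pairSet n d → (circMat A θ).det = 0 → eigDeriv A θ ≠ 0 := by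
  have h := addHaar_image_eq_zero_of_det_fderivWithin_eq_zero (volume : Measure (MatTuple n d))
    (f := solveMap) (f' := solveMapDeriv)
    (s := {w ∈ angleSet n d | eigDeriv (solveMap w) (w 0 0 0) = 0})
    (fun w hw => (hasFDerivAt_solveMap hw.1).hasFDerivWithinAt)
    (fun w hw => by rw [det_solveMapDeriv hw.1, hw.2, zero_div])
  filter_upwards [compl_mem_ae_iff.2 h] with A hA θ hθ hdet h0
  have e : (A + (θ - A 0 0 0) • unitTuple 0 0 0 : MatTuple n d) 0 0 0 = θ := by
    simp [unitTuple_apply]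
  have hf := (mem_fiber_iff (w := A + (θ - A 0 0 0) • unitTuple 0 0 0) (A := A)).2
    (by rw [e]; exact ⟨rfl, hθ, hdet⟩)
  exact hA ⟨_, ⟨hf.1, by rw [hf.2, e, h0]⟩, hf.2⟩

end Solve

section GaussDensity

variable {n d : ℕ}

/-- The density of the Gaussian measure on tuples. -/
noncomputable def gaussDens (A : MatTuple n d) : ℝ :=
  ∏ i, ∏ p, ∏ q, gaussianPDFReal 0 1 (A i p q)

theorem gaussTuple_eq_withDensity :
    gaussTuple n d = volume.withDensity fun A => ENNReal.ofReal (gaussDens A) := by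
  have h1 : (Measure.pi fun _ : Fin n => gaussianReal 0 1) =
      (volume : Measure (Fin n → ℝ)).withDensity fun x =>
        ENNReal.ofReal (∏ q, gaussianPDFReal 0 1 (x q)) := pi_gaussianReal fun _ => one_ne_zero
  have i1 : Integrable fun x : Fin n → ℝ => ∏ q, gaussianPDFReal 0 1 (x q) :=
    Integrable.fintype_prod fun _ => integrable_gaussianPDFReal 0 1
  have n1 : ∀ x : Fin n → ℝ, 0 ≤ ∏ q, gaussianPDFReal 0 1 (x q) := fun x =>
    Finset.prod_nonneg fun q _ => gaussianPDFReal_nonneg 0 1 (x q)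
  have h2 : (Measure.pi fun _ : Fin n => Measure.pi fun _ : Fin n => gaussianReal 0 1) =
      (volume : Measure (Fin n → Fin n → ℝ)).withDensity fun x =>
        ENNReal.ofReal (∏ p, ∏ q, gaussianPDFReal 0 1 (x p q)) := by
    simp_rw [h1]
    exact pi_withDensity_ofReal (fun _ => volume) (fun _ => n1) fun _ => i1
  have i2 : Integrable fun x : Fin n → Fin n → ℝ => ∏ p, ∏ q, gaussianPDFReal 0 1 (x p q) :=
    Integrable.fintype_prod fun _ => i1
  rw [gaussTuple]
  simp_rw [h2]
  exact pi_withDensity_ofReal (fun _ => volume)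
    (fun _ x => Finset.prod_nonneg fun p _ => n1 (x p)) fun _ => i2

theorem continuous_gaussDens : Continuous (gaussDens (n := n) (d := d)) := by
  have : Continuous (gaussianPDFReal 0 1) := by
    rw [gaussianPDFReal_def]; fun_prop
  exact continuous_finsetProd _ fun i _ => continuous_finsetProd _ fun p _ =>
    continuous_finsetProd _ fun q _ => this.comp (by fun_prop)

theorem gaussDens_pos (A : MatTuple n d) : 0 < gaussDens A :=
  Finset.prod_pos fun _ _ => Finset.prod_pos fun _ _ => Finset.prod_pos fun _ _ =>
    gaussianPDFReal_pos 0 1 _ one_ne_zero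

theorem lintegral_gaussTuple {H : MatTuple n d → ℝ≥0∞} (hH : Measurable H) :
    ∫⁻ A, H A ∂gaussTuple n d = ∫⁻ A, ENNReal.ofReal (gaussDens A) * H A := by
  rw [gaussTuple_eq_withDensity, lintegral_withDensity_eq_lintegral_mul _
    continuous_gaussDens.measurable.ennreal_ofReal hH]
  rfl

theorem gaussDens_eq_exp (A : MatTuple n d) :
    gaussDens A = ((((√(2 * π))⁻¹ ^ n) ^ n) ^ (d + 1)) *
      exp (-(∑ i, ∑ p, ∑ q, A i p q ^ 2) / 2) := by
  simp only [gaussDens, gaussianPDFReal_zero_one, Finset.prod_mul_distrib, ← Real.exp_sum,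
    Finset.prod_const, Finset.card_univ, Fintype.card_fin]
  congr 2
  simp only [neg_div, Finset.sum_neg_distrib, Finset.sum_div]

theorem gaussDens_resample [NeZero n] (A : MatTuple n d) (t : ℝ) :
    gaussDens (A + (t - A 0 0 0) • unitTuple 0 0 0) * gaussianPDFReal 0 1 (A 0 0 0) =
      gaussDens A * gaussianPDFReal 0 1 t := by
  have key : ∑ i, ∑ p, ∑ q, (A + (t - A 0 0 0) • unitTuple 0 0 0 : MatTuple n d) i p q ^ 2 =
      (∑ i, ∑ p, ∑ q, A i p q ^ 2) + (t ^ 2 - A 0 0 0 ^ 2) := by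
    have h : ∀ i p q, (A + (t - A 0 0 0) • unitTuple 0 0 0 : MatTuple n d) i p q ^ 2 =
        A i p q ^ 2 + (if i = 0 then if p = 0 then if q = 0 then t ^ 2 - A 0 0 0 ^ 2 else 0
          else 0 else 0) := by
      intro i p q
      simp only [Pi.add_apply, Pi.smul_apply, unitTuple_apply, smul_eq_mul]
      by_cases h1 : i = 0
      · by_cases h2 : p = 0
        · by_cases h3 : q = 0
          · subst h1 h2 h3; simp
          · simp [h3]
        · simp [h2]
      · simp [h1]
    simp only [h, Finset.sum_add_distrib]
    simp
  rw [gaussDens_eq_exp, gaussDens_eq_exp, key, gaussianPDFReal_zero_one, gaussianPDFReal_zero_one]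
  have e : exp (-((∑ i, ∑ p, ∑ q, A i p q ^ 2) + (t ^ 2 - A 0 0 0 ^ 2)) / 2) *
      exp (-A 0 0 0 ^ 2 / 2) = exp (-(∑ i, ∑ p, ∑ q, A i p q ^ 2) / 2) * exp (-t ^ 2 / 2) := by
    rw [← exp_add, ← exp_add]; ring_nf
  linear_combination (((√(2 * π))⁻¹ ^ n) ^ n) ^ (d + 1) * (√(2 * π))⁻¹ * e

end GaussDensity

section RootSum

variable {n d : ℕ} [NeZero n]

variable (n d) in
/-- The regular points of `solveMap`. -/
def regSet : Set (MatTuple n d) := {w | w ∈ angleSet n d ∧ eigDeriv (solveMap w) (w 0 0 0) ≠ 0}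

theorem continuousOn_solveMap_pairing :
    ContinuousOn (fun w : MatTuple n d => (w 0 0 0, solveMap w)) (angleSet n d) := by
  have h := continuousOn_solveAt.comp (continuous_pairing (n := n) (d := d)).continuousOn
    (s := angleSet n d) fun w hw => hw
  have h0 : Continuous fun w : MatTuple n d => w 0 0 0 := by fun_prop
  exact h0.continuousOn.prodMk h

theorem isOpen_regSet : IsOpen (regSet n d) :=
  (continuous_eigDeriv.comp_continuousOn continuousOn_solveMap_pairing).isOpen_inter_preimage
    isOpen_angleSet isOpen_compl_singleton

omit [NeZero n] in
theorem relCond_circle (A : MatTuple n d) (θ : ℝ) : relCond n d A (cos θ) (sin θ) =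
    √(monoSum d (cos θ) (sin θ)) * (adjNorm (circMat A θ) / |eigDeriv A θ|) := rfl

theorem continuous_monoSum_circle : Continuous fun θ : ℝ => √(monoSum d (cos θ) (sin θ)) := by
  unfold monoSum; fun_prop

theorem continuousOn_relCond_solveMap :
    ContinuousOn (fun w => relCond n d (solveMap w) (cos (w 0 0 0)) (sin (w 0 0 0)))
      (regSet n d) := by
  have hp := (continuousOn_solveMap_pairing (n := n) (d := d)).mono
    (fun w hw => hw.1 : regSet n d ⊆ angleSet n d)
  have h0 : Continuous fun w : MatTuple n d => w 0 0 0 := by fun_prop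
  have h1 := (continuous_monoSum_circle (d := d)).comp h0
  have h2 := continuous_adjNorm.comp_continuousOn hp
  have h3 := continuous_eigDeriv.comp_continuousOn hp
  exact h1.continuousOn.mul (h2.div h3.abs fun w hw => abs_ne_zero.2 hw.2)

/-- The sum of the relative condition numbers over the fibre of `solveMap`. -/
noncomputable def rootSum (A : MatTuple n d) : ℝ≥0∞ :=
  ∑' w, Set.indicator {w | w ∈ regSet n d ∧ solveMap w = A} ((regSet n d).indicator fun w =>
    ENNReal.ofReal (relCond n d (solveMap w) (cos (w 0 0 0)) (sin (w 0 0 0)))) w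

theorem det_solveMapDeriv_ne_zero {w : MatTuple n d} (hw : w ∈ regSet n d) :
    (solveMapDeriv w).det ≠ 0 := by
  have hs : sin (w 0 0 0) ≠ 0 := sin_ne_zero_of_mem_pairSet (x := (w 0 0 0, w)) hw.1
  rw [det_solveMapDeriv hw.1]
  exact div_ne_zero hw.2 (mul_ne_zero (pow_ne_zero d hs) hw.1.2)

theorem measurable_rootSum : Measurable (rootSum (n := n) (d := d)) :=
  (lintegral_tsum_preimage_eq volume isOpen_regSet.measurableSet
    (fun _ hw => (hasFDerivAt_solveMap hw.1).hasFDerivWithinAt)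
    (fun _ hw => det_solveMapDeriv_ne_zero hw)
    (measurable_indicator_of_continuousOn isOpen_regSet continuousOn_relCond_solveMap)).1

/-- The integrand of the condition number after the change of variables. -/
noncomputable def angleWeight (θ : ℝ) (A : MatTuple n d) : ℝ :=
  √(monoSum d (cos θ) (sin θ)) *
    (adjNorm (circMat (solveAt A θ) θ) / |sin θ ^ d * (circMat A θ).adjugate 0 0|)

omit [NeZero n] in
theorem adjNorm_nonneg (M : Matrix (Fin n) (Fin n) ℝ) : 0 ≤ adjNorm M := Real.sqrt_nonneg _

omit [NeZero n] in
theorem relCond_nonneg (A : MatTuple n d) (θ : ℝ) : 0 ≤ relCond n d A (cos θ) (sin θ) :=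
  mul_nonneg (Real.sqrt_nonneg _) (div_nonneg (adjNorm_nonneg _) (abs_nonneg _))

theorem lintegral_rootSum_eq_regSet :
    ∫⁻ A, rootSum A ∂gaussTuple n d = ∫⁻ w in regSet n d,
      ENNReal.ofReal (angleWeight (w 0 0 0) w * gaussDens (solveMap w)) := by
  have hc : ContinuousOn (fun w : MatTuple n d =>
      relCond n d (solveMap w) (cos (w 0 0 0)) (sin (w 0 0 0)) * gaussDens (solveMap w))
      (regSet n d) :=
    continuousOn_relCond_solveMap.mul (continuous_gaussDens.comp_continuousOn
      (continuousOn_solveMap_pairing.mono (fun w hw => hw.1 : regSet n d ⊆ angleSet n d)).snd)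
  have h := (lintegral_tsum_preimage_eq volume isOpen_regSet.measurableSet
    (fun _ hw => (hasFDerivAt_solveMap hw.1).hasFDerivWithinAt)
    (fun _ hw => det_solveMapDeriv_ne_zero hw)
    (measurable_indicator_of_continuousOn isOpen_regSet hc)).2
  rw [lintegral_gaussTuple measurable_rootSum]
  convert h using 1
  · refine lintegral_congr fun A => ?_
    rw [rootSum, ← ENNReal.tsum_mul_left]
    refine tsum_congr fun w => ?_
    by_cases hw : w ∈ {w | w ∈ regSet n d ∧ solveMap w = A}
    · rw [Set.indicator_of_mem hw, Set.indicator_of_mem hw, Set.indicator_of_mem hw.1,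
        Set.indicator_of_mem hw.1, hw.2, mul_comm, ENNReal.ofReal_mul (relCond_nonneg _ _)]
    · rw [Set.indicator_of_notMem hw, Set.indicator_of_notMem hw, mul_zero]
  · refine setLIntegral_congr_fun isOpen_regSet.measurableSet fun w hw => ?_
    rw [Set.indicator_of_mem hw, ← ENNReal.ofReal_mul (abs_nonneg _), det_solveMapDeriv hw.1,
      relCond_circle, angleWeight, abs_div]
    have h2 : |eigDeriv (solveMap w) (w 0 0 0)| ≠ 0 := abs_ne_zero.2 hw.2
    congr 1
    rw [show solveAt w (w 0 0 0) = solveMap w from rfl]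
    field_simp

theorem unit_last_apply_zero (hd : 1 ≤ d) : unitTuple (n := n) (Fin.last d) 0 0 0 0 0 = 0 := by
  rw [unitTuple_apply, if_neg]
  rintro ⟨h, -⟩
  have := congrArg Fin.val h
  simp at this
  omega

theorem eq_zero_of_det_solveMapDeriv_eq_zero (hd : 1 ≤ d) {w : MatTuple n d} {r : ℝ}
    (hw : w ∈ angleSet n d) (hr : w + r • unitTuple (Fin.last d) 0 0 ∈ angleSet n d)
    (h0 : (solveMapDeriv w).det = 0)
    (h1 : (solveMapDeriv (w + r • unitTuple (Fin.last d) 0 0)).det = 0)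
    (hcos : cos (w 0 0 0) ≠ 0) : r = 0 := by
  have e : (w + r • unitTuple (Fin.last d) 0 0 : MatTuple n d) 0 0 0 = w 0 0 0 := by
    simp only [Pi.add_apply, Pi.smul_apply]
    rw [unit_last_apply_zero hd, smul_zero, add_zero]
  have d0 := hasDerivAt_rootCoord_solveMapDeriv hw
  have d1 := hasDerivAt_rootCoord_solveMapDeriv hr
  rw [h0] at d0
  rw [h1, e] at d1
  have hs : sin (w 0 0 0) ≠ 0 := sin_ne_zero_of_mem_pairSet (x := (w 0 0 0, w)) hw
  have d2 := (((hasDerivAt_cos (w 0 0 0)).div (hasDerivAt_sin _) hs).pow d).const_mul r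
  have d3 := d0.sub d2
  have d4 := d1.congr_of_eventuallyEq (f₁ := rootCoord w - fun θ => r * (cos / sin) θ ^ d) (by
    have hc : Continuous fun r : ℝ => (r, w) := by fun_prop
    filter_upwards [hc.continuousAt.preimage_mem_nhds (isOpen_pairSet.mem_nhds hw)] with θ hθ
    exact (rootCoord_add_unit_last hd (sin_ne_zero_of_mem_pairSet hθ) hθ.2 r).symm)
  have h5 := d3.unique d4
  have hne : (d : ℝ) ≠ 0 := by positivity
  have hsq : -sin (w 0 0 0) * sin (w 0 0 0) - cos (w 0 0 0) * cos (w 0 0 0) = -1 := by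
    linarith [sin_sq_add_cos_sq (w 0 0 0)]
  rw [hsq] at h5
  simp only [zero_sub, neg_eq_zero, mul_eq_zero, Pi.div_apply] at h5
  rcases h5 with h5 | (h5 | h5) | h5
  · exact h5
  · exact absurd h5 hne
  · exact absurd h5 (pow_ne_zero _ (div_ne_zero hcos hs))
  · exact absurd h5 (div_ne_zero (by norm_num) (pow_ne_zero 2 hs))

theorem volume_angleSet_diff_regSet (hd : 1 ≤ d) : volume (angleSet n d \ regSet n d) = 0 := by
  have hc0 : Continuous fun w : MatTuple n d => w 0 0 0 := by fun_prop
  have h1 : volume {w : MatTuple n d | w 0 0 0 = π / 2} = 0 := by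
    refine measure_eq_zero_of_forall_line volume
      (isClosed_eq hc0 continuous_const).measurableSet (unitTuple 0 0 0) fun w => ?_
    refine Set.Subsingleton.measure_zero (fun r hr s hs => ?_) _
    simp only [Set.mem_ofPred_eq, Pi.add_apply, Pi.smul_apply, unitTuple_apply, smul_eq_mul,
      and_self, if_true, mul_one] at hr hs
    linarith
  have h2 : volume ((angleSet n d \ regSet n d) ∩ {w | cos (w 0 0 0) ≠ 0}) = 0 := by
    refine measure_eq_zero_of_forall_line volume ((isOpen_angleSet.measurableSet.diff
      isOpen_regSet.measurableSet).inter ((continuous_cos.comp hc0).isOpen_preimage _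
        isOpen_compl_singleton).measurableSet) (unitTuple (Fin.last d) 0 0) fun w => ?_
    refine Set.Subsingleton.measure_zero (fun r hr s hs => ?_) _
    have hdet : ∀ w ∈ angleSet n d \ regSet n d, (solveMapDeriv w).det = 0 := fun w hw => by
      rw [det_solveMapDeriv hw.1, show eigDeriv (solveMap w) (w 0 0 0) = 0 from
        not_not.1 fun h => hw.2 ⟨hw.1, h⟩, zero_div]
    have e : w + s • unitTuple (Fin.last d) 0 0 =
        (w + r • unitTuple (Fin.last d) 0 0) + (s - r) • unitTuple (Fin.last d) 0 0 := by
      rw [add_assoc, ← add_smul, add_sub_cancel]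
    have hs1 : w + s • unitTuple (Fin.last d) 0 0 ∈ angleSet n d \ regSet n d := hs.1
    rw [e] at hs1
    have := eq_zero_of_det_solveMapDeriv_eq_zero hd hr.1.1 hs1.1 (hdet _ hr.1) (hdet _ hs1) hr.2
    linarith
  refine measure_mono_null (fun w hw => ?_) (measure_union_null h1 h2)
  by_cases hcos : cos (w 0 0 0) = 0
  · left
    obtain ⟨h0, hπ⟩ := hw.1.1
    simp only at h0 hπ
    exact injOn_cos ⟨h0.le, hπ.le⟩ ⟨by positivity, by linarith⟩ (by rw [hcos, cos_pi_div_two])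
  · exact Or.inr ⟨hw, hcos⟩

end RootSum

section Resample

variable {n d : ℕ} [NeZero n]

omit [NeZero n] in
theorem continuousOn_adjNorm_circMat {X : Type*} [TopologicalSpace X] {τ : X → ℝ}
    {A : X → MatTuple n d} {s : Set X} (hτ : ContinuousOn τ s) (hA : ContinuousOn A s) :
    ContinuousOn (fun x => adjNorm (circMat (A x) (τ x))) s := by
  have h := continuous_adjNorm.comp_continuousOn (hτ.prodMk hA)
  simp only [Function.comp_def] at h
  exact h

omit [NeZero n] in
theorem continuous_gaussianPDFReal (v : NNReal) : Continuous (gaussianPDFReal 0 v) := by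
  rw [gaussianPDFReal_def]; fun_prop

/-- The contribution of an angle and a tuple to the mean of `rootSum`. -/
noncomputable def angleTerm (x : ℝ × MatTuple n d) : ℝ≥0∞ :=
  (pairSet n d).indicator
    (fun x => ENNReal.ofReal (angleWeight x.1 x.2 * gaussianPDFReal 0 1 (rootCoord x.2 x.1))) x

theorem measurable_angleTerm : Measurable (angleTerm (n := n) (d := d)) := by
  have h1 : ContinuousOn (fun x : ℝ × MatTuple n d => rootCoord x.2 x.1) (pairSet n d) :=
    fun x hx => (contDiffAt_rootCoord hx).continuousAt.continuousWithinAt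
  have h2 : ContinuousOn (fun x : ℝ × MatTuple n d => adjNorm (circMat (solveAt x.2 x.1) x.1))
      (pairSet n d) := continuousOn_adjNorm_circMat continuousOn_fst continuousOn_solveAt
  have h3 : Continuous fun x : ℝ × MatTuple n d => (circMat x.2 x.1).adjugate 0 0 :=
    (contDiff_adjugate (m := 0)
      (fun p q => contDiff_circMat contDiff_snd contDiff_fst p q) 0 0).continuous
  have h4 : Continuous fun x : ℝ × MatTuple n d => sin x.1 ^ d := by fun_prop
  have h5 : Continuous fun x : ℝ × MatTuple n d => √(monoSum d (cos x.1) (sin x.1)) :=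
    continuous_monoSum_circle.comp continuous_fst
  have h6 : ContinuousOn (fun x : ℝ × MatTuple n d => angleWeight x.1 x.2) (pairSet n d) :=
    h5.continuousOn.mul (h2.div (h4.mul h3).abs.continuousOn fun x hx => abs_ne_zero.2
      (mul_ne_zero (pow_ne_zero d (sin_ne_zero_of_mem_pairSet hx)) hx.2))
  have h7 : ContinuousOn (fun x : ℝ × MatTuple n d => gaussianPDFReal 0 1 (rootCoord x.2 x.1))
      (pairSet n d) := (continuous_gaussianPDFReal 1).comp_continuousOn h1
  exact measurable_indicator_of_continuousOn isOpen_pairSet (h6.mul h7)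

theorem angleTerm_add_unit (θ r : ℝ) (A : MatTuple n d) :
    angleTerm (θ, A + r • unitTuple 0 0 0) = angleTerm (θ, A) := by
  have h : (θ, A + r • unitTuple 0 0 0) ∈ pairSet n d ↔ (θ, A) ∈ pairSet n d := by
    simp only [pairSet, Set.mem_ofPred_eq, adjugate_circMat_add]
  by_cases hx : (θ, A) ∈ pairSet n d
  · rw [angleTerm, angleTerm, Set.indicator_of_mem hx, Set.indicator_of_mem (h.2 hx)]
    simp only [angleWeight]
    rw [solveAt_add_unit hx, adjugate_circMat_add,
      rootCoord_add_unit (sin_ne_zero_of_mem_pairSet hx) hx.2]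
  · rw [angleTerm, angleTerm, Set.indicator_of_notMem hx,
      Set.indicator_of_notMem fun h' => hx (h.1 h')]

theorem lintegral_rootSum_eq_angleTerm (hd : 1 ≤ d) :
    ∫⁻ A : MatTuple n d, rootSum A ∂gaussTuple n d =
      ∫⁻ θ : ℝ, (∫⁻ A : MatTuple n d, angleTerm (θ, A) ∂gaussTuple n d) := by
  have hφ : ∀ x, 0 < gaussianPDFReal 0 1 x := fun x => gaussianPDFReal_pos 0 1 x one_ne_zero
  have hφc := continuous_gaussianPDFReal 1
  set H : MatTuple n d → ℝ≥0∞ := fun w =>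
    ENNReal.ofReal (gaussDens w / gaussianPDFReal 0 1 (w 0 0 0)) * angleTerm (w 0 0 0, w) with hH
  have hc0 : Continuous fun w : MatTuple n d => w 0 0 0 := by fun_prop
  have hHm : Measurable H :=
    (continuous_gaussDens.div (hφc.comp hc0) fun w => (hφ _).ne').measurable.ennreal_ofReal.mul
      (measurable_angleTerm.comp continuous_pairing.measurable)
  have hae : regSet n d =ᵐ[volume] angleSet n d :=
    (ae_le_set.2 (by rw [Set.sdiff_eq_empty.2 fun w hw => hw.1, measure_empty])).antisymm
      (ae_le_set.2 (volume_angleSet_diff_regSet hd))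
  rw [lintegral_rootSum_eq_regSet, setLIntegral_congr hae,
    ← lintegral_indicator isOpen_angleSet.measurableSet]
  have e1 : ∀ w : MatTuple n d, (angleSet n d).indicator (fun w => ENNReal.ofReal
      (angleWeight (w 0 0 0) w * gaussDens (solveMap w))) w = H w := by
    intro w
    by_cases hw : w ∈ angleSet n d
    · have hw' : (w 0 0 0, w) ∈ pairSet n d := hw
      rw [Set.indicator_of_mem hw, hH]
      simp only [angleTerm]
      rw [Set.indicator_of_mem hw', ← ENNReal.ofReal_mul (div_nonneg (gaussDens_pos w).le (hφ _).le)]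
      congr 1
      have h := gaussDens_resample w (rootCoord w (w 0 0 0))
      have h' : gaussDens (solveMap w) =
          gaussDens w * gaussianPDFReal 0 1 (rootCoord w (w 0 0 0)) /
            gaussianPDFReal 0 1 (w 0 0 0) := by
        rw [eq_div_iff (hφ _).ne', ← h]; rfl
      rw [h']
      ring
    · have hw' : (w 0 0 0, w) ∉ pairSet n d := hw
      rw [Set.indicator_of_notMem hw, hH]
      simp only [angleTerm]
      rw [Set.indicator_of_notMem hw', mul_zero]
  rw [lintegral_congr e1]
  have hone : ∫⁻ r : ℝ, ENNReal.ofReal (gaussianPDFReal 0 1 r) = 1 := by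
    rw [← ofReal_integral_eq_lintegral_ofReal (integrable_gaussianPDFReal 0 1)
      (Filter.Eventually.of_forall fun r => (hφ r).le),
      integral_gaussianPDFReal_eq_one 0 one_ne_zero, ENNReal.ofReal_one]
  have h := lintegral_lintegral_resample volume (coordForm n d) (unitTuple 0 0 0) coordForm_unit
    hφc.measurable.ennreal_ofReal hHm
  rw [hone, one_mul] at h
  rw [← h]
  have e2 : ∀ (A : MatTuple n d) (r : ℝ), ENNReal.ofReal (gaussianPDFReal 0 1 (coordForm n d A)) *
      H (A + (r - coordForm n d A) • unitTuple 0 0 0) =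
      ENNReal.ofReal (gaussDens A) * angleTerm (r, A) := by
    intro A r
    have e : (A + (r - A 0 0 0) • unitTuple 0 0 0 : MatTuple n d) 0 0 0 = r := by
      simp [unitTuple_apply]
    rw [coordForm_apply]
    simp only [hH]
    rw [e, angleTerm_add_unit, ← mul_assoc, ← ENNReal.ofReal_mul (hφ _).le]
    congr 2
    have h := gaussDens_resample A r
    have := (hφ r).ne'
    field_simp
    linarith
  simp only [e2]
  rw [lintegral_lintegral_swap]
  · refine lintegral_congr fun θ => ?_
    exact (lintegral_gaussTuple (measurable_angleTerm.comp measurable_prodMk_left)).symm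
  · exact ((continuous_gaussDens.measurable.ennreal_ofReal.comp measurable_fst).mul
      (measurable_angleTerm.comp measurable_swap)).aemeasurable

end Resample

section GaussianMap

theorem charFunDual_pi {ι : Type*} [Fintype ι] {E : ι → Type*} [∀ i, NormedAddCommGroup (E i)]
    [∀ i, NormedSpace ℝ (E i)] [∀ i, MeasurableSpace (E i)] [∀ i, BorelSpace (E i)]
    [∀ i, SecondCountableTopology (E i)] [∀ i, CompleteSpace (E i)]
    (μ : ∀ i, Measure (E i)) [∀ i, IsProbabilityMeasure (μ i)] (L : StrongDual ℝ (∀ i, E i)) :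
    charFunDual (Measure.pi μ) L = ∏ i, charFunDual (μ i) (L.comp (.single ℝ E i)) :=
  charFunDual_eq_pi_iff.2 rfl L

theorem charFunDual_gaussianReal_zero (v : NNReal) (L : StrongDual ℝ ℝ) :
    charFunDual (gaussianReal 0 v) L = Complex.exp ((-(v * L 1 ^ 2) / 2 : ℝ)) := by
  have h : charFunDual (gaussianReal 0 v) L = charFun (gaussianReal 0 v) (L 1) := by
    rw [charFunDual_apply, charFun_apply_real]
    refine integral_congr_ae (Filter.Eventually.of_forall fun x => ?_)
    have : L x = L 1 * x := by
      conv_lhs => rw [← mul_one x, ← smul_eq_mul, map_smul, smul_eq_mul, mul_comm]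
    simp only [this]
    push_cast
    rfl
  rw [h, charFun_gaussianReal]
  congr 1
  push_cast
  ring

variable {n d : ℕ}

instance isProbabilityMeasure_gaussTuple : IsProbabilityMeasure (gaussTuple n d) := by
  unfold gaussTuple; infer_instance

theorem charFunDual_gaussTuple (L : StrongDual ℝ (MatTuple n d)) :
    charFunDual (gaussTuple n d) L =
      ∏ i, ∏ p, ∏ q, Complex.exp ((-(L (unitTuple i p q) ^ 2) / 2 : ℝ)) := by
  rw [gaussTuple, charFunDual_pi]
  refine Finset.prod_congr rfl fun i _ => ?_
  rw [charFunDual_pi]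
  refine Finset.prod_congr rfl fun p _ => ?_
  rw [charFunDual_pi]
  refine Finset.prod_congr rfl fun q _ => ?_
  rw [charFunDual_gaussianReal_zero]
  simp only [unitTuple, ContinuousLinearMap.comp_apply, ContinuousLinearMap.single_apply,
    NNReal.coe_one, one_mul]
  congr!

/-- Linear combinations of the matrices of a tuple, with coefficients depending on the entry. -/
noncomputable def combine (b : Fin (d + 1) → Fin n × Fin n → ℝ) :
    MatTuple n d →L[ℝ] (Fin n × Fin n → ℝ) :=
  LinearMap.toContinuousLinearMap
    { toFun := fun A e => ∑ i, b i e * A i e.1 e.2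
      map_add' := fun A B => by
        ext e; simp [mul_add, Finset.sum_add_distrib]
      map_smul' := fun r A => by
        ext e; simp [Finset.mul_sum, mul_left_comm] }

theorem combine_apply (b : Fin (d + 1) → Fin n × Fin n → ℝ) (A : MatTuple n d) (e : Fin n × Fin n) :
    combine b A e = ∑ i, b i e * A i e.1 e.2 := rfl

theorem combine_unit (b : Fin (d + 1) → Fin n × Fin n → ℝ) (i : Fin (d + 1)) (p q : Fin n) :
    combine b (unitTuple i p q) = b i (p, q) • Pi.single (p, q) 1 := by
  ext e
  rw [combine_apply]
  simp only [unitTuple_apply, Pi.smul_apply, Pi.single_apply, Prod.ext_iff, smul_eq_mul]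
  by_cases h : e.1 = p ∧ e.2 = q
  · obtain ⟨rfl, rfl⟩ := h
    simp
  · simp [h]

theorem map_combine_gaussTuple {b : Fin (d + 1) → Fin n × Fin n → ℝ} {v : Fin n × Fin n → NNReal}
    (hv : ∀ e, (v e : ℝ) = ∑ i, b i e ^ 2) :
    (gaussTuple n d).map (combine b) = Measure.pi fun e => gaussianReal 0 (v e) := by
  have : IsProbabilityMeasure ((gaussTuple n d).map (combine b)) :=
    Measure.isProbabilityMeasure_map (combine b).continuous.aemeasurable
  refine Measure.ext_of_charFunDual (funext fun L => ?_)
  rw [charFunDual_map, charFunDual_gaussTuple, charFunDual_pi]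
  simp only [charFunDual_gaussianReal_zero, ContinuousLinearMap.comp_apply, combine_unit, map_smul,
    smul_eq_mul]
  rw [Finset.prod_comm, Fintype.prod_prod_type]
  refine Finset.prod_congr rfl fun p _ => ?_
  rw [Finset.prod_comm]
  refine Finset.prod_congr rfl fun q _ => ?_
  rw [← Complex.exp_sum, ← Complex.ofReal_sum, hv, Finset.sum_mul, ← Finset.sum_neg_distrib,
    Finset.sum_div]
  simp only [mul_pow, ContinuousLinearMap.single_apply]
  congr!

theorem lintegral_combine_gaussTuple {b : Fin (d + 1) → Fin n × Fin n → ℝ}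
    {v : Fin n × Fin n → NNReal} (hv : ∀ e, (v e : ℝ) = ∑ i, b i e ^ 2) (hv0 : ∀ e, v e ≠ 0)
    {F : EMat n → ℝ≥0∞} (hF : Measurable F) :
    ∫⁻ A, F (WithLp.toLp 2 (combine b A)) ∂gaussTuple n d =
      ∫⁻ V : EMat n, ENNReal.ofReal (∏ e, gaussianPDFReal 0 (v e) (V e)) * F V := by
  have hF' : Measurable fun x : Fin n × Fin n → ℝ => F (WithLp.toLp 2 x) :=
    hF.comp (MeasurableEquiv.toLp 2 (Fin n × Fin n → ℝ)).measurable
  have hc : Measurable fun x : Fin n × Fin n → ℝ =>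
      ENNReal.ofReal (∏ e, gaussianPDFReal 0 (v e) (x e)) := by
    refine Measurable.ennreal_ofReal (Continuous.measurable ?_)
    exact continuous_finsetProd _ fun e _ =>
      (continuous_gaussianPDFReal (v e)).comp (continuous_apply e)
  have h := (PiLp.volume_preserving_toLp (Fin n × Fin n)).lintegral_comp_emb
    (MeasurableEquiv.toLp 2 (Fin n × Fin n → ℝ)).measurableEmbedding
    (fun V : EMat n => ENNReal.ofReal (∏ e, gaussianPDFReal 0 (v e) (V e)) * F V)
  rw [← h, ← lintegral_map hF' (combine b).continuous.measurable, map_combine_gaussTuple hv,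
    pi_gaussianReal hv0, lintegral_withDensity_eq_lintegral_mul _ hc hF']
  rfl

end GaussianMap

section AngleMean

variable {n d : ℕ}

theorem adjNorm_smul (M : Matrix (Fin n) (Fin n) ℝ) (r : ℝ) :
    adjNorm (r • M) = |r ^ (n - 1)| * adjNorm M := by
  simp only [adjNorm, Matrix.adjugate_smul, Matrix.smul_apply, smul_eq_mul, mul_pow,
    Fintype.card_fin]
  rw [← Finset.mul_sum, Real.sqrt_mul (sq_nonneg _), Real.sqrt_sq_eq_abs]

theorem monoSum_eq_sum_sq (α β : ℝ) :
    monoSum d α β = ∑ i : Fin (d + 1), (α ^ (i : ℕ) * β ^ (d - (i : ℕ))) ^ 2 := by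
  rw [monoSum, Finset.sum_range]
  refine Finset.sum_congr rfl fun i _ => ?_
  ring

theorem sq_lt_monoSum (hd : 1 ≤ d) {α β : ℝ} (hα : α ≠ 0) : (β ^ d) ^ 2 < monoSum d α β := by
  rw [monoSum_eq_sum_sq, Fin.sum_univ_castSucc]
  obtain ⟨d, rfl⟩ : ∃ k, d = k + 1 := ⟨d - 1, by omega⟩
  rw [Fin.sum_univ_succ]
  have h1 : 0 ≤ ∑ i : Fin d, (α ^ ((i.succ.castSucc : Fin (d + 1 + 1)) : ℕ) *
    β ^ (d + 1 - ((i.succ.castSucc : Fin (d + 1 + 1)) : ℕ))) ^ 2 :=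
      Finset.sum_nonneg fun _ _ => sq_nonneg _
  have h2 : 0 < (α ^ (d + 1)) ^ 2 := by positivity
  simp at h1 ⊢
  linarith

/-- The coefficients expressing the normalised matrix along the circle, without the contribution of
the entry `A 0 0 0`. -/
noncomputable def circCoeff [NeZero n] (d : ℕ) (θ : ℝ) (i : Fin (d + 1)) (e : Fin n × Fin n) : ℝ :=
  if i = 0 ∧ e = (0, 0) then 0 else
    (√(monoSum d (cos θ) (sin θ)))⁻¹ * (cos θ ^ (i : ℕ) * sin θ ^ (d - (i : ℕ)))

variable [NeZero n]

theorem matOfE_combine_circCoeff (A : MatTuple n d) (θ : ℝ) :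
    matOfE n (WithLp.toLp 2 (combine (circCoeff d θ) A)) = (√(monoSum d (cos θ) (sin θ)))⁻¹ •
      (circMat A θ + (-(sin θ ^ d * A 0 0 0)) • Matrix.single 0 0 1) := by
  ext p q
  simp only [matOfE_apply, combine_apply, Matrix.smul_apply, Matrix.add_apply, smul_eq_mul,
    Matrix.single_apply, circMat_apply, mul_add, Finset.mul_sum]
  by_cases h : p = 0 ∧ q = 0
  · obtain ⟨rfl, rfl⟩ := h
    rw [Fin.sum_univ_succ, Fin.sum_univ_succ]
    simp [circCoeff, Fin.succ_ne_zero, mul_assoc]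
  · have h' : ¬(0 = p ∧ 0 = q) := fun h' => h ⟨h'.1.symm, h'.2.symm⟩
    simp only [h', if_false, mul_zero, add_zero]
    refine Finset.sum_congr rfl fun i _ => ?_
    simp [circCoeff, Prod.ext_iff, h, mul_assoc]

theorem sum_circCoeff_sq_of_ne {θ : ℝ} (hS : 0 < monoSum d (cos θ) (sin θ)) {e : Fin n × Fin n}
    (he : e ≠ (0, 0)) : ∑ i, circCoeff d θ i e ^ 2 = 1 := by
  simp only [circCoeff, he, and_false, if_false, mul_pow _ (cos θ ^ _ * _)]
  rw [← Finset.mul_sum, inv_pow, Real.sq_sqrt hS.le, ← monoSum_eq_sum_sq]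
  exact inv_mul_cancel₀ hS.ne'

theorem sum_circCoeff_sq_zero {θ : ℝ} (hS : 0 < monoSum d (cos θ) (sin θ)) :
    ∑ i, circCoeff (n := n) d θ i (0, 0) ^ 2 =
      1 - (sin θ ^ d / √(monoSum d (cos θ) (sin θ))) ^ 2 := by
  have h : (√(monoSum d (cos θ) (sin θ)))⁻¹ ^ 2 * monoSum d (cos θ) (sin θ) = 1 := by
    rw [inv_pow, Real.sq_sqrt hS.le]
    exact inv_mul_cancel₀ hS.ne'
  rw [monoSum_eq_sum_sq, ← monoSum_eq_sum_sq, Fin.sum_univ_succ] 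
  nth_rw 2 [monoSum_eq_sum_sq] at h
  rw [Fin.sum_univ_succ, mul_add, Finset.mul_sum] at h
  simp only [circCoeff, Fin.succ_ne_zero, false_and, if_false, mul_pow _ (cos θ ^ _ * _),
    and_self, if_true] at h ⊢
  simp only [Fin.val_zero, pow_zero, one_mul, Nat.sub_zero] at h
  rw [div_pow, div_eq_mul_inv, ← inv_pow, mul_comm ((sin θ ^ d) ^ 2)]
  linarith

theorem graphDensity_combine {A : MatTuple n d} {θ : ℝ} (hS : 0 < monoSum d (cos θ) (sin θ))
    (hs : 0 < sin θ) (hc : (circMat A θ).adjugate 0 0 ≠ 0) :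
    (WithLp.toLp 2 (combine (circCoeff d θ) A) : EMat n) ∈ cofSet n ∧
    angleWeight θ A = (sin θ ^ d / √(monoSum d (cos θ) (sin θ)))⁻¹ *
      graphDensity (fderiv ℝ (detSolE n)) (WithLp.toLp 2 (combine (circCoeff d θ) A)) ∧
    rootCoord A θ = (detSolE n (WithLp.toLp 2 (combine (circCoeff d θ) A)) -
      (WithLp.toLp 2 (combine (circCoeff d θ) A) : EMat n) (0, 0)) /
        (sin θ ^ d / √(monoSum d (cos θ) (sin θ))) := by
  set V : EMat n := WithLp.toLp 2 (combine (circCoeff d θ) A) with hV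
  set S := √(monoSum d (cos θ) (sin θ)) with hSdef
  have hS0 : 0 < S := Real.sqrt_pos.2 hS
  have ha : 0 < sin θ ^ d := pow_pos hs d
  set a := sin θ ^ d with hadef
  set M := circMat A θ with hMdef
  have hm : matOfE n V = S⁻¹ • (M + (-(a * A 0 0 0)) • Matrix.single 0 0 1) :=
    matOfE_combine_circCoeff A θ
  have hSi : S⁻¹ ≠ 0 := inv_ne_zero hS0.ne'
  have hadj : (matOfE n V).adjugate 0 0 = S⁻¹ ^ (n - 1) * M.adjugate 0 0 := by
    rw [hm, Matrix.adjugate_smul, Fintype.card_fin, Matrix.smul_apply, adjugate_add_smul_single,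
      smul_eq_mul]
  have hmem : V ∈ cofSet n := by
    change (matOfE n V).adjugate 0 0 ≠ 0
    rw [hadj]
    exact mul_ne_zero (pow_ne_zero _ hSi) hc
  have hsol : detSol (matOfE n V) = S⁻¹ * detSol M := by
    rw [hm, detSol_smul _ hSi, detSol_add_smul_single hc]
  have hV0 : V (0, 0) = S⁻¹ * (M 0 0 - a * A 0 0 0) := by
    rw [← matOfE_apply, hm]
    simp [sub_eq_add_neg]
  refine ⟨hmem, ?_, ?_⟩
  · have hN : circMat (solveAt A θ) θ = M + (detSol M - M 0 0) • Matrix.single 0 0 1 := by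
      rw [solveAt, circMat_add_unit, rootCoord, detSol, ← hMdef]
      congr 2
      simp only [Fin.val_zero, pow_zero, one_mul, Nat.sub_zero, ← hadef]
      field_simp
      ring
    have hN' : matOfE n V + (detSol (matOfE n V) - V (0, 0)) • Matrix.single 0 0 1 =
        S⁻¹ • (M + (detSol M - M 0 0) • Matrix.single 0 0 1) := by
      rw [hsol, hV0, hm]
      ext p q
      simp only [Matrix.add_apply, Matrix.smul_apply, smul_eq_mul]
      ring
    rw [graphDensity_detSolE hmem, hN', adjNorm_smul, hadj, angleWeight, hN, ← hMdef, ← hadef,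
      ← hSdef, abs_mul, abs_mul, abs_of_pos ha]
    have h1 : |S⁻¹ ^ (n - 1)| ≠ 0 := abs_ne_zero.2 (pow_ne_zero _ hSi)
    have h2 : |M.adjugate 0 0| ≠ 0 := abs_ne_zero.2 hc
    field_simp
  · rw [detSolE, hsol, hV0, rootCoord, detSol, ← hMdef, ← hadef]
    field_simp
    ring

/-- The integrand of the mean over tuples at a fixed angle, in terms of the normalised matrix. -/
noncomputable def fixedAngleTerm (n : ℕ) [NeZero n] (c : ℝ) : EMat n → ℝ≥0∞ :=
  (cofSet n).indicator fun V => ENNReal.ofReal (c⁻¹ * graphDensity (fderiv ℝ (detSolE n)) V *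
    gaussianPDFReal 0 1 ((detSolE n V - V (0, 0)) / c))

theorem measurable_fixedAngleTerm (c : ℝ) : Measurable (fixedAngleTerm n c) := by
  have h0 : Continuous fun V : EMat n => V (0, 0) := by fun_prop
  have h1 : ContinuousOn (detSolE n) (cofSet n) :=
    fun V hV => (contDiffAt_detSolE hV).continuousAt.continuousWithinAt
  exact measurable_indicator_of_continuousOn isOpen_cofSet
    ((continuousOn_const.mul isConeGraph_detSolE.continuousOn_graphDensity).mul
      ((continuous_gaussianPDFReal 1).comp_continuousOn
        ((h1.sub h0.continuousOn).div_const c)))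

theorem angleTerm_eq_fixedAngleTerm {θ : ℝ} (hθ : θ ∈ Set.Ioo 0 π)
    (hS : 0 < monoSum d (cos θ) (sin θ)) (A : MatTuple n d) :
    angleTerm (θ, A) = fixedAngleTerm n (sin θ ^ d / √(monoSum d (cos θ) (sin θ)))
      (WithLp.toLp 2 (combine (circCoeff d θ) A)) := by
  rw [angleTerm, fixedAngleTerm]
  by_cases hc : (circMat A θ).adjugate 0 0 ≠ 0
  · obtain ⟨h1, h2, h3⟩ := graphDensity_combine hS (sin_pos_of_mem_Ioo hθ) hc
    have h4 : (θ, A) ∈ pairSet n d := ⟨hθ, hc⟩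
    rw [Set.indicator_of_mem h1, Set.indicator_of_mem h4]
    simp only [h2, h3]
  · have h4 : (θ, A) ∉ pairSet n d := fun h => hc h.2
    have h1 : (WithLp.toLp 2 (combine (circCoeff d θ) A) : EMat n) ∉ cofSet n := by
      intro h
      change (matOfE n _).adjugate 0 0 ≠ 0 at h
      rw [matOfE_combine_circCoeff,
        adjugate_smul_ne_zero_iff _ (inv_ne_zero (Real.sqrt_pos.2 hS).ne'),
        adjugate_add_smul_single] at h
      exact hc h
    rw [Set.indicator_of_notMem h1, Set.indicator_of_notMem h4]

end AngleMean

section Fibre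

theorem lintegral_eq_of_forall_line {E : Type*} [NormedAddCommGroup E] [NormedSpace ℝ E]
    [MeasurableSpace E] [BorelSpace E] [FiniteDimensional ℝ E] (μ : Measure E) [μ.IsAddHaarMeasure]
    (ℓ : E →L[ℝ] ℝ) (e₀ : E) (h0 : ℓ e₀ = 1) {H₁ H₂ : E → ℝ≥0∞} (h₁ : Measurable H₁)
    (h₂ : Measurable H₂)
    (h : ∀ V, ∫⁻ r : ℝ, H₁ (V + (r - ℓ V) • e₀) =
      ∫⁻ r : ℝ, H₂ (V + (r - ℓ V) • e₀)) :
    ∫⁻ V, H₁ V ∂μ = ∫⁻ V, H₂ V ∂μ := by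
  have hf : Measurable ((Set.Icc (0 : ℝ) 1).indicator fun _ => (1 : ℝ≥0∞)) :=
    measurable_const.indicator measurableSet_Icc
  have e : ∀ {H : E → ℝ≥0∞}, Measurable H → ∫⁻ V, H V ∂μ =
      ∫⁻ V, (Set.Icc (0 : ℝ) 1).indicator (fun _ => (1 : ℝ≥0∞)) (ℓ V) *
        (∫⁻ r : ℝ, H (V + (r - ℓ V) • e₀)) ∂μ := by
    intro H hH
    have h1 := lintegral_lintegral_resample μ ℓ e₀ h0 hf hH
    have h2 : ∫⁻ r : ℝ, (Set.Icc (0 : ℝ) 1).indicator (fun _ => (1 : ℝ≥0∞)) r = 1 := by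
      rw [lintegral_indicator measurableSet_Icc]
      simp
    rw [h2, one_mul] at h1
    rw [← h1]
    refine lintegral_congr fun V => ?_
    have hm : Measurable fun r : ℝ => H (V + (r - ℓ V) • e₀) := hH.comp (by fun_prop)
    rw [lintegral_const_mul _ hm]
  rw [e h₁, e h₂]
  simp_rw [h]

theorem gaussianPDFReal_mul_gaussianPDFReal_div {c : ℝ} (hc0 : 0 < c) (hc1 : c < 1) {v : NNReal}
    (hv : (v : ℝ) = 1 - c ^ 2) {w : NNReal} (hw : (w : ℝ) = c ^ 2 * (1 - c ^ 2)) (t y : ℝ) :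
    gaussianPDFReal 0 v y * (c⁻¹ * gaussianPDFReal 0 1 ((t - y) / c)) =
      gaussianPDFReal 0 1 t * gaussianPDFReal ((1 - c ^ 2) * t) w y := by
  have h1 : 0 < 1 - c ^ 2 := by nlinarith
  simp only [gaussianPDFReal, hv, hw, NNReal.coe_one, mul_one, sub_zero]
  have e1 : √(2 * π * (c ^ 2 * (1 - c ^ 2))) = c * √(2 * π * (1 - c ^ 2)) := by
    rw [show 2 * π * (c ^ 2 * (1 - c ^ 2)) = c ^ 2 * (2 * π * (1 - c ^ 2)) by ring,
      Real.sqrt_mul (sq_nonneg c), Real.sqrt_sq hc0.le]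
  have e2 : rexp (-y ^ 2 / (2 * (1 - c ^ 2))) * rexp (-((t - y) / c) ^ 2 / 2) =
      rexp (-t ^ 2 / 2) * rexp (-(y - (1 - c ^ 2) * t) ^ 2 / (2 * (c ^ 2 * (1 - c ^ 2)))) := by
    rw [← Real.exp_add, ← Real.exp_add]
    congr 1
    field_simp
    ring
  rw [e1, mul_inv]
  linear_combination (√(2 * π * (1 - c ^ 2)))⁻¹ * c⁻¹ * (√(2 * π))⁻¹ * e2

theorem lintegral_gaussianPDFReal_mul_div {c : ℝ} (hc0 : 0 < c) (hc1 : c < 1) {v : NNReal}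
    (hv : (v : ℝ) = 1 - c ^ 2) (t : ℝ) :
    ∫⁻ y, ENNReal.ofReal (gaussianPDFReal 0 v y * (c⁻¹ * gaussianPDFReal 0 1 ((t - y) / c))) =
      ENNReal.ofReal (gaussianPDFReal 0 1 t) := by
  have h1 : 0 < c ^ 2 * (1 - c ^ 2) := mul_pos (by positivity) (by nlinarith)
  obtain ⟨w, hw⟩ : ∃ w : NNReal, (w : ℝ) = c ^ 2 * (1 - c ^ 2) := ⟨⟨_, h1.le⟩, rfl⟩
  have hw0 : w ≠ 0 := by
    rintro rfl
    rw [← hw] at h1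
    simp at h1
  simp_rw [gaussianPDFReal_mul_gaussianPDFReal_div hc0 hc1 hv hw,
    ENNReal.ofReal_mul (gaussianPDFReal_nonneg _ _ _)]
  rw [lintegral_const_mul' _ _ ENNReal.ofReal_ne_top, lintegral_gaussianPDFReal_eq_one _ hw0,
    mul_one]

variable {n d : ℕ} [NeZero n]

theorem graphDensity_detSolE_add_single {V : EMat n} (hV : V ∈ cofSet n) (r : ℝ) :
    graphDensity (fderiv ℝ (detSolE n)) (V + r • EuclideanSpace.single (0, 0) 1) =
      graphDensity (fderiv ℝ (detSolE n)) V := by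
  rw [graphDensity_detSolE hV, graphDensity_detSolE (isConeGraph_detSolE.add_mem V hV r),
    matOfE_add_single, adjugate_add_smul_single, detSol_add_smul_single hV, add_assoc, ← add_smul]
  congr 4
  simp
  ring

theorem lintegral_fixedAngleTerm {c : ℝ} (hc0 : 0 < c) (hc1 : c < 1)
    {v : Fin n × Fin n → NNReal} (hv0 : (v (0, 0) : ℝ) = 1 - c ^ 2)
    (hv : ∀ e, e ≠ (0, 0) → v e = 1) :
    ∫⁻ V : EMat n, ENNReal.ofReal (∏ e, gaussianPDFReal 0 (v e) (V e)) * fixedAngleTerm n c V =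
      singularIntegral n := by
  set g : EMat n → ℝ := graphDensity (fderiv ℝ (detSolE n)) with hg
  set o : EMat n := EuclideanSpace.single (0, 0) 1 with ho
  have hcone := isConeGraph_detSolE (n := n)
  have hsol : ContinuousOn (detSolE n) (cofSet n) :=
    fun V hV => (contDiffAt_detSolE hV).continuousAt.continuousWithinAt
  have hgc : ContinuousOn g (cofSet n) := hcone.continuousOn_graphDensity
  have hprod : ∀ v : Fin n × Fin n → NNReal,
      Continuous fun V : EMat n => ∏ e, gaussianPDFReal 0 (v e) (V e) := fun v =>
    continuous_finsetProd _ fun e _ => (continuous_gaussianPDFReal (v e)).comp (by fun_prop)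
  rw [singularIntegral, ← lintegral_indicator isOpen_cofSet.measurableSet]
  refine lintegral_eq_of_forall_line volume (EuclideanSpace.proj (0, 0)) o (by simp [ho])
    ((hprod v).measurable.ennreal_ofReal.mul (measurable_fixedAngleTerm c))
    (measurable_indicator_of_continuousOn isOpen_cofSet
      ((hgc.mul ((continuous_gaussianPDFReal 1).comp_continuousOn hsol)).mul
        (hprod fun _ => 1).continuousOn)) fun V => ?_
  by_cases hV : V ∈ cofSet n
  swap
  · have h1 : ∀ r, V + r • o ∉ cofSet n := fun r h => hV (hcone.add_mem_iff.1 h)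
    simp [fixedAngleTerm, Set.indicator_of_notMem (h1 _)]
  set K : ℝ := g V * ∏ e ∈ Finset.univ.erase (0, 0), gaussianPDFReal 0 1 (V e) with hK
  have hK0 : 0 ≤ K := mul_nonneg (graphDensity_pos _ _).le
    (Finset.prod_nonneg fun _ _ => gaussianPDFReal_nonneg _ _ _)
  have hmem : ∀ r : ℝ, V + r • o ∈ cofSet n := fun r => hcone.add_mem V hV r
  have h00 : ∀ r : ℝ, (V + (r - V (0, 0)) • o) (0, 0) = r := fun r => by simp [ho]
  have hne : ∀ (r : ℝ) e, e ≠ (0, 0) → (V + r • o) e = V e := fun r e he => by simp [ho, he]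
  have hP : ∀ (v : Fin n × Fin n → NNReal), (∀ e, e ≠ (0, 0) → v e = 1) → ∀ r : ℝ,
      ∏ e, gaussianPDFReal 0 (v e) ((V + (r - V (0, 0)) • o) e) =
        gaussianPDFReal 0 (v (0, 0)) r *
          ∏ e ∈ Finset.univ.erase (0, 0), gaussianPDFReal 0 1 (V e) := by
    intro v hv r
    rw [← Finset.mul_prod_erase Finset.univ _ (Finset.mem_univ (0, 0)), h00]
    congr 1
    refine Finset.prod_congr rfl fun e he => ?_
    have he := Finset.ne_of_mem_erase he
    rw [hv e he, hne _ e he]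
  have e1 : ∀ r : ℝ, ENNReal.ofReal (∏ e, gaussianPDFReal 0 (v e)
      ((V + (r - V (0, 0)) • o) e)) *
        fixedAngleTerm n c (V + (r - V (0, 0)) • o) =
      ENNReal.ofReal K * ENNReal.ofReal (gaussianPDFReal 0 (v (0, 0)) r *
        (c⁻¹ * gaussianPDFReal 0 1 ((detSolE n V - r) / c))) := by
    intro r
    rw [hP v hv, fixedAngleTerm, Set.indicator_of_mem (hmem _), h00,
      hcone.add_eq V hV, graphDensity_detSolE_add_single hV,
      ← ENNReal.ofReal_mul (mul_nonneg (gaussianPDFReal_nonneg _ _ _)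
        (Finset.prod_nonneg fun _ _ => gaussianPDFReal_nonneg _ _ _)), ← ENNReal.ofReal_mul hK0]
    congr 1
    rw [hK]
    ring
  have e2 : ∀ r : ℝ, (cofSet n).indicator (fun V => ENNReal.ofReal (g V *
      gaussianPDFReal 0 1 (detSolE n V) * ∏ e, gaussianPDFReal 0 1 (V e)))
        (V + (r - V (0, 0)) • o) =
      ENNReal.ofReal K * (ENNReal.ofReal (gaussianPDFReal 0 1 (detSolE n V)) *
        ENNReal.ofReal (gaussianPDFReal 0 1 r)) := by
    intro r
    rw [Set.indicator_of_mem (hmem _), hP (fun _ => 1) fun _ _ => rfl,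
      hcone.add_eq V hV, hg, graphDensity_detSolE_add_single hV,
      ← ENNReal.ofReal_mul (gaussianPDFReal_nonneg _ _ _), ← ENNReal.ofReal_mul hK0]
    congr 1
    rw [hK]
    ring
  refine (lintegral_congr e1).trans (Eq.trans ?_ (lintegral_congr e2).symm)
  rw [lintegral_const_mul' _ _ ENNReal.ofReal_ne_top, lintegral_const_mul' _ _ ENNReal.ofReal_ne_top,
    lintegral_const_mul' _ _ ENNReal.ofReal_ne_top, lintegral_gaussianPDFReal_mul_div hc0 hc1 hv0,
    lintegral_gaussianPDFReal_eq_one _ one_ne_zero, mul_one]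

theorem lintegral_angleTerm (hd : 1 ≤ d) {θ : ℝ} (hθ : θ ∈ Set.Ioo 0 π) (hcos : cos θ ≠ 0) :
    ∫⁻ A : MatTuple n d, angleTerm (θ, A) ∂gaussTuple n d = singularIntegral n := by
  have hlt := sq_lt_monoSum hd (β := sin θ) hcos
  have ha : 0 < sin θ ^ d := pow_pos (sin_pos_of_mem_Ioo hθ) d
  have hS : 0 < monoSum d (cos θ) (sin θ) := (by positivity : (0 : ℝ) ≤ _).trans_lt hlt
  have hc0 : 0 < sin θ ^ d / √(monoSum d (cos θ) (sin θ)) := div_pos ha (Real.sqrt_pos.2 hS)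
  have hc1 : sin θ ^ d / √(monoSum d (cos θ) (sin θ)) < 1 :=
    (div_lt_one (Real.sqrt_pos.2 hS)).2 (Real.lt_sqrt_of_sq_lt hlt)
  simp_rw [angleTerm_eq_fixedAngleTerm hθ hS]
  set c := sin θ ^ d / √(monoSum d (cos θ) (sin θ))
  have hc2 : 0 < 1 - c ^ 2 := by nlinarith
  set v : Fin n × Fin n → NNReal := fun e => if e = (0, 0) then ⟨1 - c ^ 2, hc2.le⟩ else 1 with hv
  have hv0 : (v (0, 0) : ℝ) = 1 - c ^ 2 := by
    simp only [hv]
    rfl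
  have hv1 : ∀ e, e ≠ (0, 0) → v e = 1 := fun e he => by simp [hv, he]
  rw [lintegral_combine_gaussTuple (v := v) _ _ (measurable_fixedAngleTerm c),
    lintegral_fixedAngleTerm hc0 hc1 hv0 hv1]
  · intro e
    by_cases he : e = (0, 0)
    · rw [he, hv0, sum_circCoeff_sq_zero hS]
    · rw [hv1 e he, sum_circCoeff_sq_of_ne hS he, NNReal.coe_one]
  · intro e
    by_cases he : e = (0, 0)
    · rw [he, ← NNReal.coe_ne_zero, hv0]
      exact hc2.ne'
    · rw [hv1 e he]
      exact one_ne_zero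

theorem lintegral_rootSum (hd : 1 ≤ d) :
    ∫⁻ A : MatTuple n d, rootSum A ∂gaussTuple n d = ENNReal.ofReal π * singularIntegral n := by
  rw [lintegral_rootSum_eq_angleTerm hd]
  have h : (fun θ : ℝ => ∫⁻ A : MatTuple n d, angleTerm (θ, A) ∂gaussTuple n d) =ᵐ[volume]
      (Set.Ioo 0 π).indicator fun _ => singularIntegral n := by
    filter_upwards [compl_mem_ae_iff.2 (measure_singleton (π / 2) : volume {π / 2} = 0)] with θ hθ2
    by_cases hθ : θ ∈ Set.Ioo 0 π
    · rw [Set.indicator_of_mem hθ]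
      refine lintegral_angleTerm hd hθ fun hc => hθ2 ?_
      have := injOn_cos (Set.Ioo_subset_Icc_self hθ)
        (⟨by positivity, by linarith [pi_pos]⟩ : π / 2 ∈ Set.Icc 0 π) (by rw [hc, cos_pi_div_two])
      exact this
    · rw [Set.indicator_of_notMem hθ]
      have : ∀ A : MatTuple n d, angleTerm (θ, A) = 0 := fun A =>
        Set.indicator_of_notMem (fun h => hθ h.1) _
      simp [this]
  rw [lintegral_congr_ae h, lintegral_indicator measurableSet_Ioo, setLIntegral_const,
    Real.volume_Ioo, sub_zero, mul_comm]

end Fibre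

section Generic

variable {n d : ℕ}

theorem ae_det_circMat_zero_ne_zero : ∀ᵐ A : MatTuple n d, (circMat A 0).det ≠ 0 := by
  have hA : ∀ (A : MatTuple n d) (r : ℝ), circMat (A + r • fun i p q => if p = q then 1 else 0) 0 =
      Matrix.scalar (Fin n) r - -circMat A 0 := by
    intro A r
    ext p q
    simp only [circMat_apply, Matrix.sub_apply, Matrix.neg_apply, Pi.add_apply, Pi.smul_apply,
      smul_eq_mul, cos_zero, sin_zero, one_pow, one_mul, Matrix.scalar_apply, Matrix.diagonal_apply,
      mul_add, Finset.sum_add_distrib]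
    rw [Finset.sum_eq_single (f := fun i : Fin (d + 1) =>
      0 ^ (d - (i : ℕ)) * (r * if p = q then (1 : ℝ) else 0)) (Fin.last d)]
    · by_cases h : p = q <;> simp [h]; ring
    · intro i _ hi
      have : d - (i : ℕ) ≠ 0 := by
        have := Fin.val_lt_last hi
        omega
      simp [this]
    · simp
  refine measure_mono_null (t := {A : MatTuple n d | (circMat A 0).det = 0})
    (fun A hA => not_not.1 hA) ?_
  have hc : Continuous fun A : MatTuple n d => (circMat A 0).det :=
    (contDiff_det (m := 0) fun p q => contDiff_circMat contDiff_id contDiff_const p q).continuous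
  refine measure_eq_zero_of_forall_line volume (isClosed_singleton.preimage hc).measurableSet
    (fun i p q => if p = q then 1 else 0) fun A => ?_
  refine (Set.Finite.subset (Polynomial.finite_setOfPred_isRoot
    (Matrix.charpoly_monic (-circMat A 0)).ne_zero) fun r hr => ?_).measure_zero _
  have hr' : (circMat (A + r • fun i p q => if p = q then 1 else 0) 0).det = 0 := hr
  rw [hA, ← Matrix.eval_charpoly] at hr'
  exact hr'

variable [NeZero n]

/-- Fill the column `j` of the first matrix of a tuple so that the matrix at the angle stored in
`w 0 0 j` satisfies the column relation with coefficients stored in that column. -/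
noncomputable def fillColumn (j : Fin n) (w : MatTuple n d) : MatTuple n d :=
  w + fun i p q => if i = 0 ∧ q = j then
    ((∑ k, (if k = 0 then 0 else w 0 k j) * circMat w (w 0 0 j) p k) - circMat w (w 0 0 j) p j) /
      sin (w 0 0 j) ^ d else 0

theorem differentiableOn_fillColumn (j : Fin n) :
    DifferentiableOn ℝ (fillColumn (d := d) j) {w | w 0 j j = 0 ∧ sin (w 0 0 j) ≠ 0} := by
  have h0 : ∀ i p q, Differentiable ℝ fun w : MatTuple n d => w i p q := fun i p q => by fun_prop
  have h1 : ContDiff ℝ 1 fun w : MatTuple n d => w 0 0 j := by fun_prop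
  have hM : ∀ p q, Differentiable ℝ fun w : MatTuple n d => circMat w (w 0 0 j) p q := fun p q =>
    (contDiff_circMat contDiff_id h1 p q).differentiable one_ne_zero
  have hS : Differentiable ℝ fun w : MatTuple n d => sin (w 0 0 j) ^ d :=
    (contDiff_sin.comp h1 |>.pow d).differentiable one_ne_zero
  have hN : ∀ p, Differentiable ℝ fun w : MatTuple n d =>
      (∑ k, (if k = 0 then 0 else w 0 k j) * circMat w (w 0 0 j) p k) -
        circMat w (w 0 0 j) p j := by
    intro p
    refine (Differentiable.fun_sum fun k _ => ?_).sub (hM p j)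
    by_cases hk : k = 0
    · simp [hk]
    · simp only [hk, if_false]
      exact (h0 0 k j).mul (hM p k)
  have hne : ∀ w ∈ {w : MatTuple n d | w 0 j j = 0 ∧ sin (w 0 0 j) ≠ 0}, sin (w 0 0 j) ^ d ≠ 0 :=
    fun w hw => pow_ne_zero d hw.2
  refine differentiable_id.differentiableOn.add ?_
  refine differentiableOn_pi.2 fun i => differentiableOn_pi.2 fun p =>
    differentiableOn_pi.2 fun q => ?_
  by_cases h : i = 0 ∧ q = j
  · simp only [h, and_self, if_true]
    simp only [div_eq_mul_inv]
    exact (hN p).differentiableOn.mul (hS.differentiableOn.inv hne)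
  · simp only [h, if_false]
    exact differentiableOn_const 0

theorem mem_image_fillColumn {A : MatTuple n d} {θ : ℝ} (hθ : sin θ ≠ 0) {j : Fin n}
    (h : ColumnRelation (circMat A θ) j) :
    A ∈ fillColumn j '' {w | w 0 j j = 0 ∧ sin (w 0 0 j) ≠ 0} := by
  obtain ⟨hj, c, hc0, hcj, hc⟩ := h
  set w : MatTuple n d := fun i p q =>
    if i = 0 ∧ q = j then (if p = 0 then θ else c p) else A i p q with hw
  have hw0 : w 0 0 j = θ := by simp [hw]
  have hwp : ∀ p, p ≠ 0 → w 0 p j = c p := fun p hp => by simp [hw, hp]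
  have hwA : ∀ i p q, ¬(i = 0 ∧ q = j) → w i p q = A i p q := fun i p q h => by
    simp only [hw, h, if_false]
  refine ⟨w, ⟨by rw [hwp j hj, hcj], by rwa [hw0]⟩, ?_⟩
  have hs := pow_ne_zero d hθ
  funext i p q
  simp only [fillColumn, Pi.add_apply]
  by_cases h : i = 0 ∧ q = j
  · obtain ⟨rfl, rfl⟩ := h
    have e1 : ∀ k, (if k = 0 then 0 else w 0 k q) * circMat w (w 0 0 q) p k =
        c k * circMat A θ p k := by
      intro k
      by_cases hk0 : k = 0
      · simp [hk0, hc0]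
      by_cases hkq : k = q
      · simp [hkq, hj, hwp q hj, hcj]
      · rw [if_neg hk0, hwp k hk0, hw0, circMat_apply, circMat_apply]
        simp only [hwA _ p k fun h => hkq h.2]
    have e2 : circMat w (w 0 0 q) p q = circMat A θ p q + sin θ ^ d * (w 0 p q - A 0 p q) := by
      rw [hw0, circMat_apply, circMat_apply, Fin.sum_univ_succ, Fin.sum_univ_succ]
      have : ∀ i : Fin d, w i.succ p q = A i.succ p q := fun i =>
        hwA _ p q fun h => Fin.succ_ne_zero i h.1
      simp only [this]
      simp
      ring
    simp only [and_self, if_true, e1]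
    rw [← hc p, e2, hw0]
    field_simp
    ring
  · simp only [h, if_false, add_zero]
    exact hwA i p q h

theorem volume_image_fillColumn (j : Fin n) : (volume : Measure (MatTuple n d))
    (fillColumn j '' {w | w 0 j j = 0 ∧ sin (w 0 0 j) ≠ 0}) = 0 := by
  refine addHaar_image_eq_zero_of_differentiableOn_of_addHaar_eq_zero volume
    (differentiableOn_fillColumn j) (measure_mono_null (t := {w : MatTuple n d | w 0 j j = 0})
      (fun w hw => hw.1) ?_)
  have hc : Continuous fun w : MatTuple n d => w 0 j j := by fun_prop
  refine measure_eq_zero_of_forall_line volume (isClosed_singleton.preimage hc).measurableSet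
    (unitTuple 0 j j) fun w => ?_
  refine (Set.Finite.subset (Set.finite_singleton (-w 0 j j)) fun r hr => ?_).measure_zero _
  have hr' : w 0 j j + r * unitTuple (d := d) 0 j j 0 j j = 0 := hr
  rw [unitTuple_apply] at hr'
  simp at hr'
  exact eq_neg_of_add_eq_zero_right hr'

theorem ae_adjugate_circMat_ne_zero : ∀ᵐ A : MatTuple n d, ∀ θ ∈ Set.Ioo 0 π,
    (circMat A θ).det = 0 → (circMat A θ).adjugate 0 0 ≠ 0 := by
  set τ : MatTuple n d → MatTuple n d := fun A i p q => A i q p with hτ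
  set B : Fin n → Set (MatTuple n d) := fun j =>
    fillColumn j '' {w | w 0 j j = 0 ∧ sin (w 0 0 j) ≠ 0} with hB
  have hτd : Differentiable ℝ τ :=
    differentiable_pi.2 fun i => differentiable_pi.2 fun p => differentiable_pi.2 fun q => by
      simp only [hτ]; fun_prop
  refine measure_mono_null (t := (⋃ j, B j) ∪ ⋃ j, τ '' B j) ?_
    (measure_union_null (measure_iUnion_null fun j => volume_image_fillColumn j)
      (measure_iUnion_null fun j => addHaar_image_eq_zero_of_differentiableOn_of_addHaar_eq_zero
        volume hτd.differentiableOn (volume_image_fillColumn j)))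
  intro A hA
  simp only [Set.mem_compl_iff, Set.mem_ofPred_eq, not_forall, not_not] at hA
  obtain ⟨θ, hθ, h1, h2⟩ := hA
  have hs := (sin_pos_of_mem_Ioo hθ).ne'
  rcases exists_columnRelation h1 h2 with ⟨j, hj⟩ | ⟨j, hj⟩
  · exact Or.inl (Set.mem_iUnion.2 ⟨j, mem_image_fillColumn hs hj⟩)
  · have e : (circMat A θ)ᵀ = circMat (τ A) θ := by
      ext p q
      simp only [Matrix.transpose_apply, circMat_apply, hτ]
    rw [e] at hj
    exact Or.inr (Set.mem_iUnion.2 ⟨j, τ A, mem_image_fillColumn hs hj, rfl⟩)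

end Generic

section Roots

variable {n d : ℕ}

/-- The angles of the polynomial eigenvalues. -/
def eigAngles (A : MatTuple n d) : Set ℝ := {θ | θ ∈ Set.Ioo 0 π ∧ (circMat A θ).det = 0}

theorem circMat_pi_eq (A : MatTuple n d) : circMat A π = (-1 : ℝ) ^ d • circMat A 0 := by
  ext p q
  simp only [circMat_apply, Matrix.smul_apply, smul_eq_mul, Finset.mul_sum, cos_pi, sin_pi,
    cos_zero, sin_zero, one_pow, one_mul]
  refine Finset.sum_congr rfl fun i _ => ?_
  by_cases hi : (i : ℕ) = d
  · simp [hi]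
  · have : d - (i : ℕ) ≠ 0 := by have := i.2; omega
    simp [this]

theorem finite_eigAngles {A : MatTuple n d} (h0 : (circMat A 0).det ≠ 0)
    (h : ∀ θ ∈ eigAngles A, eigDeriv A θ ≠ 0) : (eigAngles A).Finite := by
  by_contra hinf
  obtain ⟨x, hx, hacc⟩ := Set.Infinite.exists_accPt_of_subset_isCompact hinf
    (isCompact_Icc (a := 0) (b := π)) fun θ hθ => Set.Ioo_subset_Icc_self hθ.1
  rw [accPt_iff_frequently_nhdsNE] at hacc
  have hc : Continuous fun θ => (circMat A θ).det :=
    continuous_iff_continuousAt.2 fun θ => (hasDerivAt_det_circMat A θ).continuousAt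
  have hx0 : (circMat A x).det = 0 := by
    by_contra hne
    have h1 : ∀ᶠ θ in nhdsWithin x {x}ᶜ, (circMat A θ).det ≠ 0 :=
      (hc.continuousAt.eventually_ne hne).filter_mono nhdsWithin_le_nhds
    obtain ⟨θ, h2, h3⟩ := (hacc.and_eventually h1).exists
    exact h3 h2.2
  have hxpi : x ≠ π := by
    rintro rfl
    rw [circMat_pi_eq, Matrix.det_smul] at hx0
    rcases mul_eq_zero.1 hx0 with h1 | h1
    · exact pow_ne_zero _ (pow_ne_zero _ (by norm_num)) h1
    · exact h0 h1
  have hx1 : x ∈ eigAngles A :=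
    ⟨⟨hx.1.lt_of_ne fun h1 => h0 (h1 ▸ hx0), hx.2.lt_of_ne hxpi⟩, hx0⟩
  have h1 := (hasDerivAt_det_circMat A x).eventually_ne (c := 0) (neg_ne_zero.2 (h x hx1))
  obtain ⟨θ, h2, h3⟩ := (hacc.and_eventually h1).exists
  exact h3 h2.2

/-- The eigenvalue with a given angle. -/
theorem bijOn_eigAngles {A : MatTuple n d} (h0 : (circMat A 0).det ≠ 0) :
    Set.BijOn (fun θ => (cos θ, sin θ)) (eigAngles A) (pevReps n d A) := by
  refine ⟨fun θ hθ => ⟨⟨cos_sq_add_sin_sq θ, Or.inl (sin_pos_of_mem_Ioo hθ.1)⟩, hθ.2⟩,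
    fun θ hθ θ' hθ' h => injOn_cos (Set.Ioo_subset_Icc_self hθ.1) (Set.Ioo_subset_Icc_self hθ'.1)
      (congrArg Prod.fst h), ?_⟩
  rintro ⟨α, β⟩ ⟨⟨h1, h2⟩, h3⟩
  simp only at h1 h2 h3
  rcases h2 with h2 | ⟨rfl, rfl⟩
  · have hα : α ^ 2 < 1 := by nlinarith
    have hα' := (sq_lt_one_iff_abs_lt_one α).1 hα
    rw [abs_lt] at hα'
    have e1 : cos (arccos α) = α := cos_arccos hα'.1.le hα'.2.le
    have e2 : sin (arccos α) = β := by
      rw [sin_arccos, ← Real.sqrt_sq h2.le]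
      congr 1
      linarith
    refine ⟨arccos α, ⟨⟨arccos_pos.2 hα'.2, ?_⟩, ?_⟩, by simp only [e1, e2]⟩
    · exact (arccos_le_pi α).lt_of_ne fun h => hα'.1.ne' (arccos_eq_pi.1 h |>.antisymm hα'.1.le)
    · rw [circMat, e1, e2]
      exact h3
  · refine absurd ?_ h0
    rw [circMat, cos_zero, sin_zero]
    exact h3

variable [NeZero n]

theorem bijOn_fiber {A : MatTuple n d}
    (h1 : ∀ θ ∈ Set.Ioo 0 π, (circMat A θ).det = 0 → (circMat A θ).adjugate 0 0 ≠ 0)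
    (h2 : ∀ θ, (θ, A) ∈ pairSet n d → (circMat A θ).det = 0 → eigDeriv A θ ≠ 0) :
    Set.BijOn (fun w => w 0 0 0) {w | w ∈ regSet n d ∧ solveMap w = A} (eigAngles A) := by
  have hiff : ∀ w, w ∈ regSet n d ∧ solveMap w = A ↔
      (w = A + (w 0 0 0 - A 0 0 0) • unitTuple 0 0 0 ∧ w 0 0 0 ∈ eigAngles A) := by
    intro w
    constructor
    · rintro ⟨hw, hA⟩
      obtain ⟨e1, e2, e3⟩ := mem_fiber_iff.1 ⟨hw.1, hA⟩
      exact ⟨e1, e2.1, e3⟩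
    · rintro ⟨e1, e2, e3⟩
      have hp : (w 0 0 0, A) ∈ pairSet n d := ⟨e2, h1 _ e2 e3⟩
      obtain ⟨e4, e5⟩ := mem_fiber_iff.2 ⟨e1, hp, e3⟩
      exact ⟨⟨e4, by rw [e5]; exact h2 _ hp e3⟩, e5⟩
  refine ⟨fun w hw => ((hiff w).1 hw).2, fun w hw w' hw' h => ?_, fun θ hθ => ?_⟩
  · rw [((hiff w).1 hw).1, ((hiff w').1 hw').1]
    simp only at h
    rw [h]
  · set w : MatTuple n d := A + (θ - A 0 0 0) • unitTuple 0 0 0 with hw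
    have e : w 0 0 0 = θ := by simp [hw, unitTuple_apply]
    exact ⟨w, (hiff w).2 ⟨by rw [e], by rwa [e]⟩, e⟩

theorem tsum_subtype_eq_of_bijOn {X Y : Type*} {s : Set X} {t : Set Y} {φ : X → Y}
    (hφ : Set.BijOn φ s t) {f : X → ℝ≥0∞} {g : Y → ℝ≥0∞} (h : ∀ x ∈ s, f x = g (φ x)) :
    ∑' x : s, f x = ∑' y : t, g y := by
  rw [← (hφ.equiv φ).tsum_eq]
  exact tsum_congr fun x => h x x.2

theorem muTotal_ae_eq : ∀ᵐ A : MatTuple n d,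
    muTotal n d A = ENNReal.ofReal (tnorm n d A) * rootSum A := by
  filter_upwards [ae_det_circMat_zero_ne_zero, ae_adjugate_circMat_ne_zero, ae_eigDeriv_ne_zero]
    with A h0 h1 h2
  have hb := bijOn_eigAngles h0
  have hd : ∀ θ ∈ eigAngles A, eigDeriv A θ ≠ 0 := fun θ hθ =>
    h2 θ ⟨hθ.1, h1 θ hθ.1 hθ.2⟩ hθ.2
  have hfin : (pevReps n d A).Finite := by
    rw [← hb.image_eq]
    exact (finite_eigAngles h0 hd).image _
  rw [muTotal, if_neg (Set.not_infinite.2 hfin), rootSum, ← tsum_subtype, ← ENNReal.tsum_mul_left,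
    ← tsum_subtype_eq_of_bijOn hb (f := fun θ => muLoc n d A (cos θ) (sin θ))
      (g := fun x => muLoc n d A x.1 x.2) fun _ _ => rfl]
  refine (tsum_subtype_eq_of_bijOn (bijOn_fiber h1 h2) (f := fun w => ENNReal.ofReal (tnorm n d A) *
    (regSet n d).indicator (fun w => ENNReal.ofReal
      (relCond n d (solveMap w) (cos (w 0 0 0)) (sin (w 0 0 0)))) w)
    (g := fun θ => muLoc n d A (cos θ) (sin θ)) fun w hw => ?_).symm
  have hθ := (bijOn_fiber h1 h2).mapsTo hw
  rw [Set.indicator_of_mem hw.1, hw.2, muLoc_eq_relCond hθ.2 (h1 _ hθ.1 hθ.2) (hd _ hθ),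
    mul_comm, ENNReal.ofReal_mul (relCond_nonneg _ _)]

end Roots

section Homogeneous

variable {n d : ℕ}

theorem Pmat_smul (c : ℝ) (A : MatTuple n d) (α β : ℝ) :
    Pmat n d (c • A) α β = c • Pmat n d A α β := by
  ext p q
  simp only [Pmat_apply, Matrix.smul_apply, Pi.smul_apply, smul_eq_mul, Finset.mul_sum]
  exact Finset.sum_congr rfl fun i _ => by ring

theorem vvec_smul (c : ℝ) (A : MatTuple n d) (α β : ℝ) (r : Fin n → ℝ) :
    vvec n d (c • A) α β r = c • vvec n d A α β r := by
  have h1 : Pα n d (c • A) α β = c • Pα n d A α β := by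
    ext p q
    simp only [Pα, Matrix.sum_apply, Matrix.smul_apply, Matrix.of_apply, Pi.smul_apply, smul_eq_mul,
      Finset.mul_sum]
    exact Finset.sum_congr rfl fun i _ => by ring
  have h2 : Pβ n d (c • A) α β = c • Pβ n d A α β := by
    ext p q
    simp only [Pβ, Matrix.sum_apply, Matrix.smul_apply, Matrix.of_apply, Pi.smul_apply, smul_eq_mul,
      Finset.mul_sum]
    exact Finset.sum_congr rfl fun i _ => by ring
  rw [vvec, vvec, h1, h2, Matrix.smul_mulVec, Matrix.smul_mulVec, smul_sub, smul_comm β c,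
    smul_comm α c]

theorem sum_mul_vvec_smul (c : ℝ) (A : MatTuple n d) (α β : ℝ) (r ℓ : Fin n → ℝ) :
    ∑ j, ℓ j * vvec n d (c • A) α β r j = c * ∑ j, ℓ j * vvec n d A α β r j := by
  simp only [vvec_smul, Pi.smul_apply, smul_eq_mul, Finset.mul_sum]
  exact Finset.sum_congr rfl fun i _ => by ring

theorem tnorm_smul {c : ℝ} (hc : 0 < c) (A : MatTuple n d) :
    tnorm n d (c • A) = c * tnorm n d A := by
  simp only [tnorm, Pi.smul_apply, smul_eq_mul, mul_pow, ← Finset.mul_sum]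
  rw [Real.sqrt_mul (sq_nonneg c), Real.sqrt_sq hc.le]

theorem goodPair_smul {c : ℝ} (hc : c ≠ 0) (A : MatTuple n d) (α β : ℝ) :
    GoodPair n d (c • A) α β = GoodPair n d A α β := by
  funext r ℓ
  simp only [GoodPair, Pmat_smul, sum_mul_vvec_smul, Matrix.transpose_smul, map_smul,
    LinearMap.ker_smul _ c hc, mul_ne_zero_iff, hc, ne_eq, not_false_eq_true, true_and]

theorem muVal_smul {c : ℝ} (hc : 0 < c) (A : MatTuple n d) (α β : ℝ) (r ℓ : Fin n → ℝ) :
    muVal n d (c • A) α β r ℓ = muVal n d A α β r ℓ := by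
  rw [muVal, muVal, sum_mul_vvec_smul, tnorm_smul hc, abs_mul, abs_of_pos hc]
  field_simp

theorem muLoc_smul {c : ℝ} (hc : 0 < c) (A : MatTuple n d) (α β : ℝ) :
    muLoc n d (c • A) α β = muLoc n d A α β := by
  simp only [muLoc, goodPair_smul hc.ne', muVal_smul hc]

theorem muTotal_smul [NeZero n] {c : ℝ} (hc : 0 < c) (A : MatTuple n d) :
    muTotal n d (c • A) = muTotal n d A := by
  have h : pevReps n d (c • A) = pevReps n d A := by
    ext x
    simp [pevReps, IsPEV, Pmat_smul, hc.ne']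
  rw [muTotal, muTotal, h]
  simp only [muLoc_smul hc]

end Homogeneous

section Integrals

theorem lintegral_exp_neg_mul_sq {b : ℝ} (hb : 0 < b) :
    ∫⁻ x : ℝ, ENNReal.ofReal (rexp (-b * x ^ 2)) = ENNReal.ofReal √(π / b) := by
  rw [← integral_gaussian, ofReal_integral_eq_lintegral_ofReal (integrable_exp_neg_mul_sq hb)
    (Filter.Eventually.of_forall fun _ => (Real.exp_pos _).le)]

theorem lintegral_rpow_mul_exp_neg_mul {a r : ℝ} (ha : 0 < a) (hr : 0 < r) :
    ∫⁻ u in Set.Ioi (0 : ℝ), ENNReal.ofReal (u ^ (a - 1) * rexp (-(r * u))) =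
      ENNReal.ofReal ((1 / r) ^ a * Gamma a) := by
  rw [← integral_rpow_mul_exp_neg_mul_Ioi ha hr, ofReal_integral_eq_lintegral_ofReal]
  · have := integrableOn_rpow_mul_exp_neg_mul_rpow (s := a - 1) (p := 1) (b := r) (by linarith)
      one_pos hr
    simpa [IntegrableOn] using this
  · filter_upwards [ae_restrict_mem measurableSet_Ioi] with u hu
    exact mul_nonneg (rpow_nonneg (le_of_lt hu) _) (Real.exp_pos _).le

theorem lintegral_one_add_sq_rpow {s : ℝ} (hs : 1 / 2 < s) :
    ∫⁻ x : ℝ, ENNReal.ofReal ((1 / (1 + x ^ 2)) ^ s) =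
      ENNReal.ofReal (√π * (Gamma (s - 1 / 2) / Gamma s)) := by
  have hs0 : 0 < s := by linarith
  have hΓ := Gamma_pos_of_pos hs0
  have e1 : ∀ x : ℝ, ENNReal.ofReal ((1 / (1 + x ^ 2)) ^ s) = ENNReal.ofReal (Gamma s)⁻¹ *
      ∫⁻ u in Set.Ioi (0 : ℝ), ENNReal.ofReal (u ^ (s - 1) * rexp (-((1 + x ^ 2) * u))) := by
    intro x
    rw [lintegral_rpow_mul_exp_neg_mul hs0 (by positivity), ← ENNReal.ofReal_mul (by positivity)]
    congr 1
    field_simp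
  simp_rw [e1]
  rw [lintegral_const_mul' _ _ ENNReal.ofReal_ne_top, lintegral_lintegral_swap]
  · have e2 : ∀ u ∈ Set.Ioi (0 : ℝ),
        ∫⁻ x : ℝ, ENNReal.ofReal (u ^ (s - 1) * rexp (-((1 + x ^ 2) * u))) =
          ENNReal.ofReal √π * ENNReal.ofReal (u ^ (s - 1 / 2 - 1) * rexp (-(1 * u))) := by
      intro u hu
      have hu' : 0 < u := hu
      have e3 : ∀ x : ℝ, ENNReal.ofReal (u ^ (s - 1) * rexp (-((1 + x ^ 2) * u))) =
          ENNReal.ofReal (u ^ (s - 1) * rexp (-(1 * u))) * ENNReal.ofReal (rexp (-u * x ^ 2)) := by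
        intro x
        rw [← ENNReal.ofReal_mul (by positivity), mul_assoc, ← Real.exp_add]
        congr 3
        ring
      simp_rw [e3]
      rw [lintegral_const_mul' _ _ ENNReal.ofReal_ne_top, lintegral_exp_neg_mul_sq hu',
        ← ENNReal.ofReal_mul (by positivity), ← ENNReal.ofReal_mul (by positivity)]
      congr 1
      rw [show s - 1 / 2 - 1 = s - 1 - 1 / 2 by ring, rpow_sub hu' (s - 1), ← Real.sqrt_eq_rpow,
        Real.sqrt_div pi_pos.le]
      ring
    rw [setLIntegral_congr_fun measurableSet_Ioi e2,
      lintegral_const_mul' _ _ ENNReal.ofReal_ne_top,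
      lintegral_rpow_mul_exp_neg_mul (by linarith) one_pos, ← ENNReal.ofReal_mul (by positivity),
      ← ENNReal.ofReal_mul (by positivity)]
    congr 1
    simp
    ring
  · refine Measurable.aemeasurable ?_
    simp only [Function.uncurry_def]
    fun_prop

end Integrals

section Expectation

variable {n d : ℕ}

theorem measurable_tnorm : Measurable (tnorm n d) := by
  unfold tnorm
  fun_prop

theorem tnorm_pos {A : MatTuple n d} (hA : A ≠ 0) : 0 < tnorm n d A := by
  refine Real.sqrt_pos.2 (lt_of_le_of_ne (by positivity) fun h => hA ?_)
  funext i p q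
  have h1 := (Finset.sum_eq_zero_iff_of_nonneg fun i _ => by positivity).1 h.symm i (Finset.mem_univ i)
  have h2 := (Finset.sum_eq_zero_iff_of_nonneg fun p _ => by positivity).1 h1 p (Finset.mem_univ p)
  have h3 := (Finset.sum_eq_zero_iff_of_nonneg fun q _ => by positivity).1 h2 q (Finset.mem_univ q)
  exact pow_eq_zero_iff two_ne_zero |>.1 h3

theorem gaussDens_mul_exp (A : MatTuple n d) (x : ℝ) :
    gaussDens A * rexp (-(tnorm n d A ^ 2 / 2) * x ^ 2) = gaussDens (√(1 + x ^ 2) • A) := by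
  rw [gaussDens_eq_exp, gaussDens_eq_exp, mul_assoc, ← Real.exp_add, tnorm,
    Real.sq_sqrt (by positivity)]
  simp only [Pi.smul_apply, smul_eq_mul, mul_pow, Real.sq_sqrt (show 0 ≤ 1 + x ^ 2 by positivity),
    ← Finset.mul_sum]
  congr 2
  ring

theorem finrank_matTuple : Module.finrank ℝ (MatTuple n d) = (d + 1) * (n * n) := by
  simp [MatTuple, Module.finrank_pi_fintype]

theorem ae_ne_zero_matTuple [NeZero n] : ∀ᵐ A : MatTuple n d, A ≠ 0 := by
  rw [ae_iff]
  simpa using Measure.addHaar_submodule (volume : Measure (MatTuple n d)) ⊥ bot_ne_top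

theorem lintegral_muTotal_mul_gaussDens_smul [NeZero n] {r : ℝ} (hr : 0 < r) :
    ∫⁻ A : MatTuple n d, ENNReal.ofReal (gaussDens (r • A)) *
        (ENNReal.ofReal (tnorm n d A) * rootSum A) =
      ENNReal.ofReal ((1 / r) ^ ((d + 1) * (n * n))) *
        ∫⁻ A : MatTuple n d, ENNReal.ofReal (gaussDens A) *
          (ENNReal.ofReal (tnorm n d A) * rootSum A) := by
  have hm : Measurable fun A : MatTuple n d => ENNReal.ofReal (gaussDens A) *
      (ENNReal.ofReal (tnorm n d A) * rootSum A) :=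
    continuous_gaussDens.measurable.ennreal_ofReal.mul
      (measurable_tnorm.ennreal_ofReal.mul measurable_rootSum)
  have hq : ∀ᵐ A : MatTuple n d, muTotal n d (r • A) =
      ENNReal.ofReal (tnorm n d (r • A)) * rootSum (r • A) :=
    Measure.QuasiMeasurePreserving.ae ⟨by fun_prop, by
      rw [Measure.map_addHaar_smul _ hr.ne']
      exact Measure.smul_absolutelyContinuous⟩ muTotal_ae_eq
  rw [lintegral_eq_comp_smul volume hr.ne' hm, finrank_matTuple, abs_of_pos hr,
    ← mul_assoc, ← ENNReal.ofReal_mul (by positivity), ← mul_pow, one_div_mul_cancel hr.ne',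
    one_pow, ENNReal.ofReal_one, one_mul]
  refine lintegral_congr_ae ?_
  filter_upwards [hq, muTotal_ae_eq] with A h1 h2
  rw [← h1, ← h2, muTotal_smul hr]

theorem rootSum_ae_eq [NeZero n] : ∀ᵐ A : MatTuple n d, rootSum A =
    ENNReal.ofReal (√(2 * π))⁻¹ * ∫⁻ x : ℝ, ENNReal.ofReal (rexp (-(tnorm n d A ^ 2 / 2) * x ^ 2)) *
      (ENNReal.ofReal (tnorm n d A) * rootSum A) := by
  filter_upwards [ae_ne_zero_matTuple] with A hA
  have ht := tnorm_pos hA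
  rw [lintegral_mul_const _ (by fun_prop), lintegral_exp_neg_mul_sq (by positivity), ← mul_assoc,
    ← mul_assoc, ← ENNReal.ofReal_mul (by positivity), ← ENNReal.ofReal_mul (by positivity),
    show π / (tnorm n d A ^ 2 / 2) = 2 * π / tnorm n d A ^ 2 by field_simp,
    Real.sqrt_div (by positivity), Real.sqrt_sq ht.le]
  have : (√(2 * π))⁻¹ * (√(2 * π) / tnorm n d A) * tnorm n d A = 1 := by
    have : √(2 * π) ≠ 0 := by positivity
    field_simp
  rw [this, ENNReal.ofReal_one, one_mul]

theorem measurable_gaussDens_smul_mul {H : MatTuple n d → ℝ≥0∞} (hH : Measurable H) :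
    Measurable fun p : MatTuple n d × ℝ =>
      ENNReal.ofReal (gaussDens (√(1 + p.2 ^ 2) • p.1)) * H p.1 := by
  have h : Measurable fun p : MatTuple n d × ℝ => √(1 + p.2 ^ 2) • p.1 := by
    have h0 : Measurable fun p : MatTuple n d × ℝ => √(1 + p.2 ^ 2) := by fun_prop
    refine measurable_pi_lambda _ fun i => measurable_pi_lambda _ fun j =>
      measurable_pi_lambda _ fun k => ?_
    exact h0.mul (by fun_prop)
  have h1 : Measurable fun p : MatTuple n d × ℝ => gaussDens (√(1 + p.2 ^ 2) • p.1) :=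
    continuous_gaussDens.measurable.comp h
  have h2 : Measurable fun p : MatTuple n d × ℝ => H p.1 := hH.comp measurable_fst
  exact h1.ennreal_ofReal.mul h2

theorem lintegral_rootSum_eq_mul_lintegral_muTotal [NeZero n]
    (hN : (1 : ℝ) / 2 < ((d : ℝ) + 1) * (n : ℝ) ^ 2 / 2) :
    ∫⁻ A, rootSum A ∂gaussTuple n d = ENNReal.ofReal ((√(2 * π))⁻¹ *
      (√π * (Gamma (((d : ℝ) + 1) * (n : ℝ) ^ 2 / 2 - 1 / 2) /
        Gamma (((d : ℝ) + 1) * (n : ℝ) ^ 2 / 2)))) * ∫⁻ A, muTotal n d A ∂gaussTuple n d := by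
  have hac : gaussTuple n d ≪ volume := by
    rw [gaussTuple_eq_withDensity]
    exact withDensity_absolutelyContinuous _ _
  have hH : Measurable fun A : MatTuple n d => ENNReal.ofReal (tnorm n d A) * rootSum A :=
    measurable_tnorm.ennreal_ofReal.mul measurable_rootSum
  rw [lintegral_congr_ae (hac.ae_le muTotal_ae_eq), lintegral_gaussTuple measurable_rootSum,
    lintegral_gaussTuple hH]
  have e1 : ∀ᵐ A : MatTuple n d, ENNReal.ofReal (gaussDens A) * rootSum A =
      ENNReal.ofReal (√(2 * π))⁻¹ * ∫⁻ x : ℝ, ENNReal.ofReal (gaussDens (√(1 + x ^ 2) • A)) *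
        (ENNReal.ofReal (tnorm n d A) * rootSum A) := by
    filter_upwards [rootSum_ae_eq (n := n) (d := d)] with A hA
    conv_lhs => rw [hA]
    rw [mul_left_comm, ← lintegral_const_mul' _ _ ENNReal.ofReal_ne_top]
    simp only [← gaussDens_mul_exp, ENNReal.ofReal_mul (gaussDens_pos A).le, mul_assoc]
  rw [lintegral_congr_ae e1, lintegral_const_mul' _ _ ENNReal.ofReal_ne_top,
    lintegral_lintegral_swap]
  · have e2 : ∀ x : ℝ, ∫⁻ A : MatTuple n d, ENNReal.ofReal (gaussDens (√(1 + x ^ 2) • A)) *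
        (ENNReal.ofReal (tnorm n d A) * rootSum A) =
        ENNReal.ofReal ((1 / (1 + x ^ 2)) ^ (((d : ℝ) + 1) * (n : ℝ) ^ 2 / 2)) *
          ∫⁻ A : MatTuple n d, ENNReal.ofReal (gaussDens A) *
          (ENNReal.ofReal (tnorm n d A) * rootSum A) := by
      intro x
      have hx : 0 < 1 + x ^ 2 := by positivity
      rw [lintegral_muTotal_mul_gaussDens_smul (Real.sqrt_pos.2 hx)]
      congr 2
      rw [← Real.sqrt_one, ← Real.sqrt_div zero_le_one, Real.sqrt_one, Real.sqrt_eq_rpow,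
        ← Real.rpow_natCast, ← Real.rpow_mul (by positivity)]
      push_cast
      ring_nf
    rw [lintegral_congr e2, lintegral_mul_const _ (by fun_prop), lintegral_one_add_sq_rpow hN,
      ← mul_assoc, ← ENNReal.ofReal_mul (by positivity)]
  · exact (measurable_gaussDens_smul_mul hH).aemeasurable

end Expectation

/-- **Expected condition number via the volume of the singular hypersurface**:
`E μ(A) = √π · Γ((d+1)n²/2)/Γ(((d+1)n²−1)/2) · ℋ^{n²−2}(Σ ∩ S^{n²−1}) / ℋ^{n²−2}(S^{n²−2})`,
where `Σ` is the set of singular `n × n` matrices. -/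
theorem expected_condition_number_eq_singular_volume_ratio (n d : ℕ)
    (hn : 2 ≤ n) (hd : 1 ≤ d) :
    ∫⁻ A, muTotal n d A ∂(gaussTuple n d) =
      ENNReal.ofReal
          (Real.sqrt π * (Real.Gamma ((((d : ℝ) + 1) * (n : ℝ) ^ 2) / 2) /
            Real.Gamma ((((d : ℝ) + 1) * (n : ℝ) ^ 2 - 1) / 2))) *
        μH[(n : ℝ) ^ 2 - 2] {M : EMat n | (matOfE n M).det = 0 ∧ ‖M‖ = 1} /
        μH[(n : ℝ) ^ 2 - 2] (Metric.sphere (0 : EuclideanSpace ℝ (Fin (n ^ 2 - 1))) 1) := by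
  have : NeZero n := ⟨by omega⟩
  have hN : (1 : ℝ) < ((d : ℝ) + 1) * (n : ℝ) ^ 2 := by
    have h1 : (2 : ℝ) ≤ n := by exact_mod_cast hn
    have h2 : (1 : ℝ) ≤ d := by exact_mod_cast hd
    nlinarith
  set N : ℝ := ((d : ℝ) + 1) * (n : ℝ) ^ 2 with hNdef
  have key := lintegral_rootSum_eq_mul_lintegral_muTotal (n := n) (d := d) (by linarith)
  rw [lintegral_rootSum hd, ← hNdef, show N / 2 - 1 / 2 = (N - 1) / 2 by ring] at key
  have g1 : 0 < Gamma (N / 2) := Gamma_pos_of_pos (by linarith)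
  have g2 : 0 < Gamma ((N - 1) / 2) := Gamma_pos_of_pos (by linarith)
  have hπ : √π ^ 2 = π := Real.sq_sqrt pi_pos.le
  set K : ℝ := (√(2 * π))⁻¹ * (√π * (Gamma ((N - 1) / 2) / Gamma (N / 2))) with hK
  have hK0 : 0 < K := by positivity
  have hc : √π * (Gamma (N / 2) / Gamma ((N - 1) / 2)) * √(2 * π) = K⁻¹ * π := by
    rw [hK]
    field_simp
    rw [hπ]
  rw [mul_div_assoc, hausdorffMeasure_singular_div_sphere hn, ← mul_assoc,
    ← ENNReal.ofReal_mul (by positivity), hc, ENNReal.ofReal_mul (by positivity), mul_assoc, key,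
    ← mul_assoc, ← ENNReal.ofReal_mul (by positivity), inv_mul_cancel₀ hK0.ne', ENNReal.ofReal_one,
    one_mul]

end PEVP
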